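/- arXiv:2003.07511 — 2 statements merged into one kernel-verified Lean document; each statement's English description precedes it below -/
import Mathlib

section
/- Let S be a Seidel matrix of order n with smallest eigenvalue exactly −5. If n ≥ 277, then the rank of S + 5I is at least ⌊2n/3⌋ + 1. -/
open Matrix

/-- A Seidel matrix: symmetric, zero diagonal, off-diagonal entries `±1`. -/
def IsSeidel {n : ℕ} (S : Matrix (Fin n) (Fin n) ℝ) : Prop :=
  S.IsSymm ∧ (∀ i, S i i = 0) ∧ ∀ i j, i ≠ j → S i j = 1 ∨ S i j = -1

/-- Smallest eigenvalue of a real symmetric matrix (junk value `0` if not Hermitian). -/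
noncomputable def minEig {m : Type*} [Fintype m] [DecidableEq m] (A : Matrix m m ℝ) : ℝ := by
  classical
  exact if hA : A.IsHermitian then ⨅ i, hA.eigenvalues i else 0

/-- Largest eigenvalue of a real symmetric matrix (junk value `0` if not Hermitian). -/
noncomputable def maxEig {m : Type*} [Fintype m] [DecidableEq m] (A : Matrix m m ℝ) : ℝ := by
  classical
  exact if hA : A.IsHermitian then ⨆ i, hA.eigenvalues i else 0

/-- The Seidel matrix of a simple graph `G`, i.e. `J - I - 2A(G)`:
zero diagonal, `-1` on adjacent pairs, `1` on distinct non-adjacent pairs. -/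
noncomputable def seidelOf {V : Type*} [Fintype V] (G : SimpleGraph V) : Matrix V V ℝ := by
  classical
  exact Matrix.of fun i j => if i = j then 0 else if G.Adj i j then -1 else 1

/-- Smallest eigenvalue of the Seidel matrix of a finite graph. -/
noncomputable def minSeidelEig {V : Type*} [Finite V] (G : SimpleGraph V) : ℝ := by
  classical
  letI := Fintype.ofFinite V
  exact minEig (seidelOf G)

/-- Spectral radius (largest adjacency eigenvalue) of a finite graph. -/
noncomputable def specRad {V : Type*} [Finite V] (G : SimpleGraph V) : ℝ := by
  classical
  letI := Fintype.ofFinite V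
  exact maxEig (G.adjMatrix ℝ)

/-- Switching equivalence: `T = D S D` for some diagonal `±1` matrix `D`. -/
def SwEquiv {n : ℕ} (S T : Matrix (Fin n) (Fin n) ℝ) : Prop :=
  ∃ ε : Fin n → ℝ, (∀ i, ε i = 1 ∨ ε i = -1) ∧
    T = Matrix.diagonal ε * S * Matrix.diagonal ε

/-- The switching graph of a Seidel matrix `S`: the graph on `2n` vertices whose Seidel
matrix is the block matrix `((S, I - S), (I - S, S))`, adjacency given by entries `-1`. -/
def switchGraph {n : ℕ} (S : Matrix (Fin n) (Fin n) ℝ) : SimpleGraph (Fin n ⊕ Fin n) :=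
  SimpleGraph.fromRel fun x y => Matrix.fromBlocks S (1 - S) (1 - S) S x y = -1

/-- Independence number of a graph. -/
noncomputable def indepNum {V : Type*} (G : SimpleGraph V) : ℕ := Gᶜ.cliqueNum

/-- The graph consisting of `t` disjoint copies of `K₂`. -/
def nK2 (t : ℕ) : SimpleGraph (Fin t × Fin 2) :=
  SimpleGraph.fromRel fun p q => p.1 = q.1

def qf {ι : Type*} [Fintype ι] (M : ι → ι → ℝ) (c d : ι → ℝ) : ℝ :=
  ∑ i, ∑ j, c i * d j * M i j

def Psd {ι : Type*} [Fintype ι] (M : ι → ι → ℝ) : Prop :=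
  (∀ i j, M i j = M j i) ∧ ∀ c, 0 ≤ qf M c c

lemma psd_iff {ι : Type*} [Fintype ι] (M : ι → ι → ℝ) : Psd M ↔ (Matrix.of M).PosSemidef := by
  have key : ∀ c : ι → ℝ, star c ⬝ᵥ (Matrix.of M *ᵥ c) = qf M c c := by
    intro c
    simp only [dotProduct, mulVec, qf, Matrix.of_apply, Finset.mul_sum, star_trivial]
    refine Finset.sum_congr rfl fun i _ => Finset.sum_congr rfl fun j _ => ?_
    ring
  rw [posSemidef_iff_dotProduct_mulVec]
  constructor
  · rintro ⟨h1, h2⟩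
    refine ⟨?_, fun x => by rw [key]; exact h2 x⟩
    ext i j
    simp [conjTranspose_apply, h1 j i]
  · rintro ⟨h1, h2⟩
    refine ⟨fun i j => ?_, fun c => by rw [← key]; exact h2 c⟩
    have := h1.apply i j
    simpa using this.symm

lemma qf_comm {ι : Type*} [Fintype ι] {M : ι → ι → ℝ} (h : ∀ i j, M i j = M j i)
    (c d : ι → ℝ) : qf M c d = qf M d c := by
  unfold qf
  rw [Finset.sum_comm]
  refine Finset.sum_congr rfl fun i _ => Finset.sum_congr rfl fun j _ => ?_
  rw [h j i]; ring

lemma qf_comb {ι : Type*} [Fintype ι] {M : ι → ι → ℝ} (h : ∀ i j, M i j = M j i)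
    (c d : ι → ℝ) (s t : ℝ) : qf M (fun i => s * c i + t * d i) (fun i => s * c i + t * d i)
      = s ^ 2 * qf M c c + 2 * s * t * qf M c d + t ^ 2 * qf M d d := by
  have h2 : 2 * s * t * qf M c d = s * t * qf M c d + s * t * qf M d c := by
    rw [qf_comm h d c]; ring
  rw [h2]
  simp only [qf, Finset.mul_sum, ← Finset.sum_add_distrib]
  refine Finset.sum_congr rfl fun i _ => Finset.sum_congr rfl fun j _ => ?_
  ring

lemma Psd.cs {ι : Type*} [Fintype ι] {M : ι → ι → ℝ} (h : Psd M)
    (c d : ι → ℝ) : qf M c d ^ 2 ≤ qf M c c * qf M d d := by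
  have h1 : ∀ t : ℝ, 0 ≤ qf M d d * (t * t) + (2 * qf M c d) * t + qf M c c := by
    intro t
    have := h.2 (fun i => 1 * c i + t * d i)
    rw [qf_comb h.1] at this
    linarith
  have := discrim_le_zero h1
  unfold discrim at this
  nlinarith

lemma Psd.hadamard' {ι : Type*} [Fintype ι] {M N : ι → ι → ℝ} (h : Psd M) (h' : Psd N) :
    Psd (fun i j => M i j * N i j ) := by
  rw [psd_iff] at h h' ⊢
  exact Matrix.PosSemidef.hadamard h h'

lemma Psd.sub {ι κ : Type*} [Fintype ι] [Fintype κ] {M : ι → ι → ℝ} (h : Psd M) (p : κ → ι) :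
    Psd (fun i j => M (p i) (p j)) := by
  rw [psd_iff] at h ⊢
  exact h.submatrix p

lemma tensor_ineq {ι : Type*} [Fintype ι] {P : ι → ι → ℝ} (h : Psd P) (l : ℝ) :
    0 ≤ ∑ i, ∑ j, P i j ^ 3 - 6 * l * ∑ i, (∑ j, P i j) * (∑ j, P i j ^ 2)
      + l ^ 2 * (3 * (∑ i, ∑ j, P i j) * (∑ i, ∑ j, P i j ^ 2)
        + 6 * qf P (fun i => ∑ j, P i j) (fun i => ∑ j, P i j)) := by
  have hs := h.1
  let κ := ι ⊕ (ι × ι) ⊕ (ι × ι) ⊕ (ι × ι)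
  let p : κ → ι := Sum.elim id (Sum.elim (fun x => x.1) (Sum.elim (fun x => x.2) (fun x => x.2)))
  let q : κ → ι := Sum.elim id (Sum.elim (fun x => x.2) (Sum.elim (fun x => x.1) (fun x => x.2)))
  let r : κ → ι := Sum.elim id (Sum.elim (fun x => x.2) (Sum.elim (fun x => x.2) (fun x => x.1)))
  let w : κ → ℝ := Sum.elim (fun _ => 1) (fun _ => -l)
  have H := (((h.sub p).hadamard' (h.sub q)).hadamard' (h.sub r)).2 w
  have a1 : ∑ i, (∑ j, P i j) * (∑ j, P i j ^ 2) = ∑ k, ∑ i, ∑ j, P k i * P k j * P k j := by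
    refine Finset.sum_congr rfl fun k _ => ?_
    rw [Finset.sum_mul_sum]
    refine Finset.sum_congr rfl fun i _ => Finset.sum_congr rfl fun j _ => ?_
    ring
  have a1' : ∑ k, ∑ i, ∑ j, P k i * P k j * P k j = ∑ i, ∑ j, ∑ k, P i k * P j k * P j k := by
    rw [Finset.sum_comm]
    refine Finset.sum_congr rfl fun i _ => ?_
    rw [Finset.sum_comm]
    refine Finset.sum_congr rfl fun j _ => Finset.sum_congr rfl fun k _ => ?_
    rw [hs k i, hs k j]
  have a2 : (∑ i, ∑ j, P i j) * (∑ i, ∑ j, P i j ^ 2)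
      = ∑ i, ∑ j, ∑ k, ∑ m, P i k * P j m * P j m := by
    rw [Finset.sum_mul_sum]
    refine Finset.sum_congr rfl fun i _ => Finset.sum_congr rfl fun j _ => ?_
    rw [Finset.sum_mul_sum]
    refine Finset.sum_congr rfl fun k _ => Finset.sum_congr rfl fun m _ => ?_
    ring
  have a3 : qf P (fun i => ∑ j, P i j) (fun i => ∑ j, P i j)
      = ∑ i, ∑ j, ∑ k, ∑ m, P i m * P j k * P j m := by
    unfold qf
    have e : ∀ i j, (∑ k, P i k) * (∑ m, P j m) * P i j = ∑ k, ∑ m, P k i * P j m * P i j := by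
      intro i j
      rw [Finset.sum_mul_sum, Finset.sum_mul]
      refine Finset.sum_congr rfl fun k _ => ?_
      rw [Finset.sum_mul]
      refine Finset.sum_congr rfl fun m _ => ?_
      rw [hs i k]
    simp only [e]
    -- ∑ i ∑ j ∑ k ∑ m, P k i * P j m * P i j ; rename (i,j,k,m) -> (m,j,i,k)
    calc ∑ i, ∑ j, ∑ k, ∑ m, P k i * P j m * P i j
        = ∑ j, ∑ i, ∑ k, ∑ m, P k i * P j m * P i j := Finset.sum_comm
      _ = ∑ j, ∑ k, ∑ i, ∑ m, P k i * P j m * P i j := by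
          refine Finset.sum_congr rfl fun j _ => Finset.sum_comm
      _ = ∑ k, ∑ j, ∑ i, ∑ m, P k i * P j m * P i j := Finset.sum_comm
      _ = ∑ k, ∑ j, ∑ m, ∑ i, P k i * P j m * P i j := by
          refine Finset.sum_congr rfl fun k _ => Finset.sum_congr rfl fun j _ => Finset.sum_comm
      _ = _ := by
          refine Finset.sum_congr rfl fun k _ => Finset.sum_congr rfl fun j _ =>
            Finset.sum_congr rfl fun m _ => Finset.sum_congr rfl fun i _ => ?_
          rw [hs i j]
  rw [mul_assoc 3, a2, a3, a1]
  have q0 : ∑ i, ∑ j, P i j ^ 3 = ∑ i, ∑ j, P i j * P i j * P i j := by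
    refine Finset.sum_congr rfl fun i _ => Finset.sum_congr rfl fun j _ => ?_
    ring
  rw [q0]
  simp only [qf, κ, p, q, r, w, Fintype.sum_sum_type, Fintype.sum_prod_type, Sum.elim_inl,
    Sum.elim_inr, id, one_mul, mul_one, ← Finset.mul_sum, Finset.sum_add_distrib] at H
  -- normal forms
  have b1 : ∑ k, ∑ i, ∑ j, P k j * P k i * P k j = ∑ k, ∑ i, ∑ j, P k i * P k j * P k j := by
    refine Finset.sum_congr rfl fun i _ => Finset.sum_congr rfl fun j _ => 
      Finset.sum_congr rfl fun k _ => by ring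
  have b2 : ∑ k, ∑ i, ∑ j, P k j * P k j * P k i = ∑ k, ∑ i, ∑ j, P k i * P k j * P k j := by
    refine Finset.sum_congr rfl fun i _ => Finset.sum_congr rfl fun j _ => 
      Finset.sum_congr rfl fun k _ => by ring
  have b3 : ∑ i, ∑ j, ∑ k, P j k * P i k * P j k = ∑ i, ∑ j, ∑ k, P i k * P j k * P j k := by
    refine Finset.sum_congr rfl fun i _ => Finset.sum_congr rfl fun j _ => 
      Finset.sum_congr rfl fun k _ => by ring
  have b4 : ∑ i, ∑ j, ∑ k, P j k * P j k * P i k = ∑ i, ∑ j, ∑ k, P i k * P j k * P j k := by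
    refine Finset.sum_congr rfl fun i _ => Finset.sum_congr rfl fun j _ => 
      Finset.sum_congr rfl fun k _ => by ring
  have c1 : ∑ i, ∑ j, ∑ k, ∑ m, P j m * P i k * P j m
      = ∑ i, ∑ j, ∑ k, ∑ m, P i k * P j m * P j m := by
    refine Finset.sum_congr rfl fun i _ => Finset.sum_congr rfl fun j _ =>
      Finset.sum_congr rfl fun k _ => Finset.sum_congr rfl fun m _ => by ring
  have c2 : ∑ i, ∑ j, ∑ k, ∑ m, P j m * P j m * P i k
      = ∑ i, ∑ j, ∑ k, ∑ m, P i k * P j m * P j m := by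
    refine Finset.sum_congr rfl fun i _ => Finset.sum_congr rfl fun j _ =>
      Finset.sum_congr rfl fun k _ => Finset.sum_congr rfl fun m _ => by ring
  have d1 : ∑ i, ∑ j, ∑ k, ∑ m, P i m * P j m * P j k
      = ∑ i, ∑ j, ∑ k, ∑ m, P i m * P j k * P j m := by
    refine Finset.sum_congr rfl fun i _ => Finset.sum_congr rfl fun j _ =>
      Finset.sum_congr rfl fun k _ => Finset.sum_congr rfl fun m _ => by ring
  have d2 : ∑ i, ∑ j, ∑ k, ∑ m, P j k * P i m * P j m
      = ∑ i, ∑ j, ∑ k, ∑ m, P i m * P j k * P j m := by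
    refine Finset.sum_congr rfl fun i _ => Finset.sum_congr rfl fun j _ =>
      Finset.sum_congr rfl fun k _ => Finset.sum_congr rfl fun m _ => by ring
  have d3 : ∑ i, ∑ j, ∑ k, ∑ m, P j k * P j m * P i m
      = ∑ i, ∑ j, ∑ k, ∑ m, P i m * P j k * P j m := by
    refine Finset.sum_congr rfl fun i _ => Finset.sum_congr rfl fun j _ =>
      Finset.sum_congr rfl fun k _ => Finset.sum_congr rfl fun m _ => by ring
  have d4 : ∑ i, ∑ j, ∑ k, ∑ m, P j m * P i m * P j k
      = ∑ i, ∑ j, ∑ k, ∑ m, P i m * P j k * P j m := by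
    refine Finset.sum_congr rfl fun i _ => Finset.sum_congr rfl fun j _ =>
      Finset.sum_congr rfl fun k _ => Finset.sum_congr rfl fun m _ => by ring
  have d5 : ∑ i, ∑ j, ∑ k, ∑ m, P j m * P j k * P i m
      = ∑ i, ∑ j, ∑ k, ∑ m, P i m * P j k * P j m := by
    refine Finset.sum_congr rfl fun i _ => Finset.sum_congr rfl fun j _ =>
      Finset.sum_congr rfl fun k _ => Finset.sum_congr rfl fun m _ => by ring
  rw [b1, b2, b3, b4, ← a1', c1, c2, d1, d2, d3, d4, d5] at H
  linarith

lemma stepA {m : ℕ} (hm : 276 ≤ m) (M : Fin (m+1) → Fin (m+1) → ℝ) (hp : Psd M)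
    (hd : ∀ i, M i i = 5) (ho : ∀ i j, i ≠ j → M i j = 1 ∨ M i j = -1)
    (hb : ∀ c, qf M c c ≤ ((m : ℝ) + 1) / 2 * ∑ i, c i ^ 2) : False := by
  obtain ⟨ε, hε⟩ : ∃ ε : Fin m → ℝ, ∀ i, ε i = M 0 i.succ := ⟨_, fun _ => rfl⟩
  have hε2 : ∀ i, ε i ^ 2 = 1 := by
    intro i
    rw [hε]
    rcases ho 0 i.succ (Fin.succ_ne_zero i).symm with h | h <;> rw [h] <;> norm_num
  have hε3 : ∀ i, M i.succ 0 = ε i := fun i => by rw [hp.1, hε]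
  obtain ⟨P, hP⟩ : ∃ P : Fin m → Fin m → ℝ, ∀ i j, P i j = 5 * ε i * ε j * M i.succ j.succ - 1 :=
    ⟨_, fun _ _ => rfl⟩
  have hPs : ∀ i j, P i j = P j i := by
    intro i j; rw [hP, hP, hp.1 i.succ j.succ]; ring
  obtain ⟨X, hX⟩ : ∃ X : (Fin m → ℝ) → ℝ, ∀ c, X c = ∑ i, ∑ j, c i * c j * (ε i * ε j * M i.succ j.succ) :=
    ⟨_, fun _ => rfl⟩
  have hq : ∀ (a : ℝ) (c : Fin m → ℝ), qf M (Fin.cons a (fun i => ε i * c i)) (Fin.cons a (fun i => ε i * c i))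
      = 5 * a ^ 2 + 2 * a * (∑ i, c i) + X c := by
    intro a c
    simp only [qf, Fin.sum_univ_succ, Fin.cons_zero, Fin.cons_succ, hd, ← hε, hε3,
      Finset.sum_add_distrib]
    have e1 : ∑ i, a * (ε i * c i) * ε i = a * ∑ i, c i := by
      rw [Finset.mul_sum]
      refine Finset.sum_congr rfl fun i _ => ?_
      linear_combination a * c i * hε2 i
    have e2 : ∑ i, (ε i * c i) * a * ε i = a * ∑ i, c i := by
      rw [Finset.mul_sum]
      refine Finset.sum_congr rfl fun i _ => ?_
      linear_combination a * c i * hε2 i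
    have e3 : ∑ i, ∑ j, ε i * c i * (ε j * c j) * M i.succ j.succ = X c := by
      rw [hX]
      refine Finset.sum_congr rfl fun i _ => Finset.sum_congr rfl fun j _ => ?_
      ring
    rw [e1, e2, e3]; ring
  have hPq : ∀ c, qf P c c = 5 * X c - (∑ i, c i) ^ 2 := by
    intro c
    rw [sq, Finset.sum_mul_sum, hX, Finset.mul_sum, ← Finset.sum_sub_distrib]
    refine Finset.sum_congr rfl fun i _ => ?_
    rw [Finset.mul_sum, ← Finset.sum_sub_distrib]
    refine Finset.sum_congr rfl fun j _ => ?_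
    rw [hP]; ring
  have hPp : Psd P := by
    refine ⟨hPs, fun c => ?_⟩
    have := hp.2 (Fin.cons (-(∑ i, c i) / 5) (fun i => ε i * c i))
    rw [hq] at this
    rw [hPq]
    nlinarith
  have hPb : ∀ c, qf P c c ≤ 5 * ((m : ℝ) + 1) / 2 * ∑ i, c i ^ 2 := by
    intro c
    have := hb (Fin.cons 0 (fun i => ε i * c i))
    rw [hq] at this
    simp only [Fin.sum_univ_succ, Fin.cons_zero, Fin.cons_succ, mul_pow, hε2, one_mul] at this
    rw [hPq]
    nlinarith [sq_nonneg (∑ i, c i)]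
  have hPd : ∀ i, P i i = 24 := by
    intro i; rw [hP, hd]; linear_combination 25 * hε2 i
  have hPo : ∀ i j, i ≠ j → P i j = 4 ∨ P i j = -6 := by
    intro i j hij
    have h1 : ε i = 1 ∨ ε i = -1 := by rw [hε]; exact ho 0 i.succ (Fin.succ_ne_zero i).symm
    have h2 : ε j = 1 ∨ ε j = -1 := by rw [hε]; exact ho 0 j.succ (Fin.succ_ne_zero j).symm
    have h3 := ho i.succ j.succ (fun h => hij (Fin.succ_injective _ h))
    rw [hP]
    rcases h1 with h1 | h1 <;> rcases h2 with h2 | h2 <;> rcases h3 with h3 | h3 <;> rw [h1, h2, h3] <;> norm_num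
  have sq_id : ∀ i j, P i j ^ 2 = 24 - 2 * P i j + if i = j then 600 else 0 := by
    intro i j
    by_cases h : i = j
    · subst h; rw [hPd]; norm_num
    · rcases hPo i j h with h' | h' <;> rw [h', if_neg h] <;> norm_num
  have cu_id : ∀ i j, P i j ^ 3 = 28 * P i j - 48 + if i = j then 13200 else 0 := by
    intro i j
    by_cases h : i = j
    · subst h; rw [hPd]; norm_num
    · rcases hPo i j h with h' | h' <;> rw [h', if_neg h] <;> norm_num
  obtain ⟨τ, hτ⟩ : ∃ τ : Fin m → ℝ, ∀ i, τ i = ∑ j, P i j := ⟨_, fun _ => rfl⟩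
  obtain ⟨R, hR⟩ : ∃ R : ℝ, R = ∑ i, τ i := ⟨_, rfl⟩
  obtain ⟨X1, hX1⟩ : ∃ R : ℝ, R = ∑ i, τ i ^ 2 := ⟨_, rfl⟩
  obtain ⟨X2, hX2⟩ : ∃ R : ℝ, R = qf P τ τ := ⟨_, rfl⟩
  have T := tensor_ineq hPp (1 / (2 * (m : ℝ)))
  have hρ : ∀ i, ∑ j, P i j ^ 2 = 24 * m + 600 - 2 * τ i := by
    intro i
    simp only [sq_id, Finset.sum_add_distrib, Finset.sum_sub_distrib, ← Finset.mul_sum, hτ]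
    simp; ring
  have hρ3 : ∀ i, ∑ j, P i j ^ 3 = 28 * τ i - 48 * m + 13200 := by
    intro i
    simp only [cu_id, Finset.sum_add_distrib, Finset.sum_sub_distrib, ← Finset.mul_sum, hτ]
    simp; ring
  simp only [hρ, hρ3, ← hτ] at T
  have s1 : ∑ i, τ i * (24 * m + 600 - 2 * τ i) = (24 * m + 600) * R - 2 * X1 := by
    rw [hR, hX1, Finset.mul_sum, Finset.mul_sum, ← Finset.sum_sub_distrib]
    exact Finset.sum_congr rfl fun i _ => by ring
  have s2 : ∑ i : Fin m, (24 * (m : ℝ) + 600 - 2 * τ i) = 24 * m ^ 2 + 600 * m - 2 * R := by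
    simp only [Finset.sum_sub_distrib, ← Finset.mul_sum, ← hR]
    simp; ring
  have s3 : ∑ i : Fin m, (28 * τ i - 48 * (m : ℝ) + 13200) = 28 * R - 48 * m ^ 2 + 13200 * m := by
    simp only [Finset.sum_sub_distrib, Finset.sum_add_distrib, ← Finset.mul_sum, ← hR]
    simp; ring
  rw [s1, s2, s3, ← hR] at T
  have e : (fun i => τ i) = τ := rfl
  rw [e, ← hX2] at T
  have hm' : (276 : ℝ) ≤ m := by exact_mod_cast hm
  have hm0 : (0 : ℝ) < m := by linarith
  have T2 : 0 ≤ 4 * (m:ℝ)^2 * (28 * R - 48 * m ^ 2 + 13200 * m)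
      - 12 * m * ((24 * m + 600) * R - 2 * X1) + (3 * R * (24 * m ^ 2 + 600 * m - 2 * R) + 6 * X2) := by
    have := mul_nonneg (show (0:ℝ) ≤ 4 * m ^ 2 by positivity) T
    refine this.trans (le_of_eq ?_)
    field_simp
    ring
  have hRq : qf P (fun _ => 1) (fun _ => 1) = R := by
    rw [hR]; simp [qf, hτ]
  have hX1q : qf P τ (fun _ => 1) = X1 := by
    rw [hX1]; simp only [qf, mul_one, ← Finset.mul_sum, ← hτ, sq]
  have hR0 : 0 ≤ R := by rw [← hRq]; exact hPp.2 _
  have hX10 : 0 ≤ X1 := by rw [hX1]; exact Finset.sum_nonneg fun i _ => sq_nonneg _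
  have hX2b : X2 ≤ 5 * ((m : ℝ) + 1) / 2 * X1 := by rw [hX2, hX1]; exact hPb τ
  have hX1b : X1 ≤ 5 * ((m : ℝ) + 1) / 2 * R := by
    have := hPp.cs τ (fun _ => 1)
    rw [hX1q, hRq, ← hX2] at this
    rcases hX10.eq_or_lt with h | h
    · rw [← h]; positivity
    · have h3 : X1 * X1 ≤ X1 * (5 * ((m : ℝ) + 1) / 2 * R) := by nlinarith
      exact le_of_mul_le_mul_left h3 h
  have k1 : X2 ≤ (5 * ((m : ℝ) + 1) / 2) ^ 2 * R := by
    have := mul_le_mul_of_nonneg_left hX1b (show 0 ≤ 5 * ((m : ℝ) + 1) / 2 by positivity)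
    linarith
  have k2 : 24 * m * X1 ≤ 24 * m * (5 * ((m : ℝ) + 1) / 2 * R) :=
    mul_le_mul_of_nonneg_left hX1b (by positivity)
  have k3 : 0 ≤ R * (13 / 2 * (m:ℝ) ^ 2 + 5265 * m - 75/2) := mul_nonneg hR0 (by nlinarith)
  have k4 : 0 < 192 * (m:ℝ) ^ 3 * (m - 275) := mul_pos (by positivity) (by linarith)
  nlinarith [sq_nonneg R]

set_option maxHeartbeats 800000 in
lemma numB {n Θ Q K : ℝ} (hn : 277 ≤ n) (hΘ : n / 2 < Θ) (hQ : Θ ^ 2 ≤ n * Q) (hK : 0 ≤ K)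
    (h1 : 2 * K ≤ 24 * (Q - Θ ^ 2 / (n + 24)) - (Q - Θ ^ 2 / (n + 24)) ^ 2)
    (h2 : 0 ≤ 120 * Θ - 2 * Θ ^ 2 - 72 * Q + 2 * Q ^ 2 + 3 * K) :
    n - 21 ≤ Θ ∧ Θ ≤ n + 12 ∧ K ≤ 54 ∧ Q ≤ Θ ^ 2 / (n + 24) + 24 := by
  obtain ⟨N, hN⟩ : ∃ N, N = n + 24 := ⟨_, rfl⟩
  obtain ⟨h, hh⟩ : ∃ h, h = Θ ^ 2 / N := ⟨_, rfl⟩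
  obtain ⟨g, hg⟩ : ∃ g, g = Q - h := ⟨_, rfl⟩
  rw [← hN, ← hh] at h1
  rw [← hg] at h1
  rw [← hN, ← hh]
  have hN0 : 301 ≤ N := by linarith
  have hhN : h * N = Θ ^ 2 := by rw [hh]; field_simp
  have hg0 : 0 ≤ g := by nlinarith
  have hg24 : g ≤ 24 := by nlinarith
  have hQ' : Q = h + g := by linarith
  have hΘ0 : 0 < Θ := by linarith
  have hh0 : 0 ≤ h := by rw [hh]; positivity
  have hn' : n = N - 24 := by linarith
  subst hn'
  subst hQ'
  have e1 : 24 * Θ ^ 2 ≤ g * ((N - 24) * N) := by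
    have h3 : Θ ^ 2 * N ≤ ((N - 24) * (h + g)) * N := mul_le_mul_of_nonneg_right hQ (by linarith)
    have h4 : ((N - 24) * (h + g)) * N = (N - 24) * (h * N) + g * ((N - 24) * N) := by ring
    rw [h4, hhN] at h3
    linarith
  have hNN : 0 < (N - 24) * N := by nlinarith
  have u1 : Θ ^ 2 ≤ (N - 24) * N := by
    have := mul_le_mul_of_nonneg_right hg24 hNN.le
    linarith
  have u2 : Θ ≤ N - 12 := by
    by_contra hc
    push Not at hc
    nlinarith
  have f1 : h * (N - 12) - h ^ 2 ≤ 60 * Θ := by nlinarith [mul_nonneg hh0 (sub_nonneg.2 hg24)]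
  have f2 : Θ ^ 2 * (N - 12) * N - Θ ^ 4 ≤ 60 * Θ * N ^ 2 := by
    have := mul_le_mul_of_nonneg_right f1 (show 0 ≤ N ^ 2 by positivity)
    calc Θ ^ 2 * (N - 12) * N - Θ ^ 4 = (h * N) * (N - 12) * N - (h * N) ^ 2 := by rw [hhN]; ring
      _ ≤ _ := by linarith
  have f3 : Θ * (N - 12) * N - Θ ^ 3 - 60 * N ^ 2 ≤ 0 := by
    have : Θ * (Θ * (N - 12) * N - Θ ^ 3 - 60 * N ^ 2) ≤ 0 := by linarith
    by_contra hc
    push Not at hc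
    linarith [mul_pos hΘ0 hc]
  have l1 : N - 45 ≤ Θ := by
    by_contra hc
    push Not at hc
    obtain ⟨a, ha⟩ : ∃ a, a = (N - 24) / 2 := ⟨_, rfl⟩
    obtain ⟨b, hb⟩ : ∃ b, b = N - 45 := ⟨_, rfl⟩
    have hab : 0 < b - a := by linarith
    have haΘ : 0 < Θ - a := by linarith
    have hbΘ : 0 < b - Θ := by linarith
    have Fa : 0 < a * (N - 12) * N - a ^ 3 - 60 * N ^ 2 := by
      rw [ha]
      have : 0 < (N - 301) * ((N - 301)^2) * (3/8) + (N-301)^2 * 100 + (N-301) * 100 + 1 := by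
        have : 0 ≤ N - 301 := by linarith
        positivity
      nlinarith [mul_nonneg (sub_nonneg.2 hN0) (sub_nonneg.2 hN0)]
    have Fb : 0 < b * (N - 12) * N - b ^ 3 - 60 * N ^ 2 := by
      rw [hb]
      nlinarith
    have key : (b - a) * (Θ * (N - 12) * N - Θ ^ 3 - 60 * N ^ 2)
        = (b - Θ) * (a * (N - 12) * N - a ^ 3 - 60 * N ^ 2)
          + (Θ - a) * (b * (N - 12) * N - b ^ 3 - 60 * N ^ 2)
          + (b - a) * ((Θ - a) * (b - Θ) * (Θ + a + b)) := by ring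
    have p1 := mul_pos hbΘ Fa
    have p2 := mul_pos haΘ Fb
    have hs : 0 < Θ + a + b := by linarith
    have p3 : 0 < (b - a) * ((Θ - a) * (b - Θ) * (Θ + a + b)) := by positivity
    have p4 := mul_nonneg hab.le (neg_nonneg.2 f3)
    linarith
  have g18 : 18 ≤ g := by
    have e2 : (N - 45) ^ 2 ≤ Θ ^ 2 := pow_le_pow_left₀ (by linarith) l1 2
    have e4 : 18 * ((N - 24) * N) ≤ 24 * (N - 45) ^ 2 := by
      nlinarith only [hN0, sq_nonneg (N - 301)]
    have e3 : 18 * ((N - 24) * N) ≤ g * ((N - 24) * N) := by linarith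
    exact le_of_mul_le_mul_right e3 hNN
  exact ⟨by linarith, by linarith, by nlinarith only [h1, g18, hg24], by linarith⟩

lemma numC {n Θ Q K u w : ℝ} (hn : 277 ≤ n) (h1 : n - 21 ≤ Θ) (h2 : Θ ≤ n + 12) (hK : K ≤ 54)
    (hQ : Q ≤ Θ ^ 2 / (n + 24) + 24) (hu : 0 ≤ u) (hw : w ^ 2 ≤ u * (5 - u) * K)
    (hY : Θ + 24 * u - u * Q - 2 * w ≤ 12 * (5 - u)) : 3 / 4 ≤ u := by
  by_contra hc
  push Not at hc
  obtain ⟨N, hN⟩ : ∃ N, N = n + 24 := ⟨_, rfl⟩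
  obtain ⟨h, hh⟩ : ∃ h, h = Θ ^ 2 / N := ⟨_, rfl⟩
  rw [← hN, ← hh] at hQ
  have hN0 : 301 ≤ N := by linarith
  have hhN : h * N = Θ ^ 2 := by rw [hh]; field_simp
  have hn' : n = N - 24 := by linarith
  subst hn'
  have e1 : u * (5 - u) ≤ 3.1875 := by nlinarith
  have e0 : 0 ≤ u * (5 - u) := by nlinarith
  have e2 : w ^ 2 ≤ 13.12 ^ 2 := by nlinarith
  have e3 : w ≤ 13.12 := abs_le_of_sq_le_sq' e2 (by norm_num) |>.2
  have h12 : 12 ≤ h := by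
    have : 12 * N ≤ h * N := by rw [hhN]; nlinarith
    exact le_of_mul_le_mul_right this (by linarith)
  have e4 : u * (Q - 36) ≤ 3 / 4 * (h - 12) := by nlinarith
  have e5 : Θ ≤ 77.24 + 3 / 4 * h := by linarith
  have e6 : Θ * N ≤ 77.24 * N + 3 / 4 * Θ ^ 2 := by rw [← hhN]; nlinarith
  nlinarith [mul_nonneg (sub_nonneg.2 h1) (sub_nonneg.2 h2)]

lemma numD {u d : ℝ} (hu : 3 / 4 ≤ u) (h : 2.296875 * d + u * (5 - u) ^ 2 ≤ 12 * (5 - u)) : d < 17 := by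
  nlinarith [mul_nonneg (sub_nonneg.2 hu) (sq_nonneg (u - 3)), sq_nonneg (u - 3)]

lemma exists_eig {n : ℕ} (M : Fin n → Fin n → ℝ) (hs : ∀ i j, M i j = M j i) (b : ℝ)
    (h : ¬ ∀ c, qf M c c ≤ b * ∑ i, c i ^ 2) :
    ∃ (Θ : ℝ) (v : Fin n → ℝ), b < Θ ∧ v ≠ 0 ∧ ∀ i, ∑ j, M i j * v j = Θ * v i := by
  have hq : ∀ c, qf (fun i j => (if i = j then b else 0) - M i j) c c
      = b * ∑ i, c i ^ 2 - qf M c c := by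
    intro c
    simp only [qf, Finset.mul_sum, mul_sub, Finset.sum_sub_distrib]
    congr 1
    refine Finset.sum_congr rfl fun i _ => ?_
    simp; ring
  have h1 : ¬ Psd (fun i j => (if i = j then b else 0) - M i j) := by
    intro h2
    exact h fun c => by have := h2.2 c; rw [hq] at this; linarith
  rw [psd_iff] at h1
  have hH : (Matrix.of (fun i j => (if i = j then b else 0) - M i j)).IsHermitian := by
    ext i j
    simp [conjTranspose_apply, hs j i, eq_comm]
  rw [hH.posSemidef_iff_eigenvalues_nonneg] at h1
  have h1' : ∃ k, hH.eigenvalues k < 0 := by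
    by_contra hc
    push Not at hc
    exact h1 hc
  obtain ⟨k, hk⟩ := h1'
  refine ⟨b - hH.eigenvalues k, (hH.eigenvectorBasis k).ofLp, by linarith, ?_, ?_⟩
  · intro h0
    have h2 := hH.eigenvectorBasis.orthonormal.ne_zero k
    apply h2
    ext i
    exact congrFun h0 i
  · intro i
    have h2 := congrFun (hH.mulVec_eigenvectorBasis k) i
    simp only [mulVec, dotProduct, Matrix.of_apply, sub_mul, Finset.sum_sub_distrib, ite_mul,
      zero_mul, Finset.sum_ite_eq, Finset.mem_univ, if_true, Pi.smul_apply, smul_eq_mul] at h2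
    linarith

lemma stepA' {n : ℕ} (hn : 277 ≤ n) (M : Fin n → Fin n → ℝ) (hp : Psd M)
    (hd : ∀ i, M i i = 5) (ho : ∀ i j, i ≠ j → M i j = 1 ∨ M i j = -1) :
    ∃ (Θ : ℝ) (s : Fin n → ℝ), (n : ℝ) / 2 < Θ ∧ ∑ i, s i ^ 2 = Θ ∧
      ∀ i, ∑ j, M i j * s j = Θ * s i := by
  obtain ⟨m, rfl⟩ : ∃ m, n = m + 1 := ⟨n - 1, by omega⟩
  obtain ⟨Θ, v, h1, h2, h3⟩ := exists_eig M hp.1 (((m + 1 : ℕ) : ℝ) / 2) (fun h =>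
    stepA (by omega) M hp hd ho (fun c => by simpa using h c))
  have hΘ : 0 < Θ := lt_of_le_of_lt (by positivity) h1
  have hv : 0 < ∑ i, v i ^ 2 := by
    obtain ⟨i, hi⟩ := Function.ne_iff.1 h2
    exact Finset.sum_pos' (fun i _ => sq_nonneg _) ⟨i, Finset.mem_univ _, by
      have : v i ≠ 0 := hi
      positivity⟩
  obtain ⟨t, ht⟩ : ∃ t : ℝ, t ^ 2 * ∑ i, v i ^ 2 = Θ := by
    refine ⟨Real.sqrt (Θ / ∑ i, v i ^ 2), ?_⟩
    rw [Real.sq_sqrt (by positivity)]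
    field_simp
  refine ⟨Θ, fun i => t * v i, h1, ?_, fun i => ?_⟩
  · rw [← ht, Finset.mul_sum]
    exact Finset.sum_congr rfl fun i _ => by ring
  · have : ∑ j, M i j * (t * v j) = t * ∑ j, M i j * v j := by
      rw [Finset.mul_sum]
      exact Finset.sum_congr rfl fun i _ => by ring
    rw [this, h3]; ring

set_option maxHeartbeats 800000 in
lemma stepD {n : ℕ} (hn : 277 ≤ n) (M : Fin n → Fin n → ℝ) (hp : Psd M)
    (hd : ∀ i, M i i = 5) (ho : ∀ i j, i ≠ j → M i j = 1 ∨ M i j = -1) :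
    ∃ ε : Fin n → ℝ, (∀ i, ε i = 1 ∨ ε i = -1) ∧
      ∀ x, (Finset.univ.filter (fun i => i ≠ x ∧ ε x * ε i * M x i = -1)).card ≤ 16 := by
  classical
  obtain ⟨Θ, s, hΘ, hsΘ, hM⟩ := stepA' hn M hp hd ho
  have hnR : (277 : ℝ) ≤ n := by exact_mod_cast hn
  have hΘ0 : 0 < Θ := by linarith
  obtain ⟨N, hN⟩ : ∃ N : Fin n → Fin n → ℝ, ∀ i j, N i j = M i j - s i * s j := ⟨_, fun _ _ => rfl⟩
  have hM2 : ∀ i j, M i j ^ 2 = 1 + if i = j then 24 else 0 := by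
    intro i j
    by_cases h : i = j
    · subst h; rw [hd]; norm_num
    · rcases ho i j h with h' | h' <;> rw [h', if_neg h] <;> norm_num
  have hM3 : ∀ i j, M i j ^ 3 = M i j + if i = j then 120 else 0 := by
    intro i j
    by_cases h : i = j
    · subst h; rw [hd]; norm_num
    · rcases ho i j h with h' | h' <;> rw [h', if_neg h] <;> norm_num
  have hNs : ∀ i, ∑ j, N i j * s j = 0 := by
    intro i
    have : ∑ j, N i j * s j = ∑ j, M i j * s j - s i * ∑ j, s j ^ 2 := by
      rw [Finset.mul_sum, ← Finset.sum_sub_distrib]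
      exact Finset.sum_congr rfl fun j _ => by rw [hN]; ring
    rw [this, hM, hsΘ]; ring
  have hqN : ∀ c, qf N c c = qf M c c - (∑ i, c i * s i) ^ 2 := by
    intro c
    rw [sq, Finset.sum_mul_sum]
    simp only [qf, ← Finset.sum_sub_distrib]
    refine Finset.sum_congr rfl fun i _ => Finset.sum_congr rfl fun j _ => ?_
    rw [hN]; ring
  have hqMs : ∀ c, qf M c s = Θ * ∑ i, c i * s i := by
    intro c
    rw [Finset.mul_sum]
    unfold qf
    refine Finset.sum_congr rfl fun i _ => ?_
    have : ∑ j, c i * s j * M i j = c i * ∑ j, M i j * s j := by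
      rw [Finset.mul_sum]
      exact Finset.sum_congr rfl fun j _ => by ring
    rw [this, hM]; ring
  have hNp : Psd N := by
    refine ⟨fun i j => by rw [hN, hN, hp.1 i j]; ring, fun c => ?_⟩
    have h1 := hp.cs c s
    have h2 : ∑ i, s i * s i = Θ := by rw [← hsΘ]; exact Finset.sum_congr rfl fun i _ => by ring
    rw [hqMs, hqMs s, h2] at h1
    rw [hqN]
    have h3 : Θ ^ 2 * (∑ i, c i * s i) ^ 2 ≤ Θ ^ 2 * qf M c c := by nlinarith
    have := le_of_mul_le_mul_left h3 (by positivity)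
    linarith
  obtain ⟨u, hu⟩ : ∃ u : Fin n → ℝ, ∀ i, u i = s i ^ 2 := ⟨_, fun _ => rfl⟩
  have hu0 : ∀ i, 0 ≤ u i := fun i => by rw [hu]; positivity
  have hsu : ∑ i, u i = Θ := by rw [← hsΘ]; exact Finset.sum_congr rfl fun i _ => hu i
  have hN2 : ∀ i j, N i j ^ 2 = 1 + (if i = j then 24 else 0) - u i * u j - 2 * (s i * s j * N i j) := by
    intro i j
    rw [← hM2, hN, hu, hu]; ring
  obtain ⟨K, hK⟩ : ∃ K : (Fin n → ℝ) → ℝ, ∀ c, K c = qf N (fun i => s i * c i) (fun i => s i * c i) :=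
    ⟨_, fun _ => rfl⟩
  have B1 : ∀ c, 2 * K c ≤ (∑ i, c i) ^ 2 + 24 * ∑ i, c i ^ 2 - (∑ i, u i * c i) ^ 2 := by
    intro c
    have h1 := (hNp.hadamard' hNp).2 c
    have h2 : qf (fun i j => N i j * N i j) c c
        = (∑ i, c i) ^ 2 + 24 * ∑ i, c i ^ 2 - (∑ i, u i * c i) ^ 2 - 2 * K c := by
      rw [hK, sq, sq (∑ i, u i * c i), Finset.sum_mul_sum, Finset.sum_mul_sum]
      have h3 : 24 * ∑ i, c i ^ 2 = ∑ i, ∑ j, c i * c j * (if i = j then 24 else 0) := by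
        rw [Finset.mul_sum]
        refine Finset.sum_congr rfl fun i _ => ?_
        simp; ring
      rw [h3]
      simp only [qf, Finset.mul_sum, ← Finset.sum_sub_distrib, ← Finset.sum_add_distrib]
      refine Finset.sum_congr rfl fun i _ => Finset.sum_congr rfl fun j _ => ?_
      rw [← sq, hN2]; ring
    linarith
  obtain ⟨Q, hQ⟩ : ∃ Q : ℝ, Q = ∑ i, u i ^ 2 := ⟨_, rfl⟩
  have hK0 : 0 ≤ K u := by rw [hK]; exact hNp.2 _
  have hQΘ : Θ ^ 2 ≤ n * Q := by
    have := sq_sum_le_card_mul_sum_sq (s := (Finset.univ : Finset (Fin n))) (f := u)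
    rw [hsu, ← hQ] at this
    simpa using this
  have B2 : 2 * K u ≤ 24 * (Q - Θ ^ 2 / (n + 24)) - (Q - Θ ^ 2 / (n + 24)) ^ 2 := by
    obtain ⟨t, ht⟩ : ∃ t : ℝ, t = Θ / (n + 24) := ⟨_, rfl⟩
    have htn : t * (n + 24) = Θ := by rw [ht]; field_simp
    have h1 := B1 (fun i => u i - t)
    have h2 : K (fun i => u i - t) = K u := by
      have hz : ∀ c : Fin n → ℝ, qf N c s = 0 := by
        intro c
        unfold qf
        refine Finset.sum_eq_zero fun i _ => ?_
        have : ∑ j, c i * s j * N i j = c i * ∑ j, N i j * s j := by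
          rw [Finset.mul_sum]
          exact Finset.sum_congr rfl fun j _ => by ring
        rw [this, hNs]; ring
      have := qf_comb hNp.1 (fun i => s i * u i) s 1 (-t)
      rw [hz, hz, ← hK] at this
      rw [hK]
      have e : (fun i => s i * (u i - t)) = fun i => 1 * (s i * u i) + -t * s i := by
        funext i; ring
      rw [e, this]; ring
    have h3 : ∑ i, (u i - t) = Θ - n * t := by
      rw [Finset.sum_sub_distrib, hsu]; simp
    have h4 : ∑ i, (u i - t) ^ 2 = Q - 2 * t * Θ + n * t ^ 2 := by
      have : ∀ i, (u i - t) ^ 2 = u i ^ 2 - 2 * t * u i + t ^ 2 := fun i => by ring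
      simp only [this, Finset.sum_add_distrib, Finset.sum_sub_distrib, ← Finset.mul_sum, hsu, ← hQ]
      simp
    have h5 : ∑ i, u i * (u i - t) = Q - t * Θ := by
      have : ∀ i, u i * (u i - t) = u i ^ 2 - t * u i := fun i => by ring
      simp only [this, Finset.sum_sub_distrib, ← Finset.mul_sum, hsu, ← hQ]
    rw [h2, h3, h4, h5] at h1
    have h6 : Θ ^ 2 / (n + 24) = t * Θ := by rw [ht]; field_simp
    rw [h6]
    refine h1.trans (le_of_eq ?_)
    rw [← htn]; ring
  have B3 : 0 ≤ 120 * Θ - 2 * Θ ^ 2 - 72 * Q + 2 * Q ^ 2 + 3 * K u := by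
    have h1 := ((hNp.hadamard' hNp).hadamard' hNp).2 s
    have h2 : qf (fun i j => N i j * N i j * N i j) s s
        = qf M s s + 120 * ∑ i, s i ^ 2 - 3 * (∑ i, u i) ^ 2 - 72 * ∑ i, u i ^ 2
          + 2 * (∑ i, u i ^ 2) ^ 2 + 3 * K u := by
      rw [hK, sq (∑ i, u i), sq (∑ i, u i ^ 2), Finset.sum_mul_sum, Finset.sum_mul_sum]
      have h3 : 120 * ∑ i, s i ^ 2 = ∑ i, ∑ j, s i * s j * (if i = j then 120 else 0) := by
        rw [Finset.mul_sum]
        refine Finset.sum_congr rfl fun i _ => ?_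
        simp; ring
      have h4 : 72 * ∑ i, u i ^ 2 = ∑ i, ∑ j, 3 * (u i * u j) * (if i = j then 24 else 0) := by
        rw [Finset.mul_sum]
        refine Finset.sum_congr rfl fun i _ => ?_
        simp; ring
      rw [h3, h4]
      simp only [qf, Finset.mul_sum, ← Finset.sum_sub_distrib, ← Finset.sum_add_distrib]
      refine Finset.sum_congr rfl fun i _ => Finset.sum_congr rfl fun j _ => ?_
      have e2 := hM2 i j
      have e3 := hM3 i j
      rw [hN, hu, hu]
      linear_combination (s i * s j) * e3 - 3 * (s i ^ 2 * s j ^ 2) * e2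
    have h5 : qf M s s = Θ ^ 2 := by
      rw [hqMs]
      have h2 : ∑ i, s i * s i = Θ := by rw [← hsΘ]; exact Finset.sum_congr rfl fun i _ => by ring
      rw [h2]; ring
    rw [h2, h5, hsΘ, hsu, ← hQ] at h1
    linarith
  obtain ⟨C1, C2, C3, C4⟩ := numB hnR hΘ hQΘ hK0 B2 B3
  have hNd : ∀ x, N x x = 5 - u x := fun x => by rw [hN, hd, hu]; ring
  have hsing : ∀ x d, qf N (Pi.single x 1) d = ∑ j, d j * N x j := by
    intro x d
    unfold qf
    rw [Finset.sum_eq_single x]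
    · simp
    · intro b _ hb; simp [hb]
    · simp
  have hsing2 : ∀ x, qf N (Pi.single x 1) (Pi.single x 1) = N x x := by
    intro x
    rw [hsing, Finset.sum_eq_single x]
    · simp
    · intro b _ hb; simp [hb]
    · simp
  have hNd0 : ∀ x, 0 ≤ N x x := fun x => by rw [← hsing2]; exact hNp.2 _
  have hY : ∀ x, ∑ i, u i * N x i ^ 2 ≤ 12 * (5 - u x) := by
    intro x
    obtain ⟨Y, hYd⟩ : ∃ Y : ℝ, Y = ∑ i, u i * N x i ^ 2 := ⟨_, rfl⟩
    have h1 := B1 (fun i => s i * N x i)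
    have h2 : ∑ i, s i * N x i = 0 := by
      rw [← hNs x]; exact Finset.sum_congr rfl fun i _ => by ring
    have h3 : ∑ i, (s i * N x i) ^ 2 = Y := by
      rw [hYd]; exact Finset.sum_congr rfl fun i _ => by rw [hu]; ring
    rw [h2, h3] at h1
    have h4 : K (fun i => s i * N x i) ≤ 12 * Y := by
      nlinarith [sq_nonneg (∑ i, u i * (s i * N x i))]
    have h5 := hNp.cs (Pi.single x 1) (fun i => s i * (s i * N x i))
    rw [← hK, hsing2, hsing] at h5
    have h6 : ∑ j, s j * (s j * N x j) * N x j = Y := by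
      rw [hYd]; exact Finset.sum_congr rfl fun i _ => by rw [hu]; ring
    rw [h6] at h5
    have hY0 : 0 ≤ Y := by
      rw [hYd]; exact Finset.sum_nonneg fun i _ => mul_nonneg (hu0 i) (sq_nonneg _)
    rw [← hYd, ← hNd]
    rcases hY0.eq_or_lt with h | h
    · rw [← h]; linarith [hNd0 x]
    · have h7 : Y * Y ≤ Y * (12 * N x x) := by
        nlinarith [mul_le_mul_of_nonneg_left h4 (hNd0 x)]
      exact le_of_mul_le_mul_left h7 h
  have hu34 : ∀ x, 3 / 4 ≤ u x := by
    intro x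
    obtain ⟨z, hz⟩ : ∃ z : ℝ, z = ∑ j, s j * u j * N x j := ⟨_, rfl⟩
    have h1 := hNp.cs (Pi.single x 1) (fun i => s i * u i)
    rw [← hK, hsing2, hsing, ← hz] at h1
    have h2 : (s x * z) ^ 2 ≤ u x * (5 - u x) * K u := by
      have := mul_le_mul_of_nonneg_left h1 (hu0 x)
      rw [mul_pow, ← hu, ← hNd]
      linarith
    refine numC hnR C1 C2 C3 C4 (hu0 x) h2 (le_trans (le_of_eq ?_) (hY x))
    have e : ∀ i, u i * N x i ^ 2 = u i + (if x = i then 24 * u i else 0) - u x * u i ^ 2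
        - 2 * (s x * (s i * u i * N x i)) := by
      intro i
      rw [hN2]
      split_ifs <;> ring
    simp only [e, Finset.sum_sub_distrib, Finset.sum_add_distrib, ← Finset.mul_sum, hsu, ← hQ, ← hz]
    simp
  refine ⟨fun i => if 0 ≤ s i then 1 else -1, fun i => ?_, fun x => ?_⟩
  · by_cases h : 0 ≤ s i <;> simp [h]
  obtain ⟨ε, hε⟩ : ∃ ε : Fin n → ℝ, ∀ i, ε i = if 0 ≤ s i then 1 else -1 := ⟨_, fun _ => rfl⟩
  simp only [← hε]
  have hε1 : ∀ i, ε i ^ 2 = 1 := fun i => by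
    rw [hε]; split_ifs <;> norm_num
  have hεs : ∀ i, 0 ≤ ε i * s i := fun i => by
    rw [hε]; split_ifs with h
    · linarith
    · linarith
  have key : ∀ i, i ≠ x ∧ ε x * ε i * M x i = -1 → 2.296875 ≤ u i * N x i ^ 2 := by
    rintro i ⟨-, h⟩
    have h34 : 3 / 4 ≤ (ε x * s x) * (ε i * s i) := by
      have h1 : (3 / 4 : ℝ) ^ 2 ≤ ((ε x * s x) * (ε i * s i)) ^ 2 := by
        have : ((ε x * s x) * (ε i * s i)) ^ 2 = u x * u i := by
          rw [hu, hu]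
          linear_combination (s x ^ 2 * s i ^ 2 * ε i ^ 2) * hε1 x + (s x ^ 2 * s i ^ 2) * hε1 i
        rw [this]
        nlinarith [hu34 x, hu34 i]
      exact (sq_le_sq₀ (by norm_num) (mul_nonneg (hεs x) (hεs i))).1 h1
    have e : N x i ^ 2 = (1 + (ε x * s x) * (ε i * s i)) ^ 2 := by
      have e1 : (ε x * ε i) * N x i = -(1 + (ε x * s x) * (ε i * s i)) := by
        rw [hN]; linear_combination h
      have e2 : N x i ^ 2 = ((ε x * ε i) * N x i) ^ 2 := by
        linear_combination -(N x i ^ 2 * ε i ^ 2) * hε1 x - (N x i ^ 2) * hε1 i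
      rw [e2, e1]; ring
    have h2 : 3.0625 ≤ N x i ^ 2 := by rw [e]; nlinarith
    nlinarith [hu34 i]
  set A := Finset.univ.filter (fun i => i ≠ x ∧ ε x * ε i * M x i = -1) with hA
  have hxA : x ∉ A := by simp [hA]
  have h1 : ∑ i ∈ insert x A, u i * N x i ^ 2 ≤ ∑ i, u i * N x i ^ 2 :=
    Finset.sum_le_sum_of_subset_of_nonneg (Finset.subset_univ _)
      (fun i _ _ => mul_nonneg (hu0 i) (sq_nonneg _))
  rw [Finset.sum_insert hxA] at h1
  have h2 : (A.card : ℝ) * 2.296875 ≤ ∑ i ∈ A, u i * N x i ^ 2 := by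
    rw [← nsmul_eq_mul]
    exact Finset.card_nsmul_le_sum A _ _ fun i hi => key i (by simpa [hA] using hi)
  have h3 : (A.card : ℝ) < 17 := by
    refine numD (hu34 x) ?_
    rw [hNd] at h1
    linarith [hY x]
  have h4 : A.card < 17 := by exact_mod_cast h3
  omega

set_option linter.unusedSectionVars false

section graphs
variable {V : Type} [Fintype V] [DecidableEq V] (G : SimpleGraph V) [DecidableRel G.Adj]

/-- adjacency operator -/
def adjS (f : V → ℝ) (i : V) : ℝ := ∑ j, if G.Adj i j then f j else 0

/-- bilinear form of `2 I - A` -/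
def bf (f g : V → ℝ) : ℝ := ∑ i, f i * (2 * g i - adjS G g i)

lemma adjS_comb (f g : V → ℝ) (s t : ℝ) (i : V) :
    adjS G (fun i => s * f i + t * g i) i = s * adjS G f i + t * adjS G g i := by
  simp only [adjS, Finset.mul_sum, ← Finset.sum_add_distrib]
  refine Finset.sum_congr rfl fun j _ => ?_
  split_ifs <;> ring

lemma adjS_swap (f g : V → ℝ) : ∑ i, f i * adjS G g i = ∑ i, g i * adjS G f i := by
  simp only [adjS, Finset.mul_sum]
  rw [Finset.sum_comm]
  refine Finset.sum_congr rfl fun i _ => Finset.sum_congr rfl fun j _ => ?_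
  simp only [G.adj_comm j i]
  split_ifs <;> ring

lemma bf_comm (f g : V → ℝ) : bf G f g = bf G g f := by
  have := adjS_swap G f g
  have e : ∀ f g : V → ℝ, bf G f g = 2 * ∑ i, f i * g i - ∑ i, f i * adjS G g i := by
    intro f g
    simp only [bf, Finset.mul_sum, ← Finset.sum_sub_distrib]
    exact Finset.sum_congr rfl fun i _ => by ring
  rw [e, e, this]
  congr 2
  exact Finset.sum_congr rfl fun i _ => by ring

lemma bf_comb (f g : V → ℝ) (s t : ℝ) :
    bf G (fun i => s * f i + t * g i) (fun i => s * f i + t * g i)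
      = s ^ 2 * bf G f f + 2 * s * t * bf G f g + t ^ 2 * bf G g g := by
  have h2 : 2 * s * t * bf G f g = s * t * bf G f g + s * t * bf G g f := by
    rw [bf_comm G g f]; ring
  rw [h2]
  simp only [bf, adjS_comb, Finset.mul_sum, ← Finset.sum_add_distrib]
  exact Finset.sum_congr rfl fun i _ => by ring

lemma bf_abs_le (v : V → ℝ) : bf G (fun i => |v i|) (fun i => |v i|) ≤ bf G v v := by
  refine Finset.sum_le_sum fun i _ => ?_
  have h1 : v i * adjS G v i ≤ |v i| * adjS G (fun i => |v i|) i := by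
    simp only [adjS, Finset.mul_sum]
    refine Finset.sum_le_sum fun j _ => ?_
    split_ifs
    · rw [← abs_mul]; exact le_abs_self _
    · simp
  have h2 : |v i| * |v i| = v i * v i := abs_mul_abs_self _
  nlinarith

/-- closed neighbourhood -/
def clN (Q : Finset V) : Finset V := Q.biUnion fun x => insert x (G.neighborFinset x)

lemma mem_clN {Q : Finset V} {x : V} : x ∈ clN G Q ↔ ∃ y ∈ Q, x = y ∨ G.Adj y x := by
  simp [clN]

lemma bf_zero_of_clN {Q : Finset V} {f v : V → ℝ} (hf : ∀ i, i ∉ Q → f i = 0)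
    (hv : ∀ i ∈ clN G Q, v i = 0) : bf G f v = 0 := by
  refine Finset.sum_eq_zero fun i _ => ?_
  by_cases hi : i ∈ Q
  · have h1 : v i = 0 := hv i ((mem_clN G).2 ⟨i, hi, Or.inl rfl⟩)
    have h2 : adjS G v i = 0 := by
      refine Finset.sum_eq_zero fun j _ => ?_
      split_ifs with h
      · exact hv j ((mem_clN G).2 ⟨i, hi, Or.inr h⟩)
      · rfl
    rw [h1, h2]; ring
  · rw [hf i hi]; ring

/-- kernel hypotheses bundle -/
structure KerHyp (W : Submodule ℝ (V → ℝ)) : Prop where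
  psd : ∀ f, 0 ≤ 2 * bf G f f + (∑ i, f i) ^ 2
  ker : ∀ v ∈ W, ∀ i, (∑ j, v j) + 2 * (2 * v i - adjS G v i) = 0

variable {G}

lemma KerHyp.bf_eq {W : Submodule ℝ (V → ℝ)} (h : KerHyp G W) (f : V → ℝ) {v : V → ℝ} (hv : v ∈ W) :
    2 * bf G f v = - (∑ i, f i) * ∑ i, v i := by
  have : ∀ i, 2 * v i - adjS G v i = - (∑ j, v j) / 2 := fun i => by
    have := h.ker v hv i
    linarith
  simp only [bf, this, ← Finset.sum_mul]
  ring

lemma sum_abs_pos {v : V → ℝ} (hv : v ≠ 0) : 0 < ∑ i, |v i| := by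
  obtain ⟨i, hi⟩ := Function.ne_iff.1 hv
  exact Finset.sum_pos' (fun i _ => abs_nonneg _) ⟨i, Finset.mem_univ _, abs_pos.2 hi⟩

lemma lemL {W : Submodule ℝ (V → ℝ)} (h : KerHyp G W) {Q : Finset V} {f : V → ℝ}
    (hf : ∀ i, i ∉ Q → f i = 0) (hneg : bf G f f < 0) :
    Module.finrank ℝ W ≤ (clN G Q).card := by
  by_contra hc
  push Not at hc
  let L : W →ₗ[ℝ] ({x // x ∈ clN G Q} → ℝ) :=
    { toFun := fun v x => v.1 x.1
      map_add' := fun _ _ => rfl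
      map_smul' := fun _ _ => rfl }
  have hL : LinearMap.ker L ≠ ⊥ := LinearMap.ker_ne_bot_of_finrank_lt (by simpa using hc)
  obtain ⟨v, hvk, hv0⟩ := (Submodule.ne_bot_iff _).1 hL
  have hvz : ∀ i ∈ clN G Q, v.1 i = 0 := fun i hi => congrFun (LinearMap.mem_ker.1 hvk) ⟨i, hi⟩
  have hv0' : v.1 ≠ 0 := fun h => hv0 (Subtype.ext h)
  have hb := bf_zero_of_clN G hf hvz
  have h1 := h.bf_eq f v.2
  rw [hb] at h1
  have hfs : ∑ i, f i ≠ 0 := by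
    intro h0
    have := h.psd f
    rw [h0] at this
    linarith
  have hvs : ∑ i, v.1 i = 0 := by
    rcases mul_eq_zero.1 (show -(∑ i, f i) * ∑ i, v.1 i = 0 by linarith) with h2 | h2
    · exact absurd (neg_eq_zero.1 h2) hfs
    · exact h2
  have hvq : bf G v.1 v.1 = 0 := by
    have := h.bf_eq v.1 v.2
    rw [hvs] at this
    linarith
  have hg := bf_abs_le G v.1
  have hb2 : bf G f (fun i => |v.1 i|) = 0 :=
    bf_zero_of_clN G hf fun i hi => by rw [hvz i hi, abs_zero]
  have hgs := sum_abs_pos hv0'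
  have h3 := h.psd (fun i => (∑ i, |v.1 i|) * f i + (-∑ i, f i) * |v.1 i|)
  have e := bf_comb G f (fun i => |v.1 i|) (∑ i, |v.1 i|) (-∑ i, f i)
  rw [e, hb2] at h3
  simp only [Finset.sum_add_distrib, ← Finset.mul_sum] at h3
  have h4 : (∑ i, |v.1 i|) ^ 2 * bf G f f < 0 := mul_neg_of_pos_of_neg (by positivity) hneg
  have h5 : (-∑ i, f i) ^ 2 * bf G (fun i => |v.1 i|) (fun i => |v.1 i|) ≤ 0 :=
    mul_nonpos_of_nonneg_of_nonpos (sq_nonneg _) (by linarith)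
  have h6 : (∑ i, |v.1 i|) * ∑ i, f i + (-∑ i, f i) * ∑ i, |v.1 i| = 0 := by ring
  rw [h6] at h3
  linarith

/-- `2 I - A` positive semidefinite: kernel of dimension at most a third of the vertices -/
lemma ker_third (hq : ∀ f, 0 ≤ bf G f f) (W0 : Submodule ℝ (V → ℝ))
    (hW : ∀ v, v ∈ W0 ↔ ∀ i, 2 * v i - adjS G v i = 0) :
    (∀ v ∈ W0, (fun i => |v i|) ∈ W0) ∧ 3 * Module.finrank ℝ W0 ≤ Fintype.card V := by
  classical
  have habs : ∀ v ∈ W0, (fun i => |v i|) ∈ W0 := by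
    intro v hv
    have h0 : bf G v v = 0 := by
      unfold bf
      exact Finset.sum_eq_zero fun i _ => by rw [(hW v).1 hv i]; ring
    have h1 : bf G (fun i => |v i|) (fun i => |v i|) = 0 :=
      le_antisymm (h0 ▸ bf_abs_le G v) (hq _)
    rw [hW]
    intro i
    have h2 : ∀ t : ℝ, 0 ≤ 0 * (t * t) + (2 * bf G (Pi.single i 1) (fun i => |v i|)) * t
        + bf G (Pi.single i 1) (Pi.single i 1) := by
      intro t
      have := hq (fun j => 1 * (Pi.single i (1:ℝ) : V → ℝ) j + t * |v j|)
      have e := bf_comb G (Pi.single i (1:ℝ)) (fun j => |v j|) 1 t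
      rw [e, h1] at this
      linarith
    have h3 := discrim_le_zero h2
    unfold discrim at h3
    have h4 : bf G (Pi.single i 1) (fun i => |v i|) = 0 := by nlinarith
    unfold bf at h4
    rw [Finset.sum_eq_single i] at h4
    · simpa using h4
    · intro b _ hb; simp [hb]
    · simp
  refine ⟨habs, ?_⟩
  have hnb : ∀ v ∈ W0, ∀ i, v i = 0 → ∀ j, G.Adj i j → v j = 0 := by
    intro v hv i hi j hij
    have h1 := (hW _).1 (habs v hv) i
    simp only [hi, abs_zero, mul_zero, zero_sub, neg_eq_zero] at h1
    unfold adjS at h1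
    rw [Finset.sum_eq_zero_iff_of_nonneg (fun j _ => by split_ifs <;> positivity)] at h1
    have := h1 j (Finset.mem_univ _)
    rw [if_pos hij] at this
    exact abs_eq_zero.1 this
  have hreach : ∀ v ∈ W0, ∀ i j, G.Reachable i j → v i = 0 → v j = 0 := by
    rintro v hv i j ⟨p⟩
    induction p with
    | nil => exact id
    | cons h p ih => exact fun h0 => ih (hnb v hv _ h0 _ h)
  let fib : G.ConnectedComponent → Finset V := fun c =>
    Finset.univ.filter fun x => G.connectedComponentMk x = c
  let R : Finset G.ConnectedComponent := Finset.univ.filter fun c => 3 ≤ (fib c).card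
  let L : W0 →ₗ[ℝ] ({c // c ∈ R} → ℝ) :=
    { toFun := fun v c => v.1 (Quot.out c.1)
      map_add' := fun _ _ => rfl
      map_smul' := fun _ _ => rfl }
  have hinj : Function.Injective L := by
    rw [← LinearMap.ker_eq_bot, LinearMap.ker_eq_bot']
    intro v hv
    by_contra hne
    have hv0' : v.1 ≠ 0 := fun h => hne (Subtype.ext h)
    obtain ⟨i, hi⟩ := Function.ne_iff.1 hv0'
    obtain ⟨m, hm, hmax⟩ := Finset.exists_max_image (fib (G.connectedComponentMk i))
      (fun x => |v.1 x|) ⟨i, by simp [fib]⟩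
    have hm' : G.connectedComponentMk m = G.connectedComponentMk i := by simpa [fib] using hm
    have hpos : 0 < |v.1 m| := lt_of_lt_of_le (abs_pos.2 hi) (hmax i (by simp [fib]))
    have h1 := (hW _).1 (habs v.1 v.2) m
    have h2 : adjS G (fun i => |v.1 i|) m ≤ (G.neighborFinset m).card * |v.1 m| := by
      unfold adjS
      rw [← Finset.sum_filter, ← nsmul_eq_mul]
      have e : Finset.univ.filter (fun j => G.Adj m j) = G.neighborFinset m := by
        ext j; simp
      rw [e]
      refine Finset.sum_le_card_nsmul _ _ _ fun j hj => hmax j ?_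
      have hj' : G.Adj m j := by simpa using hj
      simp only [fib, Finset.mem_filter, Finset.mem_univ, true_and]
      rw [← hm']
      exact (SimpleGraph.ConnectedComponent.eq.2 hj'.reachable).symm
    have h3 : (2 : ℝ) ≤ (G.neighborFinset m).card := by
      have : 2 * |v.1 m| ≤ (G.neighborFinset m).card * |v.1 m| := by linarith
      exact le_of_mul_le_mul_right this hpos
    have h3' : 2 ≤ (G.neighborFinset m).card := by exact_mod_cast h3
    have h4 : 3 ≤ (fib (G.connectedComponentMk i)).card := by
      have hsub : insert m (G.neighborFinset m) ⊆ fib (G.connectedComponentMk i) := by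
        intro j hj
        rcases Finset.mem_insert.1 hj with rfl | hj
        · exact hm
        · have hj' : G.Adj m j := by simpa using hj
          simp only [fib, Finset.mem_filter, Finset.mem_univ, true_and]
          rw [← hm']
          exact (SimpleGraph.ConnectedComponent.eq.2 hj'.reachable).symm
      have := Finset.card_le_card hsub
      rw [Finset.card_insert_of_notMem (by simp)] at this
      omega
    have h5 := congrFun hv ⟨G.connectedComponentMk i, by simp [R, h4]⟩
    have h6 : v.1 (Quot.out (G.connectedComponentMk i)) = 0 := h5
    refine hi (hreach v.1 v.2 _ i ?_ h6)
    exact SimpleGraph.ConnectedComponent.exact (Quot.out_eq (G.connectedComponentMk i))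
  have h1 := LinearMap.finrank_le_finrank_of_injective hinj
  have h2 : Module.finrank ℝ ({c // c ∈ R} → ℝ) = R.card := by simp
  rw [h2] at h1
  have h3 : Fintype.card V = ∑ c : G.ConnectedComponent, (fib c).card := by
    rw [← Finset.card_univ]
    exact Finset.card_eq_sum_card_fiberwise (fun x _ => Finset.mem_coe.2 (Finset.mem_univ _))
  have h4 : ∑ c ∈ R, 3 ≤ ∑ c : G.ConnectedComponent, (fib c).card :=
    (Finset.sum_le_sum fun c hc => by simpa [R] using hc).trans
      (Finset.sum_le_sum_of_subset (Finset.subset_univ _))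
  simp at h4
  omega

lemma stepE1 {W : Submodule ℝ (V → ℝ)} (h : KerHyp G W) (h1 : 1 ≤ Module.finrank ℝ W)
    (h3 : Fintype.card V ≤ 3 * Module.finrank ℝ W) : ∃ f, bf G f f < 0 := by
  by_contra hc
  push Not at hc
  let W0 : Submodule ℝ (V → ℝ) :=
    { carrier := {v | ∀ i, 2 * v i - adjS G v i = 0}
      add_mem' := by
        intro a b ha hb i
        have := adjS_comb G a b 1 1 i
        simp only [one_mul] at this
        have e : adjS G (a + b) i = adjS G a i + adjS G b i := this
        rw [e, Pi.add_apply]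
        linarith [ha i, hb i]
      zero_mem' := by intro i; simp [adjS]
      smul_mem' := by
        intro c a ha i
        have := adjS_comb G a a c 0 i
        simp only [zero_mul, add_zero] at this
        have e : adjS G (c • a) i = c * adjS G a i := this
        rw [e, Pi.smul_apply, smul_eq_mul]
        linear_combination c * ha i }
  have hW0 : ∀ v, v ∈ W0 ↔ ∀ i, 2 * v i - adjS G v i = 0 := fun v => Iff.rfl
  obtain ⟨ha, hb⟩ := ker_third hc W0 hW0
  have hs : ∀ v ∈ W, ∑ i, v i = 0 := by
    intro v hv
    have e1 := h.bf_eq v hv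
    have e2 := hc v
    nlinarith
  have hle : W ≤ W0 := by
    intro v hv i
    have := h.ker v hv i
    rw [hs v hv] at this
    linarith
  have hne : W ≠ ⊥ := by
    rintro rfl
    simp at h1
  obtain ⟨v, hv, hv0⟩ := (Submodule.ne_bot_iff _).1 hne
  have hlt : W < W0 := by
    refine lt_of_le_of_ne hle ?_
    intro he
    have h5 := ha v (hle hv)
    rw [← he] at h5
    have := hs _ h5
    linarith [sum_abs_pos hv0]
  have := Submodule.finrank_lt_finrank_of_lt hlt
  omega

end graphs

set_option linter.unusedSectionVars false

section graphs2
variable {V : Type} [Fintype V] [DecidableEq V] {G : SimpleGraph V} [DecidableRel G.Adj]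

lemma bf_split (f : V → ℝ) (hneg : bf G f f < 0) :
    ∃ (a : V) (g : V → ℝ), (∀ i, ¬ G.Reachable a i → g i = 0) ∧ bf G g g < 0 := by
  classical
  let fc : G.ConnectedComponent → V → ℝ := fun c i => if G.connectedComponentMk i = c then f i else 0
  have hsum : ∑ c, bf G (fc c) (fc c) = bf G f f := by
    unfold bf
    rw [Finset.sum_comm]
    refine Finset.sum_congr rfl fun i _ => ?_
    rw [Finset.sum_eq_single (G.connectedComponentMk i)]
    · have h1 : fc (G.connectedComponentMk i) i = f i := by simp [fc]
      have h2 : adjS G (fc (G.connectedComponentMk i)) i = adjS G f i := by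
        unfold adjS
        refine Finset.sum_congr rfl fun j _ => ?_
        split_ifs with h
        · have : G.connectedComponentMk j = G.connectedComponentMk i :=
            (SimpleGraph.ConnectedComponent.eq.2 h.reachable).symm
          simp [fc, this]
        · rfl
      rw [h1, h2]
    · intro c _ hc
      have : fc c i = 0 := by simp [fc, hc.symm]
      rw [this]; ring
    · simp
  have : ∃ c, bf G (fc c) (fc c) < 0 := by
    by_contra hc
    push Not at hc
    have := Finset.sum_nonneg (s := Finset.univ) fun c _ => hc c
    linarith
  obtain ⟨c, hc⟩ := this
  induction c using SimpleGraph.ConnectedComponent.ind with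
  | h a =>
    refine ⟨a, fc _, fun i hi => ?_, hc⟩
    have : G.connectedComponentMk i ≠ G.connectedComponentMk a := fun h =>
      hi (SimpleGraph.ConnectedComponent.exact h).symm
    simp [fc, this]

lemma closed_reach {S : Finset V} (hS : ∀ x ∈ S, ∀ y, G.Adj x y → y ∈ S) {a b : V} (ha : a ∈ S)
    (h : G.Reachable a b) : b ∈ S := by
  obtain ⟨p⟩ := h
  induction p with
  | nil => exact ha
  | cons h p ih => exact ih (hS _ ha _ h)

/-- template lemma -/
lemma template {m : ℕ} (p : Fin m → V) (hp : Function.Injective p) (c : Fin m → ℝ)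
    (hc : ∀ k, 0 < c k) (T : Fin m → Fin m → Prop) [∀ k l, Decidable (T k l)]
    (hT : ∀ k l, T k l → G.Adj (p k) (p l)) :
    ∃ f : V → ℝ, (∀ k, 0 < f (p k)) ∧ (∀ i, i ∉ Finset.univ.image p → f i = 0) ∧ (∀ i, 0 ≤ f i) ∧
      bf G f f ≤ ∑ k, c k * (2 * c k - ∑ l, if T k l then c l else 0) := by
  classical
  let f : V → ℝ := Function.extend p c 0
  have hfp : ∀ k, f (p k) = c k := fun k => hp.extend_apply c 0 k
  have hf0 : ∀ i, i ∉ Finset.univ.image p → f i = 0 := by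
    intro i hi
    have : ¬ ∃ k, p k = i := by simpa using hi
    exact Function.extend_apply' c (0 : V → ℝ) i this
  have hsum : ∀ F : V → ℝ, (∀ i, i ∉ Finset.univ.image p → F i = 0) → ∑ i, F i = ∑ k, F (p k) := by
    intro F hF
    rw [← Finset.sum_image (f := F) (s := Finset.univ) (g := p) (fun a _ b _ h => hp h)]
    refine (Finset.sum_subset (Finset.subset_univ _) fun i _ hi => hF i hi).symm
  refine ⟨f, fun k => by rw [hfp]; exact hc k, hf0, fun i => ?_, ?_⟩
  · by_cases hi : i ∈ Finset.univ.image p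
    · obtain ⟨k, -, rfl⟩ := Finset.mem_image.1 hi
      rw [hfp]; exact (hc k).le
    · rw [hf0 i hi]
  · unfold bf
    rw [hsum _ (fun i hi => by rw [hf0 i hi]; ring)]
    refine Finset.sum_le_sum fun k _ => ?_
    rw [hfp]
    refine mul_le_mul_of_nonneg_left ?_ (hc k).le
    have : ∑ l, (if T k l then c l else 0) ≤ adjS G f (p k) := by
      unfold adjS
      rw [hsum _ (fun i hi => by rw [hf0 i hi]; simp)]
      refine Finset.sum_le_sum fun l _ => ?_
      rw [hfp]
      by_cases h : T k l
      · rw [if_pos h, if_pos (hT k l h)]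
      · rw [if_neg h]; split_ifs
        · exact (hc l).le
        · rfl
    linarith

lemma ext_lemma {S : Finset V} {f : V → ℝ} (hf0 : ∀ i, i ∉ S → f i = 0) (hfn : ∀ i, 0 ≤ f i)
    (hq : bf G f f ≤ 0) {s u : V} (hs : 0 < f s) (hu : u ∉ S) (hsu : G.Adj u s) :
    ∃ g : V → ℝ, (∀ i, i ∉ insert u S → g i = 0) ∧ bf G g g < 0 := by
  classical
  refine ⟨fun i => 1 * f i + (f s / 2) * (Pi.single u (1 : ℝ) : V → ℝ) i, ?_, ?_⟩
  · intro i hi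
    rw [Finset.mem_insert, not_or] at hi
    simp [hf0 i hi.2, hi.1]
  · rw [bf_comb]
    have h1 : bf G (Pi.single u 1) (Pi.single u 1) = 2 := by
      unfold bf
      rw [Finset.sum_eq_single u]
      · have : adjS G (Pi.single u 1) u = 0 := by
          unfold adjS
          refine Finset.sum_eq_zero fun j _ => ?_
          split_ifs with h
          · simp [h.ne']
          · rfl
        rw [this]; simp
      · intro b _ hb; simp [hb]
      · simp
    have h2 : bf G f (Pi.single u 1) ≤ - f s := by
      rw [bf_comm]
      unfold bf
      rw [Finset.sum_eq_single u]
      · have : f s ≤ adjS G f u := by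
          unfold adjS
          have := Finset.single_le_sum (f := fun j => if G.Adj u j then f j else 0)
            (s := Finset.univ) (fun j _ => by split_ifs; exacts [hfn j, le_rfl])
            (Finset.mem_univ s)
          simpa [hsu] using this
        rw [hf0 u hu]; simp; exact this
      · intro b _ hb; simp [hb]
      · simp
    rw [h1]
    nlinarith

lemma clN_card {Q : Finset V} {d : ℕ} (hd : ∀ x, G.degree x ≤ d) :
    (clN G Q).card ≤ Q.card * (d + 1) := by
  unfold clN
  refine Finset.card_biUnion_le_card_mul _ _ _ fun x _ => ?_
  refine (Finset.card_insert_le _ _).trans ?_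
  have := hd x
  rw [← G.card_neighborFinset_eq_degree] at this
  omega

/-- no degree five vertex -/
lemma deg_le_four {W : Submodule ℝ (V → ℝ)} (h : KerHyp G W) (h93 : 93 ≤ Module.finrank ℝ W)
    (hdeg : ∀ x, G.degree x ≤ 16) : ∀ x, G.degree x ≤ 4 := by
  intro w
  by_contra hc
  push Not at hc
  rw [← G.card_neighborFinset_eq_degree] at hc
  obtain ⟨T, hTs, hTc⟩ := Finset.exists_subset_card_eq (show 5 ≤ (G.neighborFinset w).card by omega)
  let e : Fin 5 ≃ T := (Fintype.equivFinOfCardEq (by simpa using hTc)).symm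
  have hadj : ∀ k, G.Adj w (e k) := fun k => by simpa using hTs (e k).2
  let p : Fin 6 → V := Fin.cons w (fun k => (e k : V))
  have hp : Function.Injective p := by
    refine Fin.cons_injective_iff.2 ⟨?_, fun a b hab => e.injective (Subtype.ext hab)⟩
    rintro ⟨k, hk⟩
    exact (hadj k).ne hk.symm
  obtain ⟨f, hf1, hf2, hf3, hf4⟩ := template (G := G) p hp (Fin.cons 2 fun _ => 1)
    (fun k => by refine Fin.cases ?_ (fun i => ?_) k <;> simp)
    (fun k l => (k = 0 ∧ l ≠ 0) ∨ (k ≠ 0 ∧ l = 0)) (by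
      intro k l
      refine Fin.cases ?_ (fun i => ?_) k <;> refine Fin.cases ?_ (fun j => ?_) l
      · simp
      · intro _; exact hadj j
      · intro _; exact (hadj i).symm
      · simp)
  have hneg : bf G f f < 0 := by
    refine lt_of_le_of_lt hf4 ?_
    simp [Fin.sum_univ_succ]
    norm_num
  have h1 := lemL h hf2 hneg
  have hsub : clN G (Finset.univ.image p) ⊆
      (insert w (G.neighborFinset w)) ∪ T.biUnion (fun t => (G.neighborFinset t).erase w) := by
    intro x hx
    obtain ⟨y, hy, hxy⟩ := (mem_clN G).1 hx
    obtain ⟨k, -, rfl⟩ := Finset.mem_image.1 hy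
    simp only [Finset.mem_union, Finset.mem_insert, Finset.mem_biUnion, Finset.mem_erase,
      SimpleGraph.mem_neighborFinset]
    revert hxy
    refine Fin.cases ?_ (fun i => ?_) k
    · intro hxy
      exact Or.inl hxy
    · intro hxy
      rcases hxy with rfl | hxy
      · exact Or.inl (Or.inr (hadj i))
      · by_cases hxw : x = w
        · exact Or.inl (Or.inl hxw)
        · exact Or.inr ⟨e i, (e i).2, hxw, hxy⟩
  have h2 := (Finset.card_le_card hsub).trans (Finset.card_union_le _ _)
  have h3 : (insert w (G.neighborFinset w)).card ≤ 17 := by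
    refine (Finset.card_insert_le _ _).trans ?_
    have := hdeg w
    rw [← G.card_neighborFinset_eq_degree] at this
    omega
  have h4 : (T.biUnion (fun t => (G.neighborFinset t).erase w)).card ≤ T.card * 15 := by
    refine Finset.card_biUnion_le_card_mul _ _ _ fun t ht => ?_
    have hw : w ∈ G.neighborFinset t := by
      have : G.Adj w t := by simpa using hTs ht
      simpa using this.symm
    rw [Finset.card_erase_of_mem hw]
    have := hdeg t
    rw [← G.card_neighborFinset_eq_degree] at this
    omega
  omega

/-- affine configurations inside a big component are impossible -/
lemma no_affine {W : Submodule ℝ (V → ℝ)} (h : KerHyp G W) (h93 : 93 ≤ Module.finrank ℝ W)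
    (hdeg : ∀ x, G.degree x ≤ 4) {a : V} {C : Finset V} (hC : ∀ x, x ∈ C ↔ G.Reachable a x)
    (hC93 : 93 ≤ C.card) {m : ℕ} (hm : m ≤ 9) (hm0 : 0 < m) (p : Fin m → V) (hp : Function.Injective p)
    (hpa : ∀ k, p k ∈ C) (c : Fin m → ℝ)
    (hc : ∀ k, 0 < c k) (T : Fin m → Fin m → Prop) [∀ k l, Decidable (T k l)]
    (hT : ∀ k l, T k l → G.Adj (p k) (p l))
    (hval : ∑ k, c k * (2 * c k - ∑ l, if T k l then c l else 0) ≤ 0) : False := by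
  obtain ⟨f, hf1, hf2, hf3, hf4⟩ := template (G := G) p hp c hc T hT
  have hcard : (Finset.univ.image p).card ≤ 9 := (Finset.card_image_le).trans (by simpa using hm)
  have : ∃ s ∈ Finset.univ.image p, ∃ u, u ∉ Finset.univ.image p ∧ G.Adj u s := by
    by_contra hcon
    push Not at hcon
    have hsub : C ⊆ Finset.univ.image p := by
      intro b hb
      have h0 : p ⟨0, hm0⟩ ∈ Finset.univ.image p := Finset.mem_image_of_mem _ (Finset.mem_univ _)
      refine closed_reach (G := G) ?_ h0 (((hC _).1 (hpa ⟨0, hm0⟩)).symm.trans ((hC _).1 hb))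
      intro x hx y hxy
      by_contra hy
      exact hcon x hx y hy hxy.symm
    have := Finset.card_le_card hsub
    omega
  obtain ⟨s, hs, u, hu, hus⟩ := this
  obtain ⟨k, -, rfl⟩ := Finset.mem_image.1 hs
  obtain ⟨g, hg1, hg2⟩ := ext_lemma hf2 hf3 (hf4.trans hval) (hf1 k) hu hus
  have h1 := lemL h hg1 hg2
  have h2 := clN_card (G := G) (Q := insert u (Finset.univ.image p)) hdeg
  have h3 := Finset.card_insert_le u (Finset.univ.image p)
  omega

end graphs2

set_option linter.unusedSectionVars false

section graphs3
variable {V : Type} [Fintype V] [DecidableEq V] {G : SimpleGraph V} [DecidableRel G.Adj]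

lemma deg_le_three {W : Submodule ℝ (V → ℝ)} (h : KerHyp G W) (h93 : 93 ≤ Module.finrank ℝ W)
    (hdeg : ∀ x, G.degree x ≤ 4) {a : V} {C : Finset V} (hC : ∀ x, x ∈ C ↔ G.Reachable a x)
    (hC93 : 93 ≤ C.card) : ∀ x ∈ C, G.degree x ≤ 3 := by
  intro w hw
  by_contra hc
  push Not at hc
  rw [← G.card_neighborFinset_eq_degree] at hc
  obtain ⟨T, hTs, hTc⟩ := Finset.exists_subset_card_eq (show 4 ≤ (G.neighborFinset w).card by omega)
  let e : Fin 4 ≃ T := (Fintype.equivFinOfCardEq (by simpa using hTc)).symm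
  have hadj : ∀ k, G.Adj w (e k) := fun k => by simpa using hTs (e k).2
  let p : Fin 5 → V := Fin.cons w (fun k => (e k : V))
  have hp : Function.Injective p := by
    refine Fin.cons_injective_iff.2 ⟨?_, fun a b hab => e.injective (Subtype.ext hab)⟩
    rintro ⟨k, hk⟩
    exact (hadj k).ne hk.symm
  refine no_affine h h93 hdeg hC hC93 (m := 5) (by norm_num) (by norm_num) p hp ?_
    (Fin.cons 2 fun _ => 1)
    (fun k => by refine Fin.cases ?_ (fun i => ?_) k <;> simp)
    (fun k l => (k = 0 ∧ l ≠ 0) ∨ (k ≠ 0 ∧ l = 0)) (by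
      intro k l
      refine Fin.cases ?_ (fun i => ?_) k <;> refine Fin.cases ?_ (fun j => ?_) l
      · simp
      · intro _; exact hadj j
      · intro _; exact (hadj i).symm
      · simp) ?_
  · intro k
    refine Fin.cases hw (fun i => ?_) k
    exact (hC _).2 (((hC _).1 hw).trans (hadj i).reachable)
  · simp [Fin.sum_univ_succ]
    norm_num

/-- sum of squares -/
lemma sos {C : Finset V} {f : V → ℝ} (hf : ∀ i, i ∉ C → f i = 0)
    (hd : ∀ x ∈ C, G.degree x ≤ 3)
    (hl : ∀ x ∈ C, G.degree x = 3 → ((G.neighborFinset x).filter fun y => G.degree y ≠ 1).card ≤ 1) :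
    0 ≤ bf G f f := by
  obtain ⟨c, hc⟩ : ∃ c : V → V → ℝ, ∀ i j, c i j =
      if G.degree i = 1 ∧ G.degree j = 3 then 1 else
        if G.degree i = 3 ∧ G.degree j = 1 then 1 / 4 else 1 / 2 := ⟨_, fun _ _ => rfl⟩
  have hpair : ∀ i j, f i * f j ≤ c i j * f i ^ 2 + c j i * f j ^ 2 := by
    intro i j
    rw [hc, hc]
    by_cases h1 : G.degree i = 1 ∧ G.degree j = 3
    · have h2 : ¬ (G.degree j = 1 ∧ G.degree i = 3) := by omega
      have h3 : (G.degree j = 3 ∧ G.degree i = 1) := by omega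
      rw [if_pos h1, if_neg h2, if_pos h3]
      nlinarith [sq_nonneg (f i - f j / 2)]
    · by_cases h4 : G.degree i = 3 ∧ G.degree j = 1
      · have h2 : (G.degree j = 1 ∧ G.degree i = 3) := by omega
        rw [if_neg h1, if_pos h4, if_pos h2]
        nlinarith [sq_nonneg (f i / 2 - f j)]
      · have h2 : ¬ (G.degree j = 1 ∧ G.degree i = 3) := by omega
        have h3 : ¬ (G.degree j = 3 ∧ G.degree i = 1) := by omega
        rw [if_neg h1, if_neg h4, if_neg h2, if_neg h3]
        nlinarith [sq_nonneg (f i - f j)]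
  have hrow : ∀ i ∈ C, ∑ j, (if G.Adj i j then c i j else 0) ≤ 1 := by
    intro i hi
    have e : Finset.univ.filter (fun j => G.Adj i j) = G.neighborFinset i := by
      ext j; simp
    rw [← Finset.sum_filter, e]
    have hcard := G.card_neighborFinset_eq_degree i
    by_cases h3 : G.degree i = 3
    · have h4 := hl i hi h3
      have e2 : ∀ j, c i j ≤ 1 / 4 + if G.degree j ≠ 1 then 1 / 4 else 0 := by
        intro j
        rw [hc]
        have h5 : ¬ (G.degree i = 1 ∧ G.degree j = 3) := by omega
        rw [if_neg h5]
        by_cases h6 : G.degree j = 1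
        · rw [if_pos ⟨h3, h6⟩]; simp [h6]
        · rw [if_neg (by tauto)]; simp [h6]; norm_num
      refine (Finset.sum_le_sum fun j _ => e2 j).trans ?_
      rw [Finset.sum_add_distrib, ← Finset.sum_filter, Finset.sum_const, Finset.sum_const, hcard, h3]
      have h7 : (((G.neighborFinset i).filter fun y => G.degree y ≠ 1).card : ℝ) ≤ 1 := by
        exact_mod_cast h4
      rw [nsmul_eq_mul, nsmul_eq_mul]
      push_cast
      linarith
    · by_cases h1 : G.degree i = 1
      · have e2 : ∀ j, c i j ≤ 1 := by
          intro j; rw [hc]; split_ifs <;> norm_num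
        refine (Finset.sum_le_card_nsmul _ _ 1 fun j _ => e2 j).trans ?_
        rw [hcard, h1]; simp
      · have e2 : ∀ j, c i j ≤ 1 / 2 := by
          intro j; rw [hc, if_neg (by tauto), if_neg (by tauto)]
        refine (Finset.sum_le_card_nsmul _ _ (1 / 2) fun j _ => e2 j).trans ?_
        have h2 : G.degree i ≤ 2 := by have := hd i hi; omega
        have h2' : (G.degree i : ℝ) ≤ 2 := by exact_mod_cast h2
        rw [hcard, nsmul_eq_mul]
        linarith
  have hfA : ∑ i, f i * adjS G f i ≤ ∑ i, 2 * f i ^ 2 := by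
    calc ∑ i, f i * adjS G f i = ∑ i, ∑ j, if G.Adj i j then f i * f j else 0 := by
          refine Finset.sum_congr rfl fun i _ => ?_
          rw [adjS, Finset.mul_sum]
          refine Finset.sum_congr rfl fun j _ => ?_
          split_ifs <;> ring
      _ ≤ ∑ i, ∑ j, ((if G.Adj i j then c i j * f i ^ 2 else 0)
            + (if G.Adj j i then c j i * f j ^ 2 else 0)) := by
          refine Finset.sum_le_sum fun i _ => Finset.sum_le_sum fun j _ => ?_
          simp only [G.adj_comm j i]
          split_ifs
          · exact hpair i j
          · simp
      _ = 2 * ∑ i, ∑ j, (if G.Adj i j then c i j * f i ^ 2 else 0) := by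
          simp only [Finset.sum_add_distrib]
          rw [Finset.sum_comm (f := fun i j => if G.Adj j i then c j i * f j ^ 2 else 0)]
          ring
      _ = ∑ i, 2 * (f i ^ 2 * ∑ j, (if G.Adj i j then c i j else 0)) := by
          rw [Finset.mul_sum]
          refine Finset.sum_congr rfl fun i _ => ?_
          congr 1
          rw [Finset.mul_sum]
          refine Finset.sum_congr rfl fun j _ => ?_
          split_ifs <;> ring
      _ ≤ _ := by
          refine Finset.sum_le_sum fun i _ => ?_
          by_cases hi : i ∈ C
          · have := mul_le_mul_of_nonneg_left (hrow i hi) (sq_nonneg (f i))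
            linarith
          · rw [hf i hi]; simp
  have : bf G f f = ∑ i, 2 * f i ^ 2 - ∑ i, f i * adjS G f i := by
    unfold bf
    rw [← Finset.sum_sub_distrib]
    exact Finset.sum_congr rfl fun i _ => by ring
  rw [this]; linarith

/-- balls -/
def ball (G : SimpleGraph V) [DecidableRel G.Adj] (w : V) : ℕ → Finset V
  | 0 => {w}
  | r + 1 => ball G w r ∪ (ball G w r).biUnion fun x => G.neighborFinset x

lemma ball_succ_sub (w : V) (r : ℕ) : ball G w r ⊆ ball G w (r + 1) := Finset.subset_union_left

lemma ball_mono (w : V) : Monotone (ball G w) := monotone_nat_of_le_succ (ball_succ_sub w)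

lemma ball_adj {w x y : V} {r : ℕ} (hx : x ∈ ball G w r) (h : G.Adj x y) : y ∈ ball G w (r + 1) := by
  refine Finset.mem_union_right _ (Finset.mem_biUnion.2 ⟨x, hx, by simpa using h⟩)

lemma sphere_pred {w x : V} {r : ℕ} (hx : x ∈ ball G w (r + 1)) (hx' : x ∉ ball G w r) :
    ∃ y ∈ ball G w r, G.Adj y x := by
  rcases Finset.mem_union.1 hx with h | h
  · exact absurd h hx'
  · obtain ⟨y, hy, hyx⟩ := Finset.mem_biUnion.1 h
    exact ⟨y, hy, by simpa using hyx⟩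

lemma sphere_pred2 {w x : V} {r : ℕ} (hx : x ∈ ball G w (r + 2)) (hx' : x ∉ ball G w (r + 1)) :
    ∃ y, y ∈ ball G w (r + 1) ∧ y ∉ ball G w r ∧ G.Adj y x := by
  obtain ⟨y, hy, hyx⟩ := sphere_pred hx hx'
  exact ⟨y, hy, fun h => hx' (ball_adj h hyx), hyx⟩

lemma sphere_card {w : V} {r : ℕ} (hd : ∀ x ∈ ball G w (r + 1), G.degree x ≤ 3) :
    (ball G w (r + 2) \ ball G w (r + 1)).card ≤ (ball G w (r + 1) \ ball G w r).card * 2 := by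
  have hsub : ball G w (r + 2) \ ball G w (r + 1) ⊆ (ball G w (r + 1) \ ball G w r).biUnion
      fun y => G.neighborFinset y \ ball G w (r + 1) := by
    intro x hx
    rw [Finset.mem_sdiff] at hx
    obtain ⟨y, h1, h2, h3⟩ := sphere_pred2 hx.1 hx.2
    exact Finset.mem_biUnion.2 ⟨y, Finset.mem_sdiff.2 ⟨h1, h2⟩,
      Finset.mem_sdiff.2 ⟨by simpa using h3, hx.2⟩⟩
  refine (Finset.card_le_card hsub).trans (Finset.card_biUnion_le_card_mul _ _ _ fun y hy => ?_)
  rw [Finset.mem_sdiff] at hy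
  obtain ⟨z, hz, hzy⟩ := sphere_pred hy.1 hy.2
  have hz' : z ∈ G.neighborFinset y := by simpa using hzy.symm
  have h1 : G.neighborFinset y \ ball G w (r + 1) ⊆ (G.neighborFinset y).erase z := by
    intro t ht
    rw [Finset.mem_sdiff] at ht
    refine Finset.mem_erase.2 ⟨?_, ht.1⟩
    rintro rfl
    exact ht.2 (ball_succ_sub w r hz)
  have h2 := Finset.card_le_card h1
  rw [Finset.card_erase_of_mem hz', G.card_neighborFinset_eq_degree] at h2
  have := hd y hy.1
  omega

set_option maxHeartbeats 1600000 in
lemma hval_of {m : ℕ} (c : Fin m → ℤ) (T : Fin m → Fin m → Prop) [∀ k l, Decidable (T k l)]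
    (hh : ∀ k, 2 * c k = ∑ l, if T k l then c l else 0) :
    ∑ k, (c k : ℝ) * (2 * (c k : ℝ) - ∑ l, if T k l then (c l : ℝ) else 0) ≤ 0 := by
  apply le_of_eq
  apply Finset.sum_eq_zero
  intro k _
  have h1 : ((2 * c k : ℤ) : ℝ) = ((∑ l, if T k l then c l else 0 : ℤ) : ℝ) := by rw [hh k]
  push_cast at h1
  rw [h1, sub_self, mul_zero]

theorem endgame {W : Submodule ℝ (V → ℝ)} (h : KerHyp G W) (h93 : 93 ≤ Module.finrank ℝ W)
    (h3 : Fintype.card V ≤ 3 * Module.finrank ℝ W) (hdeg16 : ∀ x, G.degree x ≤ 16) : False := by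
  classical
  have hdeg := deg_le_four h h93 hdeg16
  obtain ⟨f0, hf0⟩ := stepE1 h (by omega) h3
  obtain ⟨a, f, hf, hneg⟩ := bf_split f0 hf0
  obtain ⟨C, hC⟩ : ∃ C : Finset V, ∀ x, x ∈ C ↔ G.Reachable a x :=
    ⟨Finset.univ.filter fun x => G.Reachable a x, fun x => by simp⟩
  have hfC : ∀ i, i ∉ C → f i = 0 := fun i hi => hf i fun h' => hi ((hC i).2 h')
  have hCc : ∀ x ∈ C, ∀ y, G.Adj x y → y ∈ C := fun x hx y hxy =>
    (hC y).2 (((hC x).1 hx).trans hxy.reachable)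
  have hclC : clN G C = C := by
    ext x
    rw [mem_clN]
    constructor
    · rintro ⟨y, hy, rfl | hxy⟩
      · exact hy
      · exact hCc y hy x hxy
    · intro hx; exact ⟨x, hx, Or.inl rfl⟩
  have hC93 : 93 ≤ C.card := by
    have := lemL h hfC hneg
    rw [hclC] at this
    omega
  have hd3 := deg_le_three h h93 hdeg hC hC93
  obtain ⟨w, hw, hw3, hwl⟩ : ∃ w ∈ C, G.degree w = 3 ∧
      2 ≤ ((G.neighborFinset w).filter fun y => G.degree y ≠ 1).card := by
    by_contra hcon
    push Not at hcon
    have := sos hfC hd3 (fun x hx hx3 => by have := hcon x hx hx3; omega)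
    linarith
  have hball : ∀ r, ball G w r ⊆ C := by
    intro r
    induction r with
    | zero => intro x hx; rw [ball, Finset.mem_singleton] at hx; rw [hx]; exact hw
    | succ r ih =>
      intro x hx
      by_cases hx' : x ∈ ball G w r
      · exact ih hx'
      · obtain ⟨y, hy, hyx⟩ := sphere_pred hx hx'
        exact hCc y (ih hy) x hyx
  have hsc : ∀ r, (ball G w (r + 2) \ ball G w (r + 1)).card
      ≤ (ball G w (r + 1) \ ball G w r).card * 2 := fun r =>
    sphere_card fun x hx => hd3 x (hball _ hx)
  have hs0 : (ball G w 1 \ ball G w 0).card ≤ 3 := by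
    rw [← hw3, ← G.card_neighborFinset_eq_degree]
    refine Finset.card_le_card fun x hx => ?_
    rw [Finset.mem_sdiff] at hx
    obtain ⟨y, hy, hyx⟩ := sphere_pred hx.1 hx.2
    rw [ball, Finset.mem_singleton] at hy
    rw [hy] at hyx
    simpa using hyx
  have hbs : ∀ r, (ball G w (r + 1)).card ≤ (ball G w r).card + (ball G w (r + 1) \ ball G w r).card := by
    intro r
    have := Finset.card_sdiff_add_card_eq_card (ball_succ_sub (G := G) w r)
    omega
  have hb0 : (ball G w 0).card = 1 := by rw [ball]; simp
  have hb4 : (ball G w 4).card ≤ 46 := by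
    have := hsc 0; have := hsc 1; have := hsc 2
    have := hbs 0; have := hbs 1; have := hbs 2; have := hbs 3
    simp only [zero_add, Nat.reduceAdd] at *
    omega
  have hw0 : w ∈ ball G w 0 := by rw [ball]; simp
  obtain ⟨v5, h5, h5'⟩ : ∃ v5, v5 ∈ ball G w 5 ∧ v5 ∉ ball G w 4 := by
    by_contra hcon
    push Not at hcon
    have hsub : C ⊆ ball G w 4 := by
      intro b hb
      refine closed_reach (G := G) (fun x hx y hxy => hcon y (ball_adj hx hxy))
        (ball_mono w (Nat.zero_le 4) hw0) (((hC w).1 hw).symm.trans ((hC b).1 hb))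
    have := Finset.card_le_card hsub
    omega
  obtain ⟨v4, h4, h4', a45⟩ := sphere_pred2 h5 h5'
  obtain ⟨v3, h3, h3', a34⟩ := sphere_pred2 h4 h4'
  obtain ⟨v2, h2, h2', a23⟩ := sphere_pred2 h3 h3'
  obtain ⟨v1, h1, h1', a12⟩ := sphere_pred2 h2 h2'
  have a01 : G.Adj w v1 := by
    obtain ⟨y, hy, hyx⟩ := sphere_pred h1 h1'
    rw [ball, Finset.mem_singleton] at hy
    rwa [hy] at hyx
  obtain ⟨p, hp, hpv1⟩ : ∃ p ∈ (G.neighborFinset w).filter fun y => G.degree y ≠ 1, p ≠ v1 :=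
    Finset.exists_mem_ne (by omega) v1
  rw [Finset.mem_filter] at hp
  obtain ⟨hpn, hpd⟩ := hp
  have a0p : G.Adj w p := by simpa using hpn
  obtain ⟨q, hq⟩ : ∃ q, q ∈ ((G.neighborFinset w).erase v1).erase p := by
    apply Finset.Nonempty.exists_mem
    rw [← Finset.card_pos]
    have e1 := Finset.pred_card_le_card_erase (s := (G.neighborFinset w).erase v1) (a := p)
    have e2 := Finset.pred_card_le_card_erase (s := G.neighborFinset w) (a := v1)
    rw [G.card_neighborFinset_eq_degree, hw3] at e2
    omega
  rw [Finset.mem_erase, Finset.mem_erase] at hq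
  obtain ⟨hqp, hqv1, hqn⟩ := hq
  have a0q : G.Adj w q := by simpa using hqn
  obtain ⟨p', hp', hp'w⟩ : ∃ p' ∈ G.neighborFinset p, p' ≠ w := by
    refine Finset.exists_mem_ne ?_ w
    have : 0 < (G.neighborFinset p).card := Finset.card_pos.2 ⟨w, by simpa using a0p.symm⟩
    rw [G.card_neighborFinset_eq_degree] at this ⊢
    omega
  have app : G.Adj p p' := by simpa using hp'
  have hpb : p ∈ ball G w 1 := ball_adj hw0 a0p
  have hqb : q ∈ ball G w 1 := ball_adj hw0 a0q
  have hp'b : p' ∈ ball G w 2 := ball_adj hpb app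
  have m01 := ball_mono (G := G) w (show 0 ≤ 1 by norm_num)
  have m12 := ball_mono (G := G) w (show 1 ≤ 2 by norm_num)
  have m23 := ball_mono (G := G) w (show 2 ≤ 3 by norm_num)
  have m34 := ball_mono (G := G) w (show 3 ≤ 4 by norm_num)
  have hpC : p ∈ C := hball 1 hpb
  have hqC : q ∈ C := hball 1 hqb
  have hp'C : p' ∈ C := hball 2 hp'b
  have hv1C : v1 ∈ C := hball _ h1
  have hv2C : v2 ∈ C := hball _ h2
  have hv3C : v3 ∈ C := hball _ h3
  have hv4C : v4 ∈ C := hball _ h4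
  have hv5C : v5 ∈ C := hball _ h5
  -- triangle
  have tri : ∀ x y z, x ∈ C → y ∈ C → z ∈ C → G.Adj x y → G.Adj y z → G.Adj x z → False := by
    intro x y z hx hy hz hxy hyz hxz
    have e1 := hxy.ne; have e2 := hyz.ne; have e3 := hxz.ne
    refine no_affine h h93 hdeg hC hC93 (m := 3) (by norm_num) (by norm_num) ![x, y, z] ?_ ?_
      ![1, 1, 1] ?_ (fun k l => k ≠ l) ?_ ?_
    · intro i j hij
      fin_cases i <;> fin_cases j <;> simp_all
    · intro k; fin_cases k <;> assumption
    · intro k; fin_cases k <;> simp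
    · intro k l hkl
      fin_cases k <;> fin_cases l <;> simp_all [G.adj_comm]
    · simp [Fin.sum_univ_succ]
      try norm_num
  have hne : ∀ {r : ℕ} {x y : V}, x ∈ ball G w r → y ∉ ball G w r → x ≠ y := by
    rintro r x y hx hy rfl
    exact hy hx
  by_cases c1 : p' = v1
  · exact tri w p v1 hw hpC hv1C a0p (c1 ▸ app) a01
  by_cases c2 : p' = q
  · exact tri w p q hw hpC hqC a0p (c2 ▸ app) a0q
  have w1 : w ≠ v1 := a01.ne
  have wp : w ≠ p := a0p.ne
  have wq : w ≠ q := a0q.ne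
  have w2 : w ≠ v2 := hne (m01 hw0) h2'
  have w3 : w ≠ v3 := hne (m12 (m01 hw0)) h3'
  have w4 : w ≠ v4 := hne (m23 (m12 (m01 hw0))) h4'
  have w5 : w ≠ v5 := hne (m34 (m23 (m12 (m01 hw0)))) h5'
  have n12 : v1 ≠ v2 := hne h1 h2'
  have n13 : v1 ≠ v3 := hne (m12 h1) h3'
  have n14 : v1 ≠ v4 := hne (m23 (m12 h1)) h4'
  have n15 : v1 ≠ v5 := hne (m34 (m23 (m12 h1))) h5'
  have n23 : v2 ≠ v3 := hne h2 h3'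
  have n24 : v2 ≠ v4 := hne (m23 h2) h4'
  have n25 : v2 ≠ v5 := hne (m34 (m23 h2)) h5'
  have n34 : v3 ≠ v4 := hne h3 h4'
  have n35 : v3 ≠ v5 := hne (m34 h3) h5'
  have n45 : v4 ≠ v5 := hne h4 h5'
  have np2 : p ≠ v2 := hne hpb h2'
  have np3 : p ≠ v3 := hne (m12 hpb) h3'
  have np4 : p ≠ v4 := hne (m23 (m12 hpb)) h4'
  have np5 : p ≠ v5 := hne (m34 (m23 (m12 hpb))) h5'
  have nq2 : q ≠ v2 := hne hqb h2'
  have nq3 : q ≠ v3 := hne (m12 hqb) h3'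
  have nq4 : q ≠ v4 := hne (m23 (m12 hqb)) h4'
  have nq5 : q ≠ v5 := hne (m34 (m23 (m12 hqb))) h5'
  have nr3 : p' ≠ v3 := hne hp'b h3'
  have nr4 : p' ≠ v4 := hne (m23 hp'b) h4'
  have nr5 : p' ≠ v5 := hne (m34 (m23 hp'b)) h5'
  by_cases c3 : p' = v2
  · refine no_affine h h93 hdeg hC hC93 (m := 4) (by norm_num) (by norm_num) ![w, p, v2, v1] ?_ ?_
      (fun k => (((![1, 1, 1, 1] : Fin 4 → ℤ) k : ℤ) : ℝ)) ?_
      (fun k l => (k, l) ∈ [((0 : Fin 4), (1 : Fin 4)), (1, 2), (2, 3), (3, 0)] ∨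
        (l, k) ∈ [((0 : Fin 4), (1 : Fin 4)), (1, 2), (2, 3), (3, 0)]) ?_ ?_
    · rw [← List.nodup_ofFn]
      simp [wp, w2, w1, np2, hpv1, n12.symm]
    · intro k; fin_cases k <;> assumption
    · intro k; fin_cases k <;> simp
    · have key : ∀ k l, (k, l) ∈ [((0 : Fin 4), (1 : Fin 4)), (1, 2), (2, 3), (3, 0)] →
          G.Adj (![w, p, v2, v1] k) (![w, p, v2, v1] l) := by
        intro k l hkl
        simp only [List.mem_cons, List.not_mem_nil, or_false, Prod.mk.injEq] at hkl
        rcases hkl with ⟨rfl, rfl⟩ | ⟨rfl, rfl⟩ | ⟨rfl, rfl⟩ | ⟨rfl, rfl⟩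
        · exact a0p
        · exact c3 ▸ app
        · exact a12.symm
        · exact a01.symm
      rintro k l (hkl | hkl)
      · exact key k l hkl
      · exact (key l k hkl).symm
    · exact hval_of _ _ (by decide)
  · refine no_affine h h93 hdeg hC hC93 (m := 9) (by norm_num) (by norm_num)
      ![w, v1, v2, v3, v4, v5, q, p, p'] ?_ ?_
      (fun k => (((![6, 5, 4, 3, 2, 1, 3, 4, 2] : Fin 9 → ℤ) k : ℤ) : ℝ)) ?_
      (fun k l => (k, l) ∈ [((0 : Fin 9), (1 : Fin 9)), (1, 2), (2, 3), (3, 4), (4, 5), (0, 6),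
          (0, 7), (7, 8)] ∨
        (l, k) ∈ [((0 : Fin 9), (1 : Fin 9)), (1, 2), (2, 3), (3, 4), (4, 5), (0, 6),
          (0, 7), (7, 8)]) ?_ ?_
    · rw [← List.nodup_ofFn]
      simp [w1, w2, w3, w4, w5, wp, wq, n12, n13, n14, n15, n23, n24, n25, n34, n35, n45,
        np2.symm, np3.symm, np4.symm, np5.symm, nq2.symm, nq3.symm, nq4.symm, nq5.symm,
        nr3.symm, nr4.symm, nr5.symm, hp'w.symm, Ne.symm c1, Ne.symm c2, Ne.symm c3,
        hpv1.symm, hqv1.symm, hqp, app.ne]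
    · intro k; fin_cases k <;> assumption
    · intro k; fin_cases k <;> simp
    · have key : ∀ k l, (k, l) ∈ [((0 : Fin 9), (1 : Fin 9)), (1, 2), (2, 3), (3, 4), (4, 5), (0, 6),
          (0, 7), (7, 8)] → G.Adj (![w, v1, v2, v3, v4, v5, q, p, p'] k)
            (![w, v1, v2, v3, v4, v5, q, p, p'] l) := by
        intro k l hkl
        simp only [List.mem_cons, List.not_mem_nil, or_false, Prod.mk.injEq] at hkl
        rcases hkl with ⟨rfl, rfl⟩ | ⟨rfl, rfl⟩ | ⟨rfl, rfl⟩ | ⟨rfl, rfl⟩ | ⟨rfl, rfl⟩ | ⟨rfl, rfl⟩ |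
          ⟨rfl, rfl⟩ | ⟨rfl, rfl⟩
        · exact a01
        · exact a12
        · exact a23
        · exact a34
        · exact a45
        · exact a0q
        · exact a0p
        · exact app
      rintro k l (hkl | hkl)
      · exact key k l hkl
      · exact (key l k hkl).symm
    · exact hval_of _ _ (by decide)

end graphs3

lemma psd_of_minEig {n : ℕ} (S : Matrix (Fin n) (Fin n) ℝ) (hS : S.IsSymm)
    (hmin : minEig S = -5) : Psd (fun i j => S i j + if i = j then (5 : ℝ) else 0) := by
  have hA : S.IsHermitian := by
    rw [Matrix.IsHermitian, Matrix.conjTranspose_eq_transpose_of_trivial]; exact hS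
  have hsym : ∀ i j, S i j = S j i := fun i j => (hS.apply j i)
  have hev : ∀ i, -5 ≤ hA.eigenvalues i := by
    intro i
    have h1 : minEig S = ⨅ i, hA.eigenvalues i := by
      simp only [minEig, dif_pos hA]
    rw [← hmin, h1]
    exact ciInf_le (Set.finite_range _).bddBelow i
  refine ⟨fun i j => by simp only [hsym i j, eq_comm (a := i)], ?_⟩
  have hbound : ∀ c, qf (fun i j => - S i j) c c ≤ 5 * ∑ i, c i ^ 2 := by
    by_contra hcon
    obtain ⟨Θ, v, h1, h2, h3⟩ := exists_eig (fun i j => - S i j)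
      (fun i j => by simp only [hsym i j]) 5 hcon
    have hmv : S *ᵥ v = (-Θ) • v := by
      ext i
      have := h3 i
      simp only [neg_mul, Finset.sum_neg_distrib] at this
      simp only [Matrix.mulVec, dotProduct, Pi.smul_apply, smul_eq_mul]
      linarith
    have heig : Module.End.HasEigenvalue (Matrix.toLin' S) (-Θ) := by
      apply Module.End.hasEigenvalue_of_hasEigenvector (x := v)
      refine ⟨?_, h2⟩
      rw [Module.End.mem_eigenspace_iff, Matrix.toLin'_apply, hmv]
    have hspec : (-Θ) ∈ spectrum ℝ S := by
      rw [← Matrix.spectrum_toLin']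
      exact heig.mem_spectrum
    rw [hA.spectrum_real_eq_range_eigenvalues] at hspec
    obtain ⟨i, hi⟩ := hspec
    have := hev i
    linarith
  intro c
  have h := hbound c
  have e : qf (fun i j => S i j + if i = j then (5 : ℝ) else 0) c c
      = 5 * ∑ i, c i ^ 2 - qf (fun i j => - S i j) c c := by
    simp only [qf, mul_add, Finset.sum_add_distrib, mul_ite, mul_zero, Finset.sum_ite_eq,
      Finset.mem_univ, if_true, mul_neg, Finset.sum_neg_distrib, Finset.mul_sum]
    rw [sub_neg_eq_add, add_comm]
    congr 1
    exact Finset.sum_congr rfl fun i _ => by ring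
  rw [e]; linarith

lemma final_core {n : ℕ} (S : Matrix (Fin n) (Fin n) ℝ) (hS : IsSeidel S)
    (hmin : minEig S = -5) (hn : 277 ≤ n) :
    2 * n / 3 + 1 ≤ (S + (5 : ℝ) • 1).rank := by
  classical
  obtain ⟨hsy, hdiag, hoff⟩ := hS
  have hsym : ∀ i j, S i j = S j i := fun i j => (hsy.apply j i)
  have hpsd := psd_of_minEig S hsy hmin
  set M : Fin n → Fin n → ℝ := fun i j => S i j + if i = j then (5 : ℝ) else 0 with hM
  obtain ⟨ε, hε, hcard⟩ := stepD hn M hpsd (fun i => by simp [hM, hdiag])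
    (fun i j hij => by simpa [hM, hij] using hoff i j hij)
  have hεε : ∀ i, ε i * ε i = 1 := fun i => by rcases hε i with h | h <;> rw [h] <;> norm_num
  let G : SimpleGraph (Fin n) :=
    { Adj := fun x i => i ≠ x ∧ ε x * ε i * M x i = -1
      symm := ⟨fun x i hxi => ⟨hxi.1.symm, by rw [hpsd.1 i x, mul_comm (ε i)]; exact hxi.2⟩⟩
      loopless := ⟨fun x hx => hx.1 rfl⟩ }
  have hdeg : ∀ x, G.degree x ≤ 16 := by
    intro x
    have : G.neighborFinset x
        = Finset.univ.filter (fun i => i ≠ x ∧ ε x * ε i * M x i = -1) := by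
      ext i
      simp [G]
    rw [← SimpleGraph.card_neighborFinset_eq_degree, this]
    exact hcard x
  have hent : ∀ i j, ε i * ε j * M i j
      = 1 + (if i = j then 4 else 0) - 2 * (if G.Adj i j then 1 else 0) := by
    intro i j
    by_cases hij : i = j
    · subst hij
      simp [hM, hdiag, hεε]
      norm_num
    · have hadj : G.Adj i j ↔ ε i * ε j * M i j = -1 :=
        ⟨fun h => h.2, fun h => ⟨fun h' => hij h'.symm, h⟩⟩
      have hm : ε i * ε j * M i j = 1 ∨ ε i * ε j * M i j = -1 := by
        have h0 : M i j = 1 ∨ M i j = -1 := by simpa [hM, hij] using hoff i j hij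
        rcases hε i with h1 | h1 <;> rcases hε j with h2 | h2 <;> rcases h0 with h3 | h3 <;>
          rw [h1, h2, h3] <;> norm_num
      rcases hm with h | h
      · have : ¬ G.Adj i j := by rw [hadj, h]; norm_num
        rw [if_neg this, if_neg hij, h]; norm_num
      · have : G.Adj i j := hadj.2 h
        rw [if_pos this, if_neg hij, h]; norm_num
  have hrow : ∀ (w : Fin n → ℝ) i, ∑ j, ε i * ε j * M i j * w j
      = (∑ j, w j) + 2 * (2 * w i - adjS G w i) := by
    intro w i
    simp only [hent, adjS]
    have : ∀ j, (1 + (if i = j then (4 : ℝ) else 0) - 2 * (if G.Adj i j then 1 else 0)) * w j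
        = w j + (if i = j then 4 * w j else 0) - 2 * (if G.Adj i j then w j else 0) := by
      intro j
      split_ifs <;> ring
    simp only [this, Finset.sum_sub_distrib, Finset.sum_add_distrib, Finset.sum_ite_eq,
      Finset.mem_univ, if_true, ← Finset.mul_sum]
    ring
  let A : Matrix (Fin n) (Fin n) ℝ := S + (5 : ℝ) • 1
  have hAM : ∀ i j, A i j = M i j := by
    intro i j
    simp [A, hM, Matrix.one_apply]
  let D : (Fin n → ℝ) →ₗ[ℝ] (Fin n → ℝ) := LinearMap.pi fun i => ε i • LinearMap.proj i
  have hD : ∀ v i, D v i = ε i * v i := fun v i => by simp [D]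
  have hDD : ∀ v, D (D v) = v := by
    intro v
    ext i
    rw [hD, hD, ← mul_assoc, hεε, one_mul]
  have hDinj : Function.Injective D := fun a b hab => by rw [← hDD a, hab, hDD]
  let W : Submodule ℝ (Fin n → ℝ) := (LinearMap.ker A.mulVecLin).map D
  have hker : KerHyp G W := by
    refine ⟨?_, ?_⟩
    · intro f
      have h1 := hpsd.2 (D f)
      have h2 : qf M (D f) (D f) = 2 * bf G f f + (∑ i, f i) ^ 2 := by
        have : qf M (D f) (D f) = ∑ i, f i * ∑ j, ε i * ε j * M i j * f j := by
          simp only [qf, hD, Finset.mul_sum]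
          exact Finset.sum_congr rfl fun i _ => Finset.sum_congr rfl fun j _ => by ring
        rw [this]
        simp only [hrow, bf, mul_add, Finset.sum_add_distrib, ← Finset.sum_mul]
        rw [sq, add_comm]
        congr 1
        rw [Finset.mul_sum]
        exact Finset.sum_congr rfl fun i _ => by ring
      rw [← h2]; exact h1
    · intro v hv i
      obtain ⟨u, hu, rfl⟩ := hv
      rw [← hrow]
      have hu' : A *ᵥ u = 0 := by simpa using hu
      have hui := congrFun hu' i
      simp only [Matrix.mulVec, dotProduct, hAM, Pi.zero_apply] at hui
      have : ∀ j, ε i * ε j * M i j * D u j = ε i * (M i j * u j) := by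
        intro j
        rw [hD]
        linear_combination (ε i * M i j * u j) * hεε j
      simp only [this, ← Finset.mul_sum, hui, mul_zero]
  have hfin : Module.finrank ℝ W = Module.finrank ℝ (LinearMap.ker A.mulVecLin) :=
    (Submodule.equivMapOfInjective D hDinj _).finrank_eq.symm
  have hrn := LinearMap.finrank_range_add_finrank_ker A.mulVecLin
  rw [← hfin, Module.finrank_fin_fun] at hrn
  have hrank : A.rank + Module.finrank ℝ W = n := hrn
  by_contra hcon
  have hcon' : ¬ 2 * n / 3 + 1 ≤ A.rank := hcon
  exact endgame hker (by omega) (by rw [Fintype.card_fin]; omega) hdeg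

/-- If `S` is a Seidel matrix of order `n ≥ 277` with smallest eigenvalue
exactly `-5`, then `rk(S + 5I) ≥ ⌊2n/3⌋ + 1`. -/
theorem stmt_0 {n : ℕ} (S : Matrix (Fin n) (Fin n) ℝ) (hS : IsSeidel S)
    (hmin : minEig S = -5) (hn : 277 ≤ n) :
    2 * n / 3 + 1 ≤ (S + (5 : ℝ) • 1).rank := by
  exact final_core S hS hmin hn
end

section
/- Let S be a Seidel matrix of order n with smallest eigenvalue exactly −5. If the clique number ω([S]) of the switching class of S equals 4 and the independence number α([S]) of the switching class of S is at most 28, then n ≤ 276. -/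
open Matrix

section FinsetPart
open Finset

/-- Truncated Shearer function. -/
noncomputable def shf : ℕ → ℝ
  | 0 => 1
  | 1 => 1/2
  | 2 => 2/5
  | (n+3) => (394 - 35 * ((n:ℝ)+3)) / 850

/-- Backward difference of the Shearer function. -/
noncomputable def shg : ℕ → ℝ
  | 0 => 1/2
  | 1 => 1/2
  | 2 => 1/10
  | 3 => 3/50
  | (_+4) => 7/170

lemma shf_succ (n : ℕ) : shf n - shf (n+1) = shg (n+1) := by
  match n with
  | 0 => norm_num [shf, shg]
  | 1 => norm_num [shf, shg]
  | 2 => norm_num [shf, shg]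
  | (k+3) => simp only [shf, shg]; push_cast; ring

lemma shg_anti : Antitone shg := by
  apply antitone_nat_of_succ_le
  intro n
  match n with
  | 0 => norm_num [shg]
  | 1 => norm_num [shg]
  | 2 => norm_num [shg]
  | 3 => norm_num [shg]
  | (k+4) => simp [shg]

lemma shf_conv (b k : ℕ) : (k:ℝ) * shg (b+k) ≤ shf b - shf (b+k) := by
  induction k with
  | zero => simp
  | succ k ih =>
    have h1 := shf_succ (b+k)
    have h2 : shg (b+k+1) ≤ shg (b+k) := shg_anti (by omega)
    have h3 : (k:ℝ) * shg (b+k+1) ≤ k * shg (b+k) := by gcongr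
    rw [← add_assoc]
    push_cast
    linarith

lemma shf_point (d : ℕ) : 0 ≤ 1 - ((d:ℝ)+1) * shf d + (d:ℝ) * ((d:ℝ)-1) * shg d := by
  match d with
  | 0 => norm_num [shf, shg]
  | 1 => norm_num [shf, shg]
  | 2 => norm_num [shf, shg]
  | 3 => norm_num [shf, shg]
  | (k+4) =>
    simp only [shf, shg]; push_cast
    have : (0:ℝ) ≤ k := Nat.cast_nonneg k
    nlinarith

lemma shf_lin (d : ℕ) : (394 - 35 * (d:ℝ)) / 850 ≤ shf d := by
  match d with
  | 0 => norm_num [shf]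
  | 1 => norm_num [shf]
  | 2 => norm_num [shf]
  | (k+3) => simp only [shf]; push_cast; linarith

open Classical in
/-- Real valued adjacency indicator. -/
noncomputable def aR {V : Type*} (G : SimpleGraph V) (u v : V) : ℝ := if G.Adj u v then 1 else 0

open Classical in
/-- Number of neighbours of `u` in `s`. -/
noncomputable def nb {V : Type*} (G : SimpleGraph V) (s : Finset V) (u : V) : ℕ :=
  (s.filter (G.Adj u)).card

section
variable {V : Type*} (G : SimpleGraph V)

lemma aR_symm (u v : V) : aR G u v = aR G v u := by
  by_cases h : G.Adj u v
  · simp [aR, h, h.symm]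
  · have h2 : ¬ G.Adj v u := fun h' => h h'.symm
    simp [aR, h, h2]

lemma aR_self (u : V) : aR G u u = 0 := by simp [aR]

lemma aR_nonneg (u v : V) : 0 ≤ aR G u v := by unfold aR; split_ifs <;> norm_num

lemma aR_adj {u v : V} (h : G.Adj u v) : aR G u v = 1 := by simp [aR, h]

lemma aR_not {u v : V} (h : ¬ G.Adj u v) : aR G u v = 0 := by simp [aR, h]

lemma sum_aR (s : Finset V) (u : V) : ∑ v ∈ s, aR G u v = (nb G s u : ℝ) := by
  classical
  simp [aR, nb, Finset.sum_boole]

open Classical in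
lemma shearer (a : ℕ) (s : Finset V)
    (htri : ∀ x ∈ s, ∀ y ∈ s, ∀ z ∈ s, G.Adj x y → G.Adj y z → G.Adj x z → False)
    (hα : ∀ S ⊆ s, (∀ x ∈ S, ∀ y ∈ S, ¬ G.Adj x y) → S.card ≤ a) :
    ∑ v ∈ s, shf (nb G s v) ≤ a := by
  induction hn : s.card using Nat.strong_induction_on generalizing s a with
  | _ n ih =>
  rcases s.eq_empty_or_nonempty with rfl | hne
  · simp
  set D : V → ℕ := nb G s with hD
  -- the remaining set
  let R : V → Finset V := fun v => s.filter (fun u => u ≠ v ∧ ¬ G.Adj v u)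
  have hRs : ∀ v, R v ⊆ s := fun v => filter_subset _ _
  let Φ : V → ℝ := fun v => 1 - ∑ u ∈ s, shf (D u) + ∑ u ∈ R v, shf (nb G (R v) u)
  have key : 0 ≤ ∑ v ∈ s, Φ v := by
    -- lower bound of each Φ
    have hΦ : ∀ v ∈ s, 1 - shf (D v) - ∑ u ∈ s, aR G v u * shf (D u)
        + ∑ u ∈ s, (∑ w ∈ s, aR G u w * (aR G w v * (if u = v then 0 else 1))) * shg (D u) ≤ Φ v := by
      intro v hv
      have e1 : ∑ u ∈ s, shf (D u) = ∑ u ∈ R v, shf (D u) + shf (D v)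
          + ∑ u ∈ s, aR G v u * shf (D u) := by
        have : ∑ u ∈ R v, shf (D u) = ∑ u ∈ s, (if u ≠ v ∧ ¬ G.Adj v u then shf (D u) else 0) := by
          rw [Finset.sum_filter]
        rw [this]
        have h2 : shf (D v) = ∑ u ∈ s, (if u = v then shf (D u) else 0) := by
          rw [Finset.sum_ite_eq' s v]; simp [hv]
        rw [h2, ← Finset.sum_add_distrib, ← Finset.sum_add_distrib]
        apply Finset.sum_congr rfl
        intro u _
        by_cases huv : u = v
        · subst huv; simp [aR_self]
        · by_cases h : G.Adj v u <;> simp [aR, huv, h]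
      have e2 : ∑ u ∈ s, (∑ w ∈ s, aR G u w * (aR G w v * (if u = v then 0 else 1))) * shg (D u)
          = ∑ u ∈ R v, (∑ w ∈ s, aR G u w * aR G w v) * shg (D u) := by
        rw [Finset.sum_filter]
        apply Finset.sum_congr rfl
        intro u hu
        by_cases huv : u = v
        · subst huv; simp
        · by_cases h : G.Adj v u
          · simp only [huv, h, not_true, and_false, if_false]
            rw [Finset.sum_eq_zero, zero_mul]
            intro w hw
            by_cases h1 : G.Adj u w
            · by_cases h2 : G.Adj w v
              · exact (htri u hu w hw v hv h1 h2 h.symm).elim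
              · simp [aR, h2]
            · simp [aR, h1]
          · simp [huv, h]
      have e3 : ∀ u ∈ R v, (∑ w ∈ s, aR G u w * aR G w v) * shg (D u)
          ≤ shf (nb G (R v) u) - shf (D u) := by
        intro u hu
        have hu' := (Finset.mem_filter.1 hu)
        have hsplit : (D u : ℝ) = nb G (R v) u + ∑ w ∈ s, aR G u w * aR G w v := by
          rw [hD, ← sum_aR, ← sum_aR, Finset.sum_filter, ← Finset.sum_add_distrib]
          apply Finset.sum_congr rfl
          intro w _
          by_cases hwv : w = v
          · subst hwv
            simp [aR_self]
            exact aR_not _ (fun h => hu'.2.2 h.symm)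
          · by_cases h : G.Adj v w
            · simp [hwv, h, aR_adj G h.symm]
            · have h2 : ¬ G.Adj w v := fun h' => h h'.symm
              simp [hwv, h, aR_not G h2]
        have hle : nb G (R v) u ≤ D u := by
          apply Finset.card_le_card
          exact Finset.filter_subset_filter _ (hRs v)
        obtain ⟨k, hk⟩ := Nat.exists_eq_add_of_le hle
        have h5 : ∑ w ∈ s, aR G u w * aR G w v = (k:ℝ) := by
          rw [hk] at hsplit; push_cast at hsplit; linarith
        rw [h5, hk]
        exact shf_conv _ _
      have e4 := Finset.sum_le_sum e3
      rw [Finset.sum_sub_distrib] at e4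
      simp only [Φ]
      rw [e2, e1]
      linarith
    refine le_trans ?_ (Finset.sum_le_sum hΦ)
    rw [Finset.sum_add_distrib, Finset.sum_sub_distrib]
    have s1 : ∑ v ∈ s, ∑ u ∈ s, aR G v u * shf (D u) = ∑ u ∈ s, (D u : ℝ) * shf (D u) := by
      rw [Finset.sum_comm]
      apply Finset.sum_congr rfl
      intro u _
      rw [← Finset.sum_mul, hD, ← sum_aR]
      congr 1
      exact Finset.sum_congr rfl (fun v _ => aR_symm G v u)
    have s2 : ∑ v ∈ s, ∑ u ∈ s, (∑ w ∈ s, aR G u w * (aR G w v * (if u = v then 0 else 1))) * shg (D u)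
        = ∑ u ∈ s, ∑ w ∈ s, aR G u w * ((D w : ℝ) - 1) * shg (D u) := by
      rw [Finset.sum_comm]
      apply Finset.sum_congr rfl
      intro u hu
      rw [← Finset.sum_mul, ← Finset.sum_mul, Finset.sum_comm]
      congr 1
      apply Finset.sum_congr rfl
      intro w _
      rw [← Finset.mul_sum]
      by_cases h : G.Adj u w
      · congr 1
        have : ∀ v ∈ s, aR G w v * (if u = v then 0 else 1)
            = aR G w v - (if u = v then aR G w v else 0) := by
          intro v _
          split_ifs <;> simp
        rw [Finset.sum_congr rfl this, Finset.sum_sub_distrib, sum_aR, Finset.sum_ite_eq]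
        simp [hu, aR_adj G h.symm, hD]
      · simp [aR_not G h]
    have s3 : ∑ u ∈ s, (D u : ℝ) * ((D u : ℝ) - 1) * shg (D u)
        ≤ ∑ u ∈ s, ∑ w ∈ s, aR G u w * ((D w : ℝ) - 1) * shg (D u) := by
      have t1 : ∑ u ∈ s, (D u : ℝ) * ((D u : ℝ) - 1) * shg (D u)
          = ∑ u ∈ s, ∑ w ∈ s, aR G u w * ((D u : ℝ) - 1) * shg (D u) := by
        apply Finset.sum_congr rfl
        intro u _
        rw [← Finset.sum_mul, ← Finset.sum_mul, sum_aR]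
      have t2 : ∑ u ∈ s, ∑ w ∈ s, aR G u w * ((D w : ℝ) - 1) * shg (D u)
          = ∑ u ∈ s, ∑ w ∈ s, aR G u w * ((D u : ℝ) - 1) * shg (D w) := by
        rw [Finset.sum_comm]
        refine Finset.sum_congr rfl (fun u _ => Finset.sum_congr rfl (fun w _ => ?_))
        rw [aR_symm]
      have t3 : ∑ u ∈ s, ∑ w ∈ s, aR G u w * ((D u : ℝ) - 1) * shg (D u)
          = ∑ u ∈ s, ∑ w ∈ s, aR G u w * ((D w : ℝ) - 1) * shg (D w) := by
        rw [Finset.sum_comm]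
        refine Finset.sum_congr rfl (fun u _ => Finset.sum_congr rfl (fun w _ => ?_))
        rw [aR_symm]
      have t4 : 0 ≤ ∑ u ∈ s, ∑ w ∈ s, aR G u w * (((D u : ℝ) - D w) * (shg (D w) - shg (D u))) := by
        refine Finset.sum_nonneg (fun u _ => Finset.sum_nonneg (fun w _ => ?_))
        apply mul_nonneg (aR_nonneg G u w)
        rcases le_total (D u) (D w) with h | h
        · have h1 := shg_anti h
          have h2 : (D u : ℝ) ≤ D w := by exact_mod_cast h
          exact mul_nonneg_of_nonpos_of_nonpos (by linarith) (by linarith)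
        · have h1 := shg_anti h
          have h2 : (D w : ℝ) ≤ D u := by exact_mod_cast h
          exact mul_nonneg (by linarith) (by linarith)
      have t5 : ∑ u ∈ s, ∑ w ∈ s, aR G u w * (((D u : ℝ) - D w) * (shg (D w) - shg (D u)))
          = ∑ u ∈ s, ∑ w ∈ s, aR G u w * ((D u : ℝ) - 1) * shg (D w)
          + ∑ u ∈ s, ∑ w ∈ s, aR G u w * ((D w : ℝ) - 1) * shg (D u)
          - ∑ u ∈ s, ∑ w ∈ s, aR G u w * ((D u : ℝ) - 1) * shg (D u)
          - ∑ u ∈ s, ∑ w ∈ s, aR G u w * ((D w : ℝ) - 1) * shg (D w) := by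
        simp only [← Finset.sum_add_distrib, ← Finset.sum_sub_distrib]
        refine Finset.sum_congr rfl (fun u _ => Finset.sum_congr rfl (fun w _ => ?_))
        ring
      linarith
    have s4 : 0 ≤ ∑ u ∈ s, (1 - ((D u:ℝ)+1) * shf (D u) + (D u:ℝ) * ((D u:ℝ)-1) * shg (D u)) :=
      Finset.sum_nonneg (fun u _ => shf_point _)
    have s5 : ∑ u ∈ s, (1 - ((D u:ℝ)+1) * shf (D u) + (D u:ℝ) * ((D u:ℝ)-1) * shg (D u))
        = ∑ u ∈ s, (1 - shf (D u)) - ∑ u ∈ s, (D u : ℝ) * shf (D u)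
          + ∑ u ∈ s, (D u : ℝ) * ((D u : ℝ) - 1) * shg (D u) := by
      rw [← Finset.sum_sub_distrib, ← Finset.sum_add_distrib]
      exact Finset.sum_congr rfl (fun u _ => by ring)
    rw [s1, s2]
    linarith
  obtain ⟨v, hv, hΦv⟩ : ∃ v ∈ s, 0 ≤ Φ v := by
    by_contra hcon
    push Not at hcon
    exact absurd key (not_le.2 (Finset.sum_neg hcon hne))
  have hvR : v ∉ R v := by simp [R]
  have hcard : (R v).card < n := by
    rw [← hn]
    exact Finset.card_lt_card ((Finset.ssubset_iff_of_subset (hRs v)).2 ⟨v, hv, hvR⟩)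
  have ha1 : 1 ≤ a := by
    have := hα {v} (by simpa using hv) (by simp)
    simpa using this
  have hrec := ih (R v).card hcard (a-1) (R v)
    (fun x hx y hy z hz => htri x (hRs v hx) y (hRs v hy) z (hRs v hz))
    (by
      intro S hS hind
      have hvS : v ∉ S := fun h => hvR (hS h)
      have := hα (insert v S) (by
        intro x hx
        rcases Finset.mem_insert.1 hx with rfl | hx
        · exact hv
        · exact hRs v (hS hx)) (by
        have hn : ∀ x ∈ S, ¬ G.Adj v x := fun x hx => (Finset.mem_filter.1 (hS hx)).2.2
        intro x hx y hy
        rcases Finset.mem_insert.1 hx with hx1 | hx1 <;>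
          rcases Finset.mem_insert.1 hy with hy1 | hy1
        · rw [hx1, hy1]; simp
        · rw [hx1]; exact hn y hy1
        · rw [hy1]; exact fun h => hn x hx1 h.symm
        · exact hind x hx1 y hy1)
      rw [Finset.card_insert_of_notMem hvS] at this
      omega) rfl
  have : ((a - 1 : ℕ) : ℝ) = a - 1 := by push_cast [ha1]; ring
  rw [this] at hrec
  simp only [Φ] at hΦv
  linarith
end

section
variable {V : Type*} (G : SimpleGraph V)

lemma aR_sq (u v : V) : aR G u v ^ 2 = aR G u v := by
  unfold aR; split_ifs <;> norm_num

/-- The quadratic form appearing in the residual inequality. -/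
noncomputable def qF (I W : Finset V) (y : V → ℝ) : ℝ :=
  36 * ∑ u ∈ W, y u ^ 2 - 18 * ∑ u ∈ W, ∑ w ∈ W, aR G u w * (y u * y w)
    - ((I.card : ℝ) - 4) * (∑ u ∈ W, y u) ^ 2
    + 6 * (∑ u ∈ W, y u) * (∑ u ∈ W, y u * nb G I u)
    - 9 * ∑ v ∈ I, (∑ u ∈ W, aR G u v * y u) ^ 2

/-- The combinatorial configuration around a triple. -/
structure Cfg (I W : Finset V) : Prop where
  hQ : ∀ W' ⊆ W, ∀ y : V → ℝ, 0 ≤ qF G I W' y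
  htri : ∀ x ∈ W, ∀ y ∈ W, ∀ z ∈ W, G.Adj x y → G.Adj y z → G.Adj x z → False
  hcom : ∀ x ∈ W, ∀ y ∈ W, ∀ z ∈ I, G.Adj x y → G.Adj y z → G.Adj x z → False
  hα : ∀ S ⊆ W, (∀ x ∈ S, ∀ y ∈ S, ¬ G.Adj x y) → S.card ≤ 26
  hx : ∀ v ∈ I, nb G W v + 1 ≤ I.card
  hdeg : ∀ u ∈ W, nb G W u ≤ I.card

variable {G}

lemma nb_mono {s t : Finset V} (h : s ⊆ t) (u : V) : nb G s u ≤ nb G t u := by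
  classical
  exact Finset.card_le_card (Finset.filter_subset_filter _ h)

variable {I W : Finset V}

lemma Cfg.mono (h : Cfg G I W) {W' : Finset V} (hW : W' ⊆ W) : Cfg G I W' where
  hQ := fun X hX => h.hQ X (hX.trans hW)
  htri := fun x hx y hy z hz => h.htri x (hW hx) y (hW hy) z (hW hz)
  hcom := fun x hx y hy z hz => h.hcom x (hW hx) y (hW hy) z hz
  hα := fun S hS => h.hα S (hS.trans hW)
  hx := fun v hv => by have := h.hx v hv; have := nb_mono (G := G) hW v; omega
  hdeg := fun u hu => (nb_mono hW u).trans (h.hdeg u (hW hu))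

lemma Cfg.single (h : Cfg G I W) {u : V} (hu : u ∈ W) :
    3 * nb G I u + I.card ≤ 40 := by
  have := h.hQ {u} (by simpa using hu) (fun _ => 1)
  simp only [qF, sum_singleton, aR_self, mul_one, one_pow, aR_sq, sum_aR] at this
  have : (3 * nb G I u + I.card : ℝ) ≤ 40 := by linarith
  exact_mod_cast this

lemma Cfg.pair (h : Cfg G I W) {u w : V} (hu : u ∈ W) (hw : w ∈ W) (hne : u ≠ w) (α β : ℝ) :
    0 ≤ 36 * (α ^ 2 + β ^ 2) - 36 * aR G u w * (α * β) - ((I.card : ℝ) - 4) * (α + β) ^ 2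
      + 6 * (α + β) * (α * nb G I u + β * nb G I w)
      - 9 * (α ^ 2 * nb G I u + β ^ 2 * nb G I w + 2 * α * β * ∑ v ∈ I, aR G u v * aR G w v) := by
  classical
  have := h.hQ {u, w} (by intro x hx; simp at hx; rcases hx with rfl | rfl <;> assumption)
    (fun x => if x = u then α else β)
  simp only [qF, sum_pair hne, aR_self, if_true, if_neg hne.symm] at this
  have e : ∑ v ∈ I, (aR G u v * α + aR G w v * β) ^ 2
      = α ^ 2 * nb G I u + β ^ 2 * nb G I w + 2 * α * β * ∑ v ∈ I, aR G u v * aR G w v := by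
    rw [← sum_aR, ← sum_aR, mul_sum, mul_sum, mul_sum, ← sum_add_distrib, ← sum_add_distrib]
    refine sum_congr rfl (fun v _ => ?_)
    rw [← aR_sq G u v, ← aR_sq G w v]
    have h1 := aR_sq G u v
    have h2 := aR_sq G w v
    rw [h1, h2]
    linear_combination α ^ 2 * h1 + β ^ 2 * h2
  rw [e, aR_symm G w u] at this
  linarith

lemma Cfg.common (h : Cfg G I W) {u w : V} (hu : u ∈ W) (hw : w ∈ W) (ha : G.Adj u w) :
    ∑ v ∈ I, aR G u v * aR G w v = 0 := by
  refine sum_eq_zero (fun v hv => ?_)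
  by_cases h1 : G.Adj u v
  · by_cases h2 : G.Adj w v
    · exact (h.hcom u hu w hw v hv ha h2 h1).elim
    · simp [aR_not G h2]
  · simp [aR_not G h1]

lemma Cfg.edge (h : Cfg G I W) {u w : V} (hu : u ∈ W) (hw : w ∈ W) (ha : G.Adj u w) :
    4 * I.card ≤ 52 + 3 * (nb G I u + nb G I w) := by
  have h1 := h.pair hu hw ha.ne 1 1
  rw [h.common hu hw ha, aR_adj G ha] at h1
  have : (4 * I.card : ℝ) ≤ 52 + 3 * (nb G I u + nb G I w) := by linarith
  exact_mod_cast this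

lemma sum_swap (L : Finset V) : ∑ v ∈ I, (nb G L v : ℝ) = ∑ u ∈ L, (nb G I u : ℝ) := by
  simp_rw [← sum_aR]
  rw [sum_comm]
  exact sum_congr rfl (fun u _ => sum_congr rfl (fun v _ => aR_symm G v u))

lemma qF_one (L : Finset V) : qF G I L (fun _ => 1) = 36 * (L.card : ℝ) - 18 * ∑ u ∈ L, (nb G L u : ℝ)
    - ((I.card : ℝ) - 4) * (L.card : ℝ) ^ 2
    + 6 * (L.card : ℝ) * (∑ v ∈ I, (nb G L v : ℝ))
    - 9 * ∑ v ∈ I, (nb G L v : ℝ) ^ 2 := by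
  have e : ∀ v, ∑ u ∈ L, aR G u v = (nb G L v : ℝ) := by
    intro v
    rw [← sum_aR]
    exact sum_congr rfl (fun u _ => aR_symm G u v)
  have e2 := sum_swap (G := G) (I := I) L
  rw [e2]
  simp [qF, e, sum_aR]

lemma Cfg.all (h : Cfg G I W) : 0 ≤ 36 * (W.card : ℝ) - 18 * ∑ u ∈ W, (nb G W u : ℝ)
    - ((I.card : ℝ) - 4) * (W.card : ℝ) ^ 2
    + ∑ v ∈ I, (6 * (W.card : ℝ) * (nb G W v : ℝ) - 9 * (nb G W v : ℝ) ^ 2) := by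
  have := h.hQ W (Subset.refl _) (fun _ => 1)
  rw [qF_one] at this
  rw [sum_sub_distrib, ← mul_sum, ← mul_sum]
  linarith

lemma Cfg.indep (h : Cfg G I W) {L : Finset V} (hL : L ⊆ W) (hi : ∀ x ∈ L, ∀ y ∈ L, ¬ G.Adj x y) :
    9 * (∑ u ∈ L, (nb G I u : ℝ)) ^ 2 ≤ (I.card : ℝ) * (36 * (L.card : ℝ) - ((I.card : ℝ) - 4) * (L.card : ℝ) ^ 2
    + 6 * (L.card : ℝ) * (∑ u ∈ L, (nb G I u : ℝ))) := by
  have h1 := h.hQ L hL (fun _ => 1)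
  rw [qF_one] at h1
  have h0 : ∑ u ∈ L, (nb G L u : ℝ) = 0 := by
    refine sum_eq_zero (fun u hu => ?_)
    rw [← sum_aR]
    exact sum_eq_zero (fun v hv => aR_not G (hi u hu v hv))
  rw [h0] at h1
  have h2 : (∑ v ∈ I, (nb G L v : ℝ)) ^ 2 ≤ (I.card : ℝ) * ∑ v ∈ I, (nb G L v : ℝ) ^ 2 :=
    sq_sum_le_card_mul_sum_sq
  rw [← sum_swap]
  have h3 : (0:ℝ) ≤ I.card := Nat.cast_nonneg _
  nlinarith

lemma Cfg.total (h : Cfg G I W) : ∑ u ∈ W, (nb G I u : ℝ) ≤ (I.card : ℝ) * ((I.card : ℝ) - 1) := by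
  rw [← sum_swap]
  have : ∑ v ∈ I, (nb G W v : ℝ) ≤ ∑ v ∈ I, ((I.card : ℝ) - 1) := by
    refine sum_le_sum (fun v hv => ?_)
    have h1 := h.hx v hv
    have : (nb G W v : ℝ) + 1 ≤ I.card := by exact_mod_cast h1
    linarith
  rwa [sum_const, nsmul_eq_mul] at this

lemma Cfg.shear (h : Cfg G I W) {s : Finset V} (hs : s ⊆ W) :
    ∑ v ∈ s, shf (nb G s v) ≤ 26 := by
  have := shearer G 26 s (fun x hx y hy z hz => h.htri x (hs hx) y (hs hy) z (hs hz))
    (fun S hS => h.hα S (hS.trans hs))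
  simpa using this

lemma Cfg.star (h : Cfg G I W) {u : V} (hu : u ∈ W) {N : Finset V} (hN : N ⊆ W)
    (ha : ∀ w ∈ N, G.Adj u w) (τ : ℕ) (hτ : nb G I u = τ) (hτ' : ∀ w ∈ N, nb G I w = τ) :
    9 * ∑ v ∈ I, (nb G N v : ℝ) ^ 2 ≤ 36 * (N.card : ℝ) - 4 * ((I.card : ℝ) - 4) * (N.card : ℝ) ^ 2
      + 15 * (N.card : ℝ) ^ 2 * τ := by
  classical
  have huN : u ∉ N := fun hh => (ha u hh).ne rfl
  have h1 := h.hQ (insert u N) (by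
    intro x hx
    rcases mem_insert.1 hx with hx | hx
    · rw [hx]; exact hu
    · exact hN hx) (fun x => if x = u then (N.card : ℝ) else 1)
  have hy : ∀ w ∈ N, (if w = u then (N.card : ℝ) else 1) = 1 := by
    intro w hw
    rw [if_neg]
    rintro rfl
    exact huN hw
  unfold qF at h1
  simp only [sum_insert huN, if_true] at h1
  have e1 : ∑ w ∈ N, (if w = u then (N.card : ℝ) else 1) ^ 2 = N.card := by
    rw [sum_congr rfl (fun w hw => by rw [hy w hw])]; simp
  have e2 : ∑ w ∈ N, (if w = u then (N.card : ℝ) else 1) = N.card := by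
    rw [sum_congr rfl hy]; simp
  have e3 : ∑ w ∈ N, (if w = u then (N.card : ℝ) else 1) * (nb G I w : ℝ) = N.card * τ := by
    rw [sum_congr rfl (fun w hw => by rw [hy w hw, hτ' w hw])]; simp
  have e4 : ∑ w ∈ N, aR G u w * ((N.card : ℝ) * (if w = u then (N.card : ℝ) else 1)) = (N.card : ℝ) ^ 2 := by
    rw [sum_congr rfl (fun w hw => by rw [hy w hw, aR_adj G (ha w hw)])]; simp; ring
  have e5 : ∑ x ∈ N, (aR G x u * ((if x = u then (N.card : ℝ) else 1) * (N.card : ℝ)) +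
      ∑ w ∈ N, aR G x w * ((if x = u then (N.card : ℝ) else 1) * (if w = u then (N.card : ℝ) else 1)))
      = (N.card : ℝ) ^ 2 := by
    have : ∀ x ∈ N, (aR G x u * ((if x = u then (N.card : ℝ) else 1) * (N.card : ℝ)) +
      ∑ w ∈ N, aR G x w * ((if x = u then (N.card : ℝ) else 1) * (if w = u then (N.card : ℝ) else 1)))
      = N.card := by
      intro x hx
      rw [hy x hx, aR_adj G (ha x hx).symm, sum_eq_zero]
      · ring
      · intro w hw
        rw [aR_not G]
        · ring
        · intro hxw
          exact h.htri u hu x (hN hx) w (hN hw) (ha x hx) hxw (ha w hw)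
    rw [sum_congr rfl this]; simp; ring
  have e6 : ∑ v ∈ I, (aR G u v * (N.card : ℝ) + ∑ w ∈ N, aR G w v * (if w = u then (N.card : ℝ) else 1)) ^ 2
      = (N.card : ℝ) ^ 2 * τ + ∑ v ∈ I, (nb G N v : ℝ) ^ 2 := by
    rw [← hτ, ← sum_aR, mul_sum, ← sum_add_distrib]
    refine sum_congr rfl (fun v hv => ?_)
    have : ∑ w ∈ N, aR G w v * (if w = u then (N.card : ℝ) else 1) = nb G N v := by
      rw [← sum_aR]
      refine sum_congr rfl (fun w hw => ?_)
      rw [hy w hw, aR_symm G w v, mul_one]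
    rw [this]
    by_cases huv : G.Adj u v
    · have h0 : (nb G N v : ℝ) = 0 := by
        rw [← sum_aR]
        refine sum_eq_zero (fun w hw => aR_not G (fun hvw => ?_))
        exact h.hcom u hu w (hN hw) v hv (ha w hw) hvw.symm huv
      rw [h0, aR_adj G huv]; ring
    · rw [aR_not G huv]; ring
  rw [e1, e2, e3, e4, e5, e6, hτ, aR_self] at h1
  nlinarith
end

section
variable {V : Type*} {G : SimpleGraph V}

lemma split2 (W : Finset V) (f : V → ℕ) (k : ℕ) :
    ∑ u ∈ W.filter (fun u => f u ≤ k), (f u : ℝ)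
      + ((k:ℝ) + 1) * ((W.card : ℝ) - (W.filter (fun u => f u ≤ k)).card) ≤ ∑ u ∈ W, (f u : ℝ) := by
  have e := sum_filter_add_sum_filter_not W (fun u => f u ≤ k) (fun u => (f u : ℝ))
  have c := card_filter_add_card_filter_not (s := W) (fun u => f u ≤ k)
  have c' : ((W.filter (fun u => f u ≤ k)).card : ℝ) + ((W.filter (fun u => ¬ f u ≤ k)).card : ℝ) = W.card := by
    exact_mod_cast c
  have h : ∑ u ∈ W.filter (fun u => ¬ f u ≤ k), ((k:ℝ)+1) ≤ ∑ u ∈ W.filter (fun u => ¬ f u ≤ k), (f u : ℝ) := by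
    refine sum_le_sum (fun u hu => ?_)
    have := (mem_filter.1 hu).2
    have h2 : k + 1 ≤ f u := by omega
    exact_mod_cast h2
  rw [sum_const, nsmul_eq_mul] at h
  rw [← e, ← c']
  linarith

lemma split3 (W : Finset V) (f : V → ℕ) (k : ℕ) :
    ∑ u ∈ W.filter (fun u => f u ≤ k), (f u : ℝ)
      + ((k:ℝ) + 1) * ((W.filter (fun u => f u = k + 1)).card : ℝ)
      + ((k:ℝ) + 2) * ((W.card : ℝ) - (W.filter (fun u => f u ≤ k)).card
        - (W.filter (fun u => f u = k + 1)).card) ≤ ∑ u ∈ W, (f u : ℝ) := by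
  have e := split2 W f (k+1)
  have d : Disjoint (W.filter (fun u => f u ≤ k)) (W.filter (fun u => f u = k + 1)) := by
    rw [disjoint_filter]
    intro u _ h; omega
  classical
  have un : W.filter (fun u => f u ≤ k + 1)
      = W.filter (fun u => f u ≤ k) ∪ W.filter (fun u => f u = k + 1) := by
    ext u; simp only [mem_filter, mem_union]
    constructor
    · rintro ⟨a, b⟩
      by_cases h : f u ≤ k
      · exact Or.inl ⟨a, h⟩
      · exact Or.inr ⟨a, by omega⟩
    · rintro (⟨a, b⟩ | ⟨a, b⟩)
      · exact ⟨a, by omega⟩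
      · exact ⟨a, by omega⟩
  have s : ∑ u ∈ W.filter (fun u => f u = k + 1), (f u : ℝ)
      = ((k:ℝ) + 1) * ((W.filter (fun u => f u = k + 1)).card : ℝ) := by
    rw [sum_congr rfl (fun u hu => by rw [(mem_filter.1 hu).2]), sum_const, nsmul_eq_mul]
    push_cast; ring
  rw [un, sum_union d, card_union_of_disjoint d, s] at e
  push_cast at e
  linarith

variable {I W : Finset V}

lemma Cfg.lowd (h : Cfg G I W) (hd : I.card ≤ 4) (hm : 90 ≤ W.card) : False := by
  have h1 := h.shear (Subset.refl W)
  have h2 : ∑ v ∈ W, (254 / 850 : ℝ) ≤ ∑ v ∈ W, shf (nb G W v) := by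
    refine sum_le_sum (fun v hv => ?_)
    have h3 := shf_lin (nb G W v)
    have h4 : (nb G W v : ℝ) ≤ 4 := by exact_mod_cast (h.hdeg v hv).trans hd
    refine le_trans ?_ h3
    linarith
  rw [sum_const, nsmul_eq_mul] at h2
  have : (90:ℝ) ≤ W.card := by exact_mod_cast hm
  nlinarith

lemma Cfg.midd (h : Cfg G I W) (hd : 5 ≤ I.card) (hd' : I.card ≤ 16)
    (hm : W.card = (276 - I.card) / 3) : False := by
  have h1 := h.shear (Subset.refl W)
  have h2 : ∑ v ∈ W, ((394 - 35 * (nb G W v : ℝ)) / 850) ≤ ∑ v ∈ W, shf (nb G W v) :=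
    sum_le_sum (fun v hv => shf_lin _)
  rw [← sum_div, sum_sub_distrib, sum_const, nsmul_eq_mul, ← mul_sum] at h2
  have h3 := h.all
  have hb : (86:ℝ) ≤ W.card := by
    have : 86 ≤ W.card := by omega
    exact_mod_cast this
  have hd16 : (I.card : ℝ) ≤ 16 := by exact_mod_cast hd'
  have h4 : ∑ v ∈ I, (6 * (W.card : ℝ) * (nb G W v : ℝ) - 9 * (nb G W v : ℝ) ^ 2)
      ≤ ∑ v ∈ I, (6 * (W.card : ℝ) * ((I.card : ℝ) - 1) - 9 * ((I.card : ℝ) - 1) ^ 2) := by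
    refine sum_le_sum (fun v hv => ?_)
    have h5 : (nb G W v : ℝ) + 1 ≤ I.card := by exact_mod_cast h.hx v hv
    have h6 : 0 ≤ ((I.card : ℝ) - 1 - nb G W v) * (6 * W.card - 9 * ((I.card : ℝ) - 1 + nb G W v)) :=
      mul_nonneg (by linarith) (by linarith)
    linarith
  rw [sum_const, nsmul_eq_mul] at h4
  generalize ∑ u ∈ W, (nb G W u : ℝ) = E at *
  have h7 : 394 * (W.card : ℝ) - 35 * E ≤ 22100 := by
    have := h2.trans h1
    rw [div_le_iff₀ (by norm_num)] at this
    linarith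
  have h8 := h3.trans (add_le_add_right h4 _)
  generalize W.card = m at *
  generalize I.card = d at *
  clear h4 h3 h2 h1
  interval_cases d <;> norm_num at hm <;> subst hm <;> norm_num at h7 h8 <;> linarith

lemma Cfg.highd (h : Cfg G I W) (hd : 23 ≤ I.card) : W.card ≤ 26 := by
  refine h.hα W (Subset.refl W) (fun x hx y hy ha => ?_)
  have h1 := h.edge hx hy ha
  have h2 := h.single hx
  have h3 := h.single hy
  omega

/-- low-`t` vertices are independent if edges need large `t` -/
lemma Cfg.low_indep (h : Cfg G I W) (k : ℕ) (hk : 52 + 6 * k < 4 * I.card) :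
    ∀ x ∈ W.filter (fun u => nb G I u ≤ k), ∀ y ∈ W.filter (fun u => nb G I u ≤ k), ¬ G.Adj x y := by
  intro x hx y hy ha
  have hx := mem_filter.1 hx
  have hy := mem_filter.1 hy
  have := h.edge hx.1 hy.1 ha
  omega

lemma Cfg.lin (h : Cfg G I W) {L : Finset V} (hL : L ⊆ W) (hi : ∀ x ∈ L, ∀ y ∈ L, ¬ G.Adj x y)
    (hne : 0 < L.card) (hI : 0 < I.card) :
    ((I.card : ℝ) - 4) * L.card - 36 ≤ 6 * ∑ u ∈ L, (nb G I u : ℝ) := by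
  have h1 := h.indep hL hi
  generalize ∑ u ∈ L, (nb G I u : ℝ) = T at *
  have hl : (0:ℝ) < L.card := by exact_mod_cast hne
  have hd : (0:ℝ) < I.card := by exact_mod_cast hI
  have h2 : 0 ≤ (I.card : ℝ) * (36 * (L.card : ℝ) - ((I.card : ℝ) - 4) * (L.card : ℝ) ^ 2
    + 6 * (L.card : ℝ) * T) := le_trans (by positivity) h1
  have h3 := nonneg_of_mul_nonneg_right h2 hd
  have h4 : 0 ≤ (L.card : ℝ) * (36 - ((I.card : ℝ) - 4) * (L.card : ℝ) + 6 * T) := by linarith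
  have h5 := nonneg_of_mul_nonneg_right h4 hl
  linarith

lemma Cfg.d18 (h : Cfg G I W) (hd : I.card = 18) (hm : W.card = 86) : False := by
  have hi := h.low_indep 3 (by omega)
  have hl := h.hα _ (filter_subset _ _) hi
  have h1 := h.indep (filter_subset _ _) hi
  have h2 := split2 W (nb G I) 3
  have h3 := h.total
  generalize ∑ u ∈ W.filter (fun u => nb G I u ≤ 3), (nb G I u : ℝ) = T at *
  have hl' : ((W.filter (fun u => nb G I u ≤ 3)).card : ℝ) ≤ 26 := by exact_mod_cast hl
  have hl0 : (0:ℝ) ≤ ((W.filter (fun u => nb G I u ≤ 3)).card : ℝ) := Nat.cast_nonneg _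
  generalize ((W.filter (fun u => nb G I u ≤ 3)).card : ℝ) = l at *
  rw [hd] at h1 h3
  rw [hm] at h2
  norm_num at h1 h2 h3
  have h4 : T ≤ 4 * l - 38 := by linarith
  have h5 : 0 ≤ (4 * l - 38 - T) * (12 * l - T - (4 * l - 38)) := mul_nonneg (by linarith) (by linarith)
  nlinarith

lemma Cfg.d21 (h : Cfg G I W) (hd : I.card = 21) (hm : W.card = 85) : False := by
  have hi := h.low_indep 5 (by omega)
  have hl := h.hα _ (filter_subset _ _) hi
  have h1 := h.indep (filter_subset _ _) hi
  have h2 := split2 W (nb G I) 5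
  have h3 := h.total
  generalize ∑ u ∈ W.filter (fun u => nb G I u ≤ 5), (nb G I u : ℝ) = T at *
  have hl' : ((W.filter (fun u => nb G I u ≤ 5)).card : ℝ) ≤ 26 := by exact_mod_cast hl
  have hl0 : (0:ℝ) ≤ ((W.filter (fun u => nb G I u ≤ 5)).card : ℝ) := Nat.cast_nonneg _
  generalize ((W.filter (fun u => nb G I u ≤ 5)).card : ℝ) = l at *
  rw [hd] at h1 h3
  rw [hm] at h2
  norm_num at h1 h2 h3
  have h4 : T ≤ 6 * l - 90 := by linarith
  have h5 : 0 ≤ (6 * l - 90 - T) * (14 * l - T - (6 * l - 90)) := mul_nonneg (by linarith) (by linarith)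
  nlinarith

lemma Cfg.d20 (h : Cfg G I W) (hd : I.card = 20) (hm : W.card = 85) : False := by
  classical
  have hi := h.low_indep 4 (by omega)
  have h0 := h.hα _ (filter_subset _ _) hi
  have h1 := h.indep (filter_subset _ _) hi
  have hlin := h.lin (filter_subset _ _) hi
  have h2 := split2 W (nb G I) 4
  have h2' := split3 W (nb G I) 4
  have h3 := h.total
  set L := W.filter (fun u => nb G I u ≤ 4) with hL
  set M := W.filter (fun u => nb G I u = 4 + 1) with hM
  generalize ∑ u ∈ L, (nb G I u : ℝ) = T at *
  have hl0 : (0:ℝ) ≤ (L.card : ℝ) := Nat.cast_nonneg _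
  rw [hd] at h1 h3 hlin
  rw [hm] at h2 h2'
  norm_num at h1 h2 h2' h3 hlin
  by_cases hc : 3 ≤ M.card
  · obtain ⟨x, y, z, hx, hy, hz, hxy, hxz, hyz⟩ := two_lt_card_iff.1 hc
    obtain ⟨p, q, hp, hq, hpq, hnad⟩ : ∃ p q, p ∈ M ∧ q ∈ M ∧ p ≠ q ∧ ¬ G.Adj p q := by
      by_contra hcon
      push Not at hcon
      exact h.htri x (mem_filter.1 hx).1 y (mem_filter.1 hy).1 z (mem_filter.1 hz).1
        (hcon x y hx hy hxy) (hcon y z hy hz hyz) (hcon x z hx hz hxz)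
    have hML : ∀ a ∈ M, ∀ b ∈ L, ¬ G.Adj a b := by
      intro a ha b hb hab
      have ha := mem_filter.1 ha
      have hb := mem_filter.1 hb
      have := h.edge ha.1 hb.1 hab
      omega
    have hpL : p ∉ L := fun hh => by
      have := (mem_filter.1 hh).2
      have := (mem_filter.1 hp).2
      omega
    have hqL : q ∉ L := fun hh => by
      have := (mem_filter.1 hh).2
      have := (mem_filter.1 hq).2
      omega
    have hl := h.hα (insert p (insert q L)) (by
      intro a ha
      simp only [mem_insert] at ha
      rcases ha with ha | ha | ha
      · rw [ha]; exact (mem_filter.1 hp).1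
      · rw [ha]; exact (mem_filter.1 hq).1
      · exact (mem_filter.1 ha).1) (by
      intro a ha b hb
      simp only [mem_insert] at ha hb
      rcases ha with ha | ha | ha <;> rcases hb with hb | hb | hb
      · rw [ha, hb]; simp
      · rw [ha, hb]; exact hnad
      · rw [ha]; exact hML p hp b hb
      · rw [ha, hb]; exact fun hh => hnad hh.symm
      · rw [ha, hb]; simp
      · rw [ha]; exact hML q hq b hb
      · rw [hb]; exact fun hh => hML p hp a ha hh.symm
      · rw [hb]; exact fun hh => hML q hq a ha hh.symm
      · exact hi a ha b hb)
    rw [card_insert_of_notMem (by simp [hpq, hpL]), card_insert_of_notMem hqL] at hl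
    have hl' : (L.card : ℝ) ≤ 24 := by
      have : L.card ≤ 24 := by omega
      exact_mod_cast this
    generalize (L.card : ℝ) = l at *
    have h4 : T ≤ 5 * l - 45 := by linarith
    have h5 : 0 ≤ (5 * l - 45 - T) * (40 * l - 3 * T - 3 * (5 * l - 45)) :=
      mul_nonneg (by linarith) (by linarith)
    nlinarith
  · have hM2 : (M.card : ℝ) ≤ 2 := by
      have : M.card ≤ 2 := by omega
      exact_mod_cast this
    have hl26 : (L.card : ℝ) ≤ 26 := by exact_mod_cast h0
    rcases Nat.eq_zero_or_pos L.card with hz | hz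
    · rw [hz] at h1 h2'
      norm_num at h1 h2'
      nlinarith
    · have := hlin (card_pos.1 hz)
      linarith

lemma Cfg.d22 (h : Cfg G I W) (hd : I.card = 22) (hm : W.card = 84) : False := by
  have hi := h.low_indep 5 (by omega)
  have h0 := h.hα _ (filter_subset _ _) hi
  have h1 := h.indep (filter_subset _ _) hi
  have hlin := h.lin (filter_subset _ _) hi
  have h2 := split2 W (nb G I) 5
  have h3 := h.total
  have ⟨u, hu, hu6⟩ : ∃ u ∈ W, nb G I u = 6 := by
    by_contra hcon
    push Not at hcon
    have : W.filter (fun u => nb G I u ≤ 5) = W := by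
      apply filter_true_of_mem
      intro x hx
      have := hcon x hx
      have := h.single hx
      omega
    rw [this] at h0
    omega
  have h3t : ∀ w ∈ W.filter (fun u => nb G I u ≤ 5), nb G I w ≤ 3 := by
    intro w hw
    have hw := mem_filter.1 hw
    have hne : u ≠ w := by rintro rfl; omega
    have hz : ∀ α : ℝ, 0 ≤ 36 * (α ^ 2 + 1 ^ 2) - 36 * aR G u w * (α * 1) - ((I.card : ℝ) - 4) * (α + 1) ^ 2
      + 6 * (α + 1) * (α * nb G I u + 1 * nb G I w)
      - 9 * (α ^ 2 * nb G I u + 1 ^ 2 * nb G I w + 2 * α * 1 * ∑ v ∈ I, aR G u v * aR G w v) :=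
      fun α => h.pair hu hw.1 hne α 1
    rw [hu6, hd] at hz
    obtain ⟨c, hc⟩ : ∃ c : ℕ, ∑ v ∈ I, aR G u v * aR G w v = c := by
      classical
      refine ⟨∑ v ∈ I, if G.Adj u v ∧ G.Adj w v then 1 else 0, ?_⟩
      push_cast
      refine sum_congr rfl (fun v _ => ?_)
      by_cases h1 : G.Adj u v <;> by_cases h2 : G.Adj w v <;> simp [aR, h1, h2]
    rw [hc] at hz
    have hlinz : ∀ B C : ℝ, (∀ α : ℝ, 0 ≤ C + B * α) → B = 0 := by
      intro B C hh
      by_contra hB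
      have := hh ((-C - 1) / B)
      rw [mul_div_cancel₀ _ hB] at this
      linarith
    have key := hlinz (- 36 * aR G u w + 6 * nb G I w - 18 * c) (18 - 3 * nb G I w) (fun α => by
      have := hz α
      norm_num at this
      nlinarith)
    by_cases ha : G.Adj u w
    · have := h.edge hu hw.1 ha
      omega
    · rw [aR_not G ha] at key
      have k2 : (nb G I w : ℝ) = 3 * c := by linarith
      have k3 : nb G I w = 3 * c := by exact_mod_cast k2
      omega
  have hT3 : ∑ u ∈ W.filter (fun u => nb G I u ≤ 5), (nb G I u : ℝ)
      ≤ ∑ u ∈ W.filter (fun u => nb G I u ≤ 5), (3:ℝ) :=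
    sum_le_sum (fun w hw => by exact_mod_cast h3t w hw)
  rw [sum_const, nsmul_eq_mul] at hT3
  have hT0 : 0 ≤ ∑ u ∈ W.filter (fun u => nb G I u ≤ 5), (nb G I u : ℝ) :=
    sum_nonneg (fun w hw => Nat.cast_nonneg _)
  generalize W.filter (fun u => nb G I u ≤ 5) = L at *
  generalize ∑ u ∈ L, (nb G I u : ℝ) = T at *
  rw [hd] at h1 h3 hlin
  rw [hm] at h2
  norm_num at h1 h2 h3 hlin
  have hl0 : (0:ℝ) ≤ (L.card : ℝ) := Nat.cast_nonneg _
  rcases Nat.eq_zero_or_pos L.card with hz | hz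
  · rw [hz] at hT3 h2
    norm_num at hT3 h2
    linarith
  · have h6 := hlin (card_pos.1 hz)
    have hl26 : (L.card : ℝ) ≤ 26 := by exact_mod_cast h0
    generalize (L.card : ℝ) = l at *
    have h7 : 12 ≤ l := by linarith
    have h5 : 0 ≤ (3 * l - T) * (44 * l - 3 * T - 3 * (3 * l)) := mul_nonneg (by linarith) (by linarith)
    nlinarith
end

section
variable {V : Type*} {G : SimpleGraph V}

lemma shf_anti : Antitone shf := by
  apply antitone_nat_of_succ_le
  intro n
  have h1 := shf_succ n
  have h2 : 0 ≤ shg (n+1) := by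
    match n with
    | 0 => norm_num [shg]
    | 1 => norm_num [shg]
    | 2 => norm_num [shg]
    | (k+3) => norm_num [shg]
  linarith

variable {I W : Finset V}

lemma Cfg.classes (h : Cfg G I W) (k q : ℕ) (hk : 52 + 3 * (2 * k + 1) < 4 * I.card)
    (hM : ∀ u ∈ W.filter (fun u => nb G I u = k + 1),
      nb G (W.filter (fun u => nb G I u = k + 1)) u ≤ q) :
    ((W.filter (fun u => nb G I u ≤ k)).card : ℝ)
      + shf q * ((W.filter (fun u => nb G I u = k + 1)).card : ℝ) ≤ 26 := by
  classical
  set L := W.filter (fun u => nb G I u ≤ k) with hL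
  set M := W.filter (fun u => nb G I u = k + 1) with hMdef
  have hd : Disjoint L M := by
    rw [hL, hMdef, disjoint_filter]
    intro u _ h; omega
  have hsub : L ∪ M ⊆ W := union_subset (filter_subset _ _) (filter_subset _ _)
  have hno : ∀ a ∈ L, ∀ b ∈ L ∪ M, ¬ G.Adj a b := by
    intro a ha b hb hab
    have ha := mem_filter.1 ha
    have := h.edge ha.1 (hsub hb) hab
    rcases mem_union.1 hb with hb | hb
    · have hb := mem_filter.1 hb
      omega
    · have hb := mem_filter.1 hb
      omega
  have h1 := h.shear hsub
  rw [sum_union hd] at h1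
  have h2 : ∑ u ∈ L, (1:ℝ) ≤ ∑ u ∈ L, shf (nb G (L ∪ M) u) := by
    refine sum_le_sum (fun u hu => ?_)
    have : nb G (L ∪ M) u = 0 := by
      unfold nb
      rw [card_eq_zero, filter_eq_empty_iff]
      intro b hb
      exact hno u hu b hb
    rw [this]; simp [shf]
  have h3 : ∑ u ∈ M, shf q ≤ ∑ u ∈ M, shf (nb G (L ∪ M) u) := by
    refine sum_le_sum (fun u hu => shf_anti ?_)
    refine le_trans ?_ (hM u hu)
    unfold nb
    apply card_le_card
    intro b hb
    have hb := mem_filter.1 hb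
    refine mem_filter.2 ⟨?_, hb.2⟩
    rcases mem_union.1 hb.1 with h5 | h5
    · exact (hno b h5 u (mem_union_right _ hu) hb.2.symm).elim
    · exact h5
  rw [sum_const, nsmul_eq_mul] at h2 h3
  linarith

lemma Cfg.d17 (h : Cfg G I W) (hd : I.card = 17) (hm : W.card = 86) : False := by
  classical
  have hM : ∀ u ∈ W.filter (fun u => nb G I u = 2 + 1),
      nb G (W.filter (fun u => nb G I u = 2 + 1)) u ≤ 1 := by
    intro u hu
    by_contra hcon
    have hc : 2 ≤ nb G (W.filter (fun u => nb G I u = 2 + 1)) u := by omega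
    unfold nb at hc
    obtain ⟨N, hN, hNc⟩ := exists_subset_card_eq hc
    have hN1 : ∀ w ∈ N, (w ∈ W ∧ nb G I w = 3) ∧ G.Adj u w := by
      intro w hw
      have := mem_filter.1 (hN hw)
      exact ⟨mem_filter.1 this.1, this.2⟩
    have hs := h.star (mem_filter.1 hu).1 (fun w hw => (hN1 w hw).1.1) (fun w hw => (hN1 w hw).2) 3
      (mem_filter.1 hu).2 (fun w hw => (hN1 w hw).1.2)
    have e := sum_swap (G := G) (I := I) N
    have e' : ∑ w ∈ N, (nb G I w : ℝ) = ∑ w ∈ N, (3:ℝ) :=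
      sum_congr rfl (fun w hw => by rw [(hN1 w hw).1.2]; norm_num)
    rw [e', sum_const, nsmul_eq_mul, hNc] at e
    have e2 : ∑ v ∈ I, (nb G N v : ℝ) ≤ ∑ v ∈ I, (nb G N v : ℝ) ^ 2 := by
      refine sum_le_sum (fun v _ => ?_)
      have : nb G N v ≤ nb G N v ^ 2 := Nat.le_self_pow (by norm_num) _
      exact_mod_cast this
    rw [hd, hNc] at hs
    norm_num at hs e
    linarith
  have h0 := h.classes 2 1 (by omega) hM
  have hi := h.low_indep 2 (by omega)
  have hlin := h.lin (filter_subset _ _) hi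
  have h2' := split3 W (nb G I) 2
  have h3 := h.total
  have hT0 : 0 ≤ ∑ u ∈ W.filter (fun u => nb G I u ≤ 2), (nb G I u : ℝ) :=
    sum_nonneg (fun w hw => Nat.cast_nonneg _)
  set L := W.filter (fun u => nb G I u ≤ 2) with hL
  set M := W.filter (fun u => nb G I u = 2 + 1) with hM
  generalize ∑ u ∈ L, (nb G I u : ℝ) = T at *
  rw [hd] at h3 hlin
  rw [hm] at h2'
  norm_num [shf] at h0 h2' h3 hlin
  rcases Nat.eq_zero_or_pos L.card with hz | hz
  · rw [hz] at h2' h0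
    norm_num at h2' h0
    linarith
  · have := hlin (card_pos.1 hz)
    have : (1:ℝ) ≤ L.card := by exact_mod_cast hz
    linarith

lemma Cfg.d19 (h : Cfg G I W) (hd : I.card = 19) (hm : W.card = 85) : False := by
  classical
  have hM : ∀ u ∈ W.filter (fun u => nb G I u = 3 + 1),
      nb G (W.filter (fun u => nb G I u = 3 + 1)) u ≤ 3 := by
    intro u hu
    by_contra hcon
    have hc : 4 ≤ nb G (W.filter (fun u => nb G I u = 3 + 1)) u := by omega
    unfold nb at hc
    obtain ⟨N, hN, hNc⟩ := exists_subset_card_eq hc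
    have hN1 : ∀ w ∈ N, (w ∈ W ∧ nb G I w = 4) ∧ G.Adj u w := by
      intro w hw
      have := mem_filter.1 (hN hw)
      exact ⟨mem_filter.1 this.1, this.2⟩
    have hu := mem_filter.1 hu
    have hs := h.star hu.1 (fun w hw => (hN1 w hw).1.1) (fun w hw => (hN1 w hw).2) 4
      hu.2 (fun w hw => (hN1 w hw).1.2)
    have e := sum_swap (G := G) (I := I) N
    have e' : ∑ w ∈ N, (nb G I w : ℝ) = ∑ w ∈ N, (4:ℝ) :=
      sum_congr rfl (fun w hw => by rw [(hN1 w hw).1.2]; norm_num)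
    rw [e', sum_const, nsmul_eq_mul, hNc] at e
    have e2 : ∑ v ∈ I, (3 * (nb G N v : ℝ) - 2 + 2 * aR G u v) ≤ ∑ v ∈ I, (nb G N v : ℝ) ^ 2 := by
      refine sum_le_sum (fun v hv => ?_)
      by_cases huv : G.Adj u v
      · have h0 : (nb G N v : ℝ) = 0 := by
          rw [← sum_aR]
          refine sum_eq_zero (fun w hw => aR_not G (fun hvw => ?_))
          exact h.hcom u hu.1 w (hN1 w hw).1.1 v hv (hN1 w hw).2 hvw.symm huv
        rw [h0, aR_adj G huv]; norm_num
      · rw [aR_not G huv]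
        have : 3 * nb G N v ≤ nb G N v ^ 2 + 2 := by
          rcases Nat.lt_or_ge (nb G N v) 2 with hh | hh
          · interval_cases nb G N v <;> norm_num
          · nlinarith
        have : 3 * (nb G N v : ℝ) ≤ (nb G N v : ℝ) ^ 2 + 2 := by exact_mod_cast this
        linarith
    rw [sum_add_distrib, sum_sub_distrib, ← mul_sum, ← mul_sum, sum_aR, sum_const, nsmul_eq_mul, hd,
      hu.2] at e2
    rw [hd, hNc] at hs
    norm_num at hs e e2
    linarith
  have h0 := h.classes 3 3 (by omega) hM
  have hi := h.low_indep 3 (by omega)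
  have hlin := h.lin (filter_subset _ _) hi
  have h2' := split3 W (nb G I) 3
  have h3 := h.total
  have hT0 : 0 ≤ ∑ u ∈ W.filter (fun u => nb G I u ≤ 3), (nb G I u : ℝ) :=
    sum_nonneg (fun w hw => Nat.cast_nonneg _)
  set L := W.filter (fun u => nb G I u ≤ 3) with hL
  set M := W.filter (fun u => nb G I u = 3 + 1) with hM
  generalize ∑ u ∈ L, (nb G I u : ℝ) = T at *
  rw [hd] at h3 hlin
  rw [hm] at h2'
  norm_num [shf] at h0 h2' h3 hlin
  rcases Nat.eq_zero_or_pos L.card with hz | hz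
  · rw [hz] at h2' h0
    norm_num at h2' h0
    linarith
  · have := hlin (card_pos.1 hz)
    have : (1:ℝ) ≤ L.card := by exact_mod_cast hz
    linarith

lemma Cfg.core (h : Cfg G I W) (hd : I.card ≤ 27) : 3 * W.card + I.card ≤ 273 := by
  by_contra hcon
  rcases Nat.lt_or_ge 22 I.card with hhi | hlo
  · have := h.highd hhi
    omega
  · have hc : (276 - I.card) / 3 ≤ W.card := by omega
    obtain ⟨W', hW', hm⟩ := exists_subset_card_eq hc
    have h' := h.mono hW'
    rcases Nat.lt_or_ge I.card 5 with h5 | h5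
    · exact h'.lowd (by omega) (by omega)
    rcases Nat.lt_or_ge I.card 17 with h17 | h17
    · exact h'.midd (by omega) (by omega) hm
    have : I.card = 17 ∨ I.card = 18 ∨ I.card = 19 ∨ I.card = 20 ∨ I.card = 21 ∨ I.card = 22 := by
      omega
    rcases this with hh | hh | hh | hh | hh | hh
    · exact h'.d17 hh (by omega)
    · exact h'.d18 hh (by omega)
    · exact h'.d19 hh (by omega)
    · exact h'.d20 hh (by omega)
    · exact h'.d21 hh (by omega)
    · exact h'.d22 hh (by omega)
end

section
variable {V : Type*} {G : SimpleGraph V} {E : Type*} [NormedAddCommGroup E] [InnerProductSpace ℝ E]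

open Classical in
lemma qF_nonneg (I W : Finset V) (a b : V → E)
    (haa : ∀ u ∈ W, ∀ w ∈ W, inner ℝ (a u) (a w) = 4 / 9 + (if u = w then 4 else 0) - 2 * aR G u w)
    (hbb : ∀ u ∈ I, ∀ w ∈ I, inner ℝ (b u) (b w) = (if u = w then 4 else 0))
    (hab : ∀ u ∈ W, ∀ w ∈ I, inner ℝ (a u) (b w) = 2 / 3 - 2 * aR G u w) (y : V → ℝ) :
    0 ≤ qF G I W y := by
  set Y := ∑ u ∈ W, y u with hY
  set X : V → ℝ := fun v => ∑ u ∈ W, aR G u v * y u with hX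
  set c : V → ℝ := fun v => (Y - 3 * X v) / 6 with hc
  set A : E := ∑ u ∈ W, y u • a u with hA
  set B : E := ∑ v ∈ I, c v • b v with hB
  have h0 : 0 ≤ inner ℝ (A - B) (A - B) := real_inner_self_nonneg
  have e : inner ℝ (A - B) (A - B) = inner ℝ A A - 2 * inner ℝ A B + inner ℝ B B := by
    rw [inner_sub_left, inner_sub_right, inner_sub_right, real_inner_comm A B]; ring
  have eAA : inner ℝ A A = 4 / 9 * Y ^ 2 + 4 * ∑ u ∈ W, y u ^ 2
      - 2 * ∑ u ∈ W, ∑ w ∈ W, aR G u w * (y u * y w) := by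
    rw [hA, sum_inner]
    have : ∀ u ∈ W, inner ℝ (y u • a u) (∑ w ∈ W, y w • a w)
        = 4 / 9 * (y u * Y) + 4 * y u ^ 2 - 2 * ∑ w ∈ W, aR G u w * (y u * y w) := by
      intro u hu
      rw [inner_sum, hY, mul_sum, mul_sum, mul_sum]
      have h4 : 4 * y u ^ 2 = ∑ w ∈ W, if u = w then 4 * (y u * y w) else 0 := by
        rw [sum_ite_eq]; simp [hu]; ring
      rw [h4, ← sum_add_distrib, ← sum_sub_distrib]
      refine sum_congr rfl (fun w hw => ?_)
      rw [inner_smul_left, inner_smul_right, haa u hu w hw]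
      simp only [RCLike.conj_to_real]
      split_ifs <;> ring
    rw [sum_congr rfl this, sum_sub_distrib, sum_add_distrib, ← mul_sum, ← mul_sum, ← mul_sum,
      ← sum_mul]
    rw [← hY]; ring
  have eAB : inner ℝ A B = 4 * ∑ v ∈ I, c v ^ 2 := by
    rw [hA, hB, inner_sum, mul_sum]
    refine sum_congr rfl (fun v hv => ?_)
    rw [sum_inner]
    have : ∀ u ∈ W, inner ℝ (y u • a u) (c v • b v) = c v * (2 / 3 * y u - 2 * (aR G u v * y u)) := by
      intro u hu
      rw [inner_smul_left, inner_smul_right, hab u hu v hv]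
      simp only [RCLike.conj_to_real]
      ring
    rw [sum_congr rfl this, ← mul_sum, sum_sub_distrib, ← mul_sum, ← mul_sum, ← hY]
    simp only [hc, hX]
    ring
  have eBB : inner ℝ B B = 4 * ∑ v ∈ I, c v ^ 2 := by
    rw [hB, sum_inner, mul_sum]
    refine sum_congr rfl (fun v hv => ?_)
    rw [inner_sum]
    have : ∀ w ∈ I, inner ℝ (c v • b v) (c w • b w) = if v = w then 4 * (c v * c w) else 0 := by
      intro w hw
      rw [inner_smul_left, inner_smul_right, hbb v hv w hw]
      simp only [RCLike.conj_to_real]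
      split_ifs <;> ring
    rw [sum_congr rfl this, sum_ite_eq]
    simp [hv]; ring
  have eT : ∑ v ∈ I, X v = ∑ u ∈ W, y u * nb G I u := by
    simp only [hX]
    rw [sum_comm]
    refine sum_congr rfl (fun u _ => ?_)
    rw [← sum_mul, sum_aR]; ring
  have eC : 36 * ∑ v ∈ I, c v ^ 2 = (I.card : ℝ) * Y ^ 2 - 6 * Y * ∑ v ∈ I, X v + 9 * ∑ v ∈ I, X v ^ 2 := by
    have : (I.card : ℝ) * Y ^ 2 = ∑ v ∈ I, Y ^ 2 := by rw [sum_const, nsmul_eq_mul]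
    rw [this, mul_sum I (fun v => c v ^ 2) 36, mul_sum I X (6 * Y), mul_sum I (fun v => X v ^ 2) 9,
      ← sum_sub_distrib, ← sum_add_distrib]
    refine sum_congr rfl (fun v _ => ?_)
    simp only [hc]; ring
  unfold qF
  rw [← hY, ← eT]
  have h9 : 0 ≤ inner ℝ A A - 2 * inner ℝ A B + inner ℝ B B := by rw [← e]; exact h0
  rw [eAA, eAB, eBB] at h9
  change 0 ≤ 36 * ∑ u ∈ W, y u ^ 2 - 18 * ∑ u ∈ W, ∑ w ∈ W, aR G u w * (y u * y w)
    - ((I.card : ℝ) - 4) * Y ^ 2 + 6 * Y * (∑ v ∈ I, X v) - 9 * ∑ v ∈ I, X v ^ 2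
  linarith

/-- A system of signed equiangular vectors with its adjacency graph. -/
structure Sys {V : Type*} (G : SimpleGraph V) (vec : V → E) (neg : V → V) : Prop where
  hneg : ∀ x, vec (neg x) = - vec x
  hself : ∀ x, inner ℝ (vec x) (vec x) = (5:ℝ)
  hpm : ∀ x y, x ≠ y → x ≠ neg y → inner ℝ (vec x) (vec y) = (1:ℝ) ∨ inner ℝ (vec x) (vec y) = (-1:ℝ)
  hadj : ∀ x y, G.Adj x y ↔ inner ℝ (vec x) (vec y) = (-1:ℝ)
  hK : ∀ S : Finset V, (∀ x ∈ S, ∀ y ∈ S, x ≠ y → G.Adj x y) → S.card ≤ 4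
  hA : ∀ S : Finset V, (∀ x ∈ S, ∀ y ∈ S, x ≠ y → inner ℝ (vec x) (vec y) = (1:ℝ)) → S.card ≤ 28

variable {vec : V → E} {neg : V → V}

lemma Sys.noK5 (h : Sys G vec neg) {a b c d e : V} (h1 : G.Adj a b) (h2 : G.Adj a c) (h3 : G.Adj a d)
    (h4 : G.Adj a e) (h5 : G.Adj b c) (h6 : G.Adj b d) (h7 : G.Adj b e) (h8 : G.Adj c d)
    (h9 : G.Adj c e) (h10 : G.Adj d e) : False := by
  classical
  have := h.hK {a, b, c, d, e} (by
    intro x hx y hy hxy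
    simp only [mem_insert, mem_singleton] at hx hy
    rcases hx with rfl | rfl | rfl | rfl | rfl <;> rcases hy with rfl | rfl | rfl | rfl | rfl <;>
      first | exact absurd rfl hxy | assumption | (apply SimpleGraph.Adj.symm; assumption))
  have hc : ({a, b, c, d, e} : Finset V).card = 5 := by
    rw [card_insert_of_notMem, card_insert_of_notMem, card_insert_of_notMem, card_insert_of_notMem,
      card_singleton]
    · simpa using h10.ne
    · simpa using ⟨h8.ne, h9.ne⟩
    · simpa using ⟨h5.ne, h6.ne, h7.ne⟩
    · simpa using ⟨h1.ne, h2.ne, h3.ne, h4.ne⟩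
  omega

/-- `g` abbreviates the inner product of two vectors. -/
noncomputable def gI (vec : V → E) (x y : V) : ℝ := inner ℝ (vec x) (vec y)

lemma gI_comm (x y : V) : gI vec x y = gI vec y x := real_inner_comm _ _

lemma Sys.g_neg_left (h : Sys G vec neg) (x y : V) : gI vec (neg x) y = - gI vec x y := by
  simp [gI, h.hneg]

lemma Sys.g_neg_right (h : Sys G vec neg) (x y : V) : gI vec x (neg y) = - gI vec x y := by
  simp [gI, h.hneg]

lemma Sys.g_self (h : Sys G vec neg) (x : V) : gI vec x x = 5 := h.hself x

lemma Sys.g_adj (h : Sys G vec neg) {x y : V} : G.Adj x y ↔ gI vec x y = -1 := h.hadj x y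

lemma Sys.ne_of (h : Sys G vec neg) {x y z : V} (hh : gI vec x z ≠ gI vec y z) : x ≠ y := by
  rintro rfl; exact hh rfl

lemma Sys.g_eq (h : Sys G vec neg) {x y : V} (h1 : x ≠ y) (h2 : x ≠ neg y) :
    gI vec x y = 1 - 2 * aR G x y := by
  rcases h.hpm x y h1 h2 with h3 | h3
  · rw [aR_not]
    · simpa [gI] using h3
    · rw [h.hadj, h3]; norm_num
  · rw [aR_adj G ((h.hadj x y).2 h3)]
    norm_num; exact h3

variable [Fintype V]

open Classical in
/-- Common neighbourhood of a triple. -/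
noncomputable def cI (vec : V → E) (p q r : V) : Finset V :=
  univ.filter (fun z => gI vec z p = -1 ∧ gI vec z q = -1 ∧ gI vec z r = -1)

open Classical in
/-- Vertices with sign pattern `(+,-,-)`. -/
noncomputable def cW (vec : V → E) (p q r : V) : Finset V :=
  univ.filter (fun z => gI vec z p = 1 ∧ gI vec z q = -1 ∧ gI vec z r = -1)

lemma mem_cI {p q r z : V} : z ∈ cI vec p q r ↔ gI vec z p = -1 ∧ gI vec z q = -1 ∧ gI vec z r = -1 := by
  simp [cI]

lemma mem_cW {p q r z : V} : z ∈ cW vec p q r ↔ gI vec z p = 1 ∧ gI vec z q = -1 ∧ gI vec z r = -1 := by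
  simp [cW]

lemma Sys.cI_indep (h : Sys G vec neg) {p q r : V} (hpq : gI vec p q = -1) (hpr : gI vec p r = -1)
    (hqr : gI vec q r = -1) {x y : V} (hx : x ∈ cI vec p q r) (hy : y ∈ cI vec p q r) (hne : x ≠ y) :
    gI vec x y = 1 := by
  rw [mem_cI] at hx hy
  have h2 : x ≠ neg y := h.ne_of (z := p) (by rw [h.g_neg_left, hx.1, hy.1]; norm_num)
  rcases h.hpm x y hne h2 with h3 | h3
  · exact h3
  · exact (h.noK5 (h.g_adj.2 h3) (h.g_adj.2 hx.1) (h.g_adj.2 hx.2.1) (h.g_adj.2 hx.2.2)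
      (h.g_adj.2 hy.1) (h.g_adj.2 hy.2.1) (h.g_adj.2 hy.2.2) (h.g_adj.2 hpq) (h.g_adj.2 hpr)
      (h.g_adj.2 hqr)).elim

lemma Sys.cI_card (h : Sys G vec neg) {p q r : V} (hpq : gI vec p q = -1) (hpr : gI vec p r = -1)
    (hqr : gI vec q r = -1) : (cI vec p q r).card ≤ 27 := by
  classical
  have hp : neg p ∉ cI vec p q r := by
    rw [mem_cI, h.g_neg_left, h.g_self]; norm_num
  have := h.hA (insert (neg p) (cI vec p q r)) (by
    intro x hx y hy hxy
    change gI vec x y = 1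
    rcases mem_insert.1 hx with hx | hx <;> rcases mem_insert.1 hy with hy | hy
    · exact absurd (hx.trans hy.symm) hxy
    · rw [hx, h.g_neg_left, gI_comm, (mem_cI.1 hy).1]; norm_num
    · rw [hy, h.g_neg_right, (mem_cI.1 hx).1]; norm_num
    · exact h.cI_indep hpq hpr hqr hx hy hxy)
  rw [card_insert_of_notMem hp] at this
  omega

lemma Sys.cfg (h : Sys G vec neg) {p q r : V} (hpq : gI vec p q = -1) (hpr : gI vec p r = -1)
    (hqr : gI vec q r = -1)
    (hmax : ∀ x y z, gI vec x y = -1 → gI vec x z = -1 → gI vec y z = -1 →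
      (cI vec x y z).card ≤ (cI vec p q r).card) :
    Cfg G (cI vec p q r) (cW vec p q r) where
  hQ := by
    classical
    intro W' hW' y
    have hqp := (gI_comm (vec := vec) q p).trans hpq
    have hrp := (gI_comm (vec := vec) r p).trans hpr
    have hrq := (gI_comm (vec := vec) r q).trans hqr
    have hpp := h.g_self p
    have hqq := h.g_self q
    have hrr := h.g_self r
    unfold gI at hqp hrp hrq hpq hpr hqr hpp hqq hrr
    refine qF_nonneg (cI vec p q r) W'
      (fun u => vec u - (1/9:ℝ) • vec p + (2/9:ℝ) • vec q + (2/9:ℝ) • vec r)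
      (fun v => vec v + (1/3:ℝ) • vec p + (1/3:ℝ) • vec q + (1/3:ℝ) • vec r) ?_ ?_ ?_ y
    · intro u hu w hw
      have hu1 := mem_cW.1 (hW' hu)
      have hw1 := mem_cW.1 (hW' hw)
      have huw : gI vec u w = 1 + (if u = w then 4 else 0) - 2 * aR G u w := by
        split_ifs with hh
        · rw [hh, h.g_self, aR_self]; norm_num
        · rw [h.g_eq hh (h.ne_of (z := p) (by rw [h.g_neg_left, hu1.1, hw1.1]; norm_num))]; ring
      rw [gI_comm w p, gI_comm w q, gI_comm w r] at hw1
      unfold gI at hu1 hw1 huw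
      simp only [inner_add_left, inner_add_right, inner_sub_left, inner_sub_right, inner_smul_left,
        inner_smul_right, RCLike.conj_to_real, hu1, hw1, hpq, hpr, hqr, hqp, hrp, hrq, hpp, hqq, hrr, huw]
      ring
    · intro u hu w hw
      have huw : gI vec u w = 1 + (if u = w then 4 else 0) := by
        split_ifs with hh
        · rw [hh, h.g_self]; norm_num
        · rw [h.cI_indep hpq hpr hqr hu hw hh]; norm_num
      have hu1 := mem_cI.1 hu
      have hw1 := mem_cI.1 hw
      rw [gI_comm w p, gI_comm w q, gI_comm w r] at hw1
      unfold gI at hu1 hw1 huw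
      simp only [inner_add_left, inner_add_right, inner_sub_left, inner_sub_right, inner_smul_left,
        inner_smul_right, RCLike.conj_to_real, hu1, hw1, hpq, hpr, hqr, hqp, hrp, hrq, hpp, hqq, hrr, huw]
      ring
    · intro u hu w hw
      have hu1 := mem_cW.1 (hW' hu)
      have hw1 := mem_cI.1 hw
      have huw : gI vec u w = 1 - 2 * aR G u w := by
        apply h.g_eq
        · exact h.ne_of (z := p) (by rw [hu1.1, hw1.1]; norm_num)
        · exact h.ne_of (z := q) (by rw [h.g_neg_left, hu1.2.1, hw1.2.1]; norm_num)
      rw [gI_comm w p, gI_comm w q, gI_comm w r] at hw1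
      unfold gI at hu1 hw1 huw
      simp only [inner_add_left, inner_add_right, inner_sub_left, inner_sub_right, inner_smul_left,
        inner_smul_right, RCLike.conj_to_real, hu1, hw1, hpq, hpr, hqr, hqp, hrp, hrq, hpp, hqq, hrr, huw]
      ring
  htri := by
    intro x hx y hy z hz hxy hyz hxz
    have hx := mem_cW.1 hx
    have hy := mem_cW.1 hy
    have hz := mem_cW.1 hz
    exact h.noK5 hxy hxz (h.g_adj.2 hx.2.1) (h.g_adj.2 hx.2.2) hyz (h.g_adj.2 hy.2.1)
      (h.g_adj.2 hy.2.2) (h.g_adj.2 hz.2.1) (h.g_adj.2 hz.2.2) (h.g_adj.2 hqr)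
  hcom := by
    intro x hx y hy z hz hxy hyz hxz
    have hx := mem_cW.1 hx
    have hy := mem_cW.1 hy
    have hz := mem_cI.1 hz
    exact h.noK5 hxy hxz (h.g_adj.2 hx.2.1) (h.g_adj.2 hx.2.2) hyz (h.g_adj.2 hy.2.1)
      (h.g_adj.2 hy.2.2) (h.g_adj.2 hz.2.1) (h.g_adj.2 hz.2.2) (h.g_adj.2 hqr)
  hα := by
    classical
    intro S hS hi
    have hS1 : ∀ x ∈ S, _ := fun x hx => mem_cW.1 (hS hx)
    have hq : neg q ∉ S := fun hh => by
      have := (hS1 _ hh).2.1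
      rw [h.g_neg_left, h.g_self] at this; norm_num at this
    have hp : p ∉ insert (neg q) S := fun hh => by
      rcases mem_insert.1 hh with hh | hh
      · have h5 := h.g_self p
        nth_rewrite 2 [hh] at h5
        rw [h.g_neg_right, hpq] at h5; norm_num at h5
      · have := (hS1 _ hh).1
        rw [h.g_self] at this; norm_num at this
    have := h.hA (insert p (insert (neg q) S)) (by
      intro x hx y hy hxy
      change gI vec x y = 1
      simp only [mem_insert] at hx hy
      rcases hx with hx | hx | hx <;> rcases hy with hy | hy | hy
      · exact absurd (hx.trans hy.symm) hxy
      · rw [hx, hy, h.g_neg_right, hpq]; norm_num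
      · rw [hx, gI_comm, (hS1 y hy).1]
      · rw [hx, hy, h.g_neg_left, gI_comm, hpq]; norm_num
      · exact absurd (hx.trans hy.symm) hxy
      · rw [hx, h.g_neg_left, gI_comm, (hS1 y hy).2.1]; norm_num
      · rw [hy, (hS1 x hx).1]
      · rw [hy, h.g_neg_right, (hS1 x hx).2.1]; norm_num
      · rw [h.g_eq hxy, aR_not G (hi x hx y hy)]
        · norm_num
        · exact h.ne_of (z := p) (by rw [h.g_neg_left, (hS1 x hx).1, (hS1 y hy).1]; norm_num))
    rw [card_insert_of_notMem hp, card_insert_of_notMem hq] at this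
    omega
  hx := by
    classical
    intro v hv
    have hv := mem_cI.1 hv
    have h1 := hmax q r v hqr (by rw [gI_comm]; exact hv.2.1) (by rw [gI_comm]; exact hv.2.2)
    refine le_trans ?_ h1
    unfold nb
    rw [← card_insert_of_notMem (a := p)]
    · apply card_le_card
      intro x hx
      rw [mem_cI]
      rcases mem_insert.1 hx with hx | hx
      · rw [hx]
        exact ⟨hpq, hpr, by rw [gI_comm]; exact hv.1⟩
      · have hx := mem_filter.1 hx
        have hxw := mem_cW.1 hx.1
        exact ⟨hxw.2.1, hxw.2.2, h.g_adj.1 hx.2.symm⟩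
    · intro hh
      have := (mem_cW.1 (mem_filter.1 hh).1).1
      rw [h.g_self] at this; norm_num at this
  hdeg := by
    classical
    intro v hv
    have hv := mem_cW.1 hv
    have h1 := hmax q r v hqr (by rw [gI_comm]; exact hv.2.1) (by rw [gI_comm]; exact hv.2.2)
    refine le_trans ?_ h1
    unfold nb
    apply card_le_card
    intro x hx
    rw [mem_cI]
    have hx := mem_filter.1 hx
    have hxw := mem_cW.1 hx.1
    exact ⟨hxw.2.1, hxw.2.2, h.g_adj.1 hx.2.symm⟩

lemma Sys.main (h : Sys G vec neg) (hinv : ∀ x, neg (neg x) = x)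
    (ht : ∃ p q r, gI vec p q = -1 ∧ gI vec p r = -1 ∧ gI vec q r = -1) :
    Fintype.card V ≤ 552 := by
  classical
  obtain ⟨⟨p, q, r⟩, hpm, hmax⟩ := exists_max_image
    (univ.filter (fun t : V × V × V => gI vec t.1 t.2.1 = -1 ∧ gI vec t.1 t.2.2 = -1 ∧ gI vec t.2.1 t.2.2 = -1))
    (fun t => (cI vec t.1 t.2.1 t.2.2).card) (by
      obtain ⟨p, q, r, hh⟩ := ht
      exact ⟨(p, q, r), by simpa using hh⟩)
  simp only [mem_filter, mem_univ, true_and] at hpm hmax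
  obtain ⟨hpq, hpr, hqr⟩ := hpm
  have hmax1 : ∀ x y z, gI vec x y = -1 → gI vec x z = -1 → gI vec y z = -1 →
      (cI vec x y z).card ≤ (cI vec p q r).card := fun x y z h1 h2 h3 => hmax (x, y, z) ⟨h1, h2, h3⟩
  have hqp := (gI_comm (vec := vec) q p).trans hpq
  have hrp := (gI_comm (vec := vec) r p).trans hpr
  have hrq := (gI_comm (vec := vec) r q).trans hqr
  have e1 : cI vec q p r = cI vec p q r := by ext z; simp only [mem_cI]; tauto
  have e2 : cI vec r p q = cI vec p q r := by ext z; simp only [mem_cI]; tauto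
  have hd := h.cI_card hpq hpr hqr
  have c0 := (h.cfg hpq hpr hqr hmax1).core hd
  have c1 := (h.cfg hqp hqr hpr (by rw [e1]; exact hmax1)).core (by rw [e1]; exact hd)
  have c2 := (h.cfg hrp hrq hpq (by rw [e2]; exact hmax1)).core (by rw [e2]; exact hd)
  rw [e1] at c1
  rw [e2] at c2
  set U : Finset V := {p, q, r} ∪ (cI vec p q r ∪ (cW vec p q r ∪ (cW vec q p r ∪ cW vec r p q))) with hU
  have hUc : U.card ≤ 3 + ((cI vec p q r).card + ((cW vec p q r).card + ((cW vec q p r).card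
      + (cW vec r p q).card))) := by
    refine (card_union_le _ _).trans (add_le_add card_le_three ?_)
    refine (card_union_le _ _).trans (add_le_add le_rfl ?_)
    refine (card_union_le _ _).trans (add_le_add le_rfl ?_)
    exact card_union_le _ _
  have hmem : ∀ z, z ∈ U ↔ (z = p ∨ z = q ∨ z = r) ∨ z ∈ cI vec p q r ∨ z ∈ cW vec p q r
      ∨ z ∈ cW vec q p r ∨ z ∈ cW vec r p q := by
    intro z; simp [hU, or_assoc]
  have hcov : (univ : Finset V) ⊆ U ∪ U.image neg := by
    intro z _
    rw [mem_union]
    by_contra hcon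
    push Not at hcon
    obtain ⟨hz1, hz2⟩ := hcon
    have hz2 : neg z ∉ U := fun hh => hz2 (mem_image.2 ⟨neg z, hh, hinv z⟩)
    rw [hmem] at hz1 hz2
    simp only [mem_cI, mem_cW, h.g_neg_left] at hz1 hz2
    have hsgn : ∀ a, (z ≠ a) → (neg z ≠ a) → gI vec z a = 1 ∨ gI vec z a = -1 := by
      intro a h1 h2
      exact h.hpm z a h1 (fun hh => h2 (by rw [hh, hinv]))
    push Not at hz1 hz2
    have s1 := hsgn p hz1.1.1 hz2.1.1
    have s2 := hsgn q hz1.1.2.1 hz2.1.2.1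
    have s3 := hsgn r hz1.1.2.2 hz2.1.2.2
    obtain ⟨-, a1, a2, a3, a4⟩ := hz1
    obtain ⟨-, b1, b2, b3, b4⟩ := hz2
    rcases s1 with s1 | s1 <;> rcases s2 with s2 | s2 <;> rcases s3 with s3 | s3 <;>
      simp [s1, s2, s3] at a1 a2 a3 a4 b1 b2 b3 b4
  have := card_le_card hcov
  rw [card_univ] at this
  have h7 := card_union_le U (U.image neg)
  have h8 : (U.image neg).card ≤ U.card := card_image_le
  omega
end

end FinsetPart

lemma psd_vecs {n : ℕ} (S : Matrix (Fin n) (Fin n) ℝ) (hS : S.IsSymm) (hmin : minEig S = -5) :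
    ∃ f : Fin n → EuclideanSpace ℝ (Fin n), ∀ i j, inner ℝ (f i) (f j) = S i j + if i = j then 5 else 0 := by
  have hA : S.IsHermitian := by
    rw [Matrix.IsHermitian, Matrix.conjTranspose_eq_transpose_of_trivial]; exact hS
  have hlam : ∀ k, 0 ≤ hA.eigenvalues k + 5 := by
    intro k
    unfold minEig at hmin
    rw [dif_pos hA] at hmin
    have := ciInf_le (Set.finite_range hA.eigenvalues).bddBelow k
    linarith
  set U : Matrix (Fin n) (Fin n) ℝ := (hA.eigenvectorUnitary : Matrix (Fin n) (Fin n) ℝ) with hU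
  have h1 : ∀ i j, S i j = ∑ k, hA.eigenvalues k * (U i k * U j k) := by
    intro i j
    have := congrFun (congrFun hA.spectral_theorem i) j
    rw [Unitary.conjStarAlgAut_apply, Matrix.mul_apply] at this
    rw [this]
    refine Finset.sum_congr rfl (fun k _ => ?_)
    rw [Matrix.mul_diagonal, Matrix.star_apply]
    simp [hU]
    ring
  have h2 : ∀ i j, ∑ k, U i k * U j k = if i = j then (1:ℝ) else 0 := by
    intro i j
    have h3 : U * star U = 1 := Unitary.mul_star_self_of_mem hA.eigenvectorUnitary.2
    have := congrFun (congrFun h3 i) j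
    rw [Matrix.mul_apply, Matrix.one_apply] at this
    rw [← this]
    refine Finset.sum_congr rfl (fun k _ => ?_)
    rw [Matrix.star_apply]
    simp
  refine ⟨fun i => WithLp.toLp 2 (fun k => Real.sqrt (hA.eigenvalues k + 5) * U i k), ?_⟩
  intro i j
  have h5 : (if i = j then (5:ℝ) else 0) = ∑ k, 5 * (U i k * U j k) := by
    rw [← Finset.mul_sum, h2]; split_ifs <;> norm_num
  rw [h1, h5, ← Finset.sum_add_distrib, PiLp.inner_apply]
  refine Finset.sum_congr rfl (fun k _ => ?_)
  have h6 := Real.mul_self_sqrt (hlam k)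
  simp only [RCLike.inner_apply, RCLike.conj_to_real]
  linear_combination (U i k * U j k) * h6

lemma sys_of_seidel {n : ℕ} (S : Matrix (Fin n) (Fin n) ℝ) (hS : IsSeidel S)
    (f : Fin n → EuclideanSpace ℝ (Fin n))
    (hf : ∀ i j, inner ℝ (f i) (f j) = S i j + if i = j then 5 else 0)
    (hω : (switchGraph S).cliqueNum = 4)
    (hα : indepNum (switchGraph S) ≤ 28) :
    Sys (switchGraph S) (Sum.elim f (fun i => - f i)) Sum.swap := by
  obtain ⟨hsym, hdiag, hoff⟩ := hS
  have hs : ∀ i j, S i j = S j i := fun i j => (hsym.apply j i)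
  have hadj : ∀ x y, (switchGraph S).Adj x y ↔
      inner ℝ (Sum.elim f (fun i => - f i) x) (Sum.elim f (fun i => - f i) y) = (-1:ℝ) := by
    have hd : ∀ i j : Fin n, i ≠ j → S i j = -1 → i ≠ j := fun _ _ h _ => h
    intro x y
    rcases x with i | i <;> rcases y with j | j <;> by_cases hij : i = j
    all_goals simp only [switchGraph, SimpleGraph.fromRel_adj, Matrix.fromBlocks_apply₁₁,
        Matrix.fromBlocks_apply₁₂, Matrix.fromBlocks_apply₂₁, Matrix.fromBlocks_apply₂₂,
        Matrix.sub_apply, Matrix.one_apply, Sum.elim_inl, Sum.elim_inr, inner_neg_left,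
        inner_neg_right, hf, hs j i, ne_eq, Sum.inl.injEq, Sum.inr.injEq, reduceCtorEq,
        not_false_eq_true, true_and, or_self, neg_neg]
    all_goals first
      | (subst hij; rw [hdiag]; norm_num)
      | (simp [hij, Ne.symm hij, fun h : j = i => hij h.symm])
  refine ⟨?_, ?_, ?_, hadj, ?_, ?_⟩
  · rintro (i | i) <;> simp
  · rintro (i | i) <;> simp only [Sum.elim_inl, Sum.elim_inr, inner_neg_left, inner_neg_right, neg_neg, hf, hdiag] <;> norm_num
  · have key : ∀ i j, i ≠ j → S i j = 1 ∨ S i j = -1 := hoff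
    rintro (i | i) (j | j) h1 h2
    · have hij : i ≠ j := fun h => h1 (by rw [h])
      rcases key i j hij with h | h <;> simp [hf, hij, h]
    · have hij : i ≠ j := fun h => h2 (by rw [h]; rfl)
      rcases key i j hij with h | h <;> simp [hf, hij, h]
    · have hij : i ≠ j := fun h => h2 (by rw [h]; rfl)
      rcases key i j hij with h | h <;> simp [hf, hij, h]
    · have hij : i ≠ j := fun h => h1 (by rw [h])
      rcases key i j hij with h | h <;> simp [hf, hij, h]
  · intro T hT
    rw [← hω]
    apply SimpleGraph.IsClique.card_le_cliqueNum
    intro x hx y hy hxy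
    exact hT x hx y hy hxy
  · intro T hT
    refine le_trans ?_ hα
    unfold indepNum
    apply SimpleGraph.IsClique.card_le_cliqueNum
    intro x hx y hy hxy
    rw [SimpleGraph.compl_adj]
    refine ⟨hxy, fun h => ?_⟩
    rw [hadj, hT x hx y hy hxy] at h
    norm_num at h

/-- If `S` is a Seidel matrix of order `n` with smallest eigenvalue exactly `-5`,
`ω([S]) = 4` and `α([S]) ≤ 28`, then `n ≤ 276`. -/
theorem stmt_1 {n : ℕ} (S : Matrix (Fin n) (Fin n) ℝ) (hS : IsSeidel S)
    (hmin : minEig S = -5)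
    (hω : (switchGraph S).cliqueNum = 4)
    (hα : indepNum (switchGraph S) ≤ 28) :
    n ≤ 276 := by
  obtain ⟨f, hf⟩ := psd_vecs S hS.1 hmin
  have hsys := sys_of_seidel S hS f hf hω hα
  have hcard := hsys.main Sum.swap_swap (by
    obtain ⟨T, hT⟩ := (switchGraph S).exists_isNClique_cliqueNum
    rw [hω] at hT
    obtain ⟨hcl, hc⟩ := hT
    obtain ⟨p, q, r, hp, hq, hr, hpq, hpr, hqr⟩ := Finset.two_lt_card_iff.1 (by omega : 2 < T.card)
    exact ⟨p, q, r, hsys.g_adj.1 (hcl hp hq hpq), hsys.g_adj.1 (hcl hp hr hpr),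
      hsys.g_adj.1 (hcl hq hr hqr)⟩)
  simp at hcard
  omega
end
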